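/- Let λ, μ ∈ ℂ^r both be dominant and let w, w′ ∈ W_r be such that w·μ and w′·μ both lie in S^{(n)}(λ;ℓ). Then the following are equivalent: (1) D_ℓ(K(λ, w·μ)) ≅ D_ℓ(K(λ, w′·μ)) as Y(gl_n)-modules; (2) some simple Y(gl_n)-module quotient of D_ℓ(K(λ, w·μ)) is isomorphic to some simple Y(gl_n)-module quotient of D_ℓ(K(λ, w′·μ)); (3) W_λ w W_μ = W_λ w′ W_μ, where W_λ and W_μ are the stabilizers of λ and μ in W_r. -/

import Mathlib

set_option synthInstance.maxHeartbeats 1000000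
set_option maxHeartbeats 1000000

noncomputable section

open scoped TensorProduct

/-- Generators of the degenerate affine Hecke algebra `H_ℓ`:
the group elements `w ∈ W_ℓ` and the polynomial generators `ε_i`. -/
inductive HGen (ℓ : ℕ) : Type
  | perm : Equiv.Perm (Fin ℓ) → HGen ℓ
  | eps : Fin ℓ → HGen ℓ

/-- Defining relations of the degenerate affine Hecke algebra: `ℂ[W_ℓ]` is a subalgebra,
`ℂ[ε_1,…,ε_ℓ]` is a (commutative polynomial) subalgebra, and the cross relation
`s_i ε_j − ε_{s_i(j)} s_i = −(δ_{i,j} − δ_{i+1,j})`. -/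
inductive HRel (ℓ : ℕ) : FreeAlgebra ℂ (HGen ℓ) → FreeAlgebra ℂ (HGen ℓ) → Prop
  | permMul (w w' : Equiv.Perm (Fin ℓ)) :
      HRel ℓ (FreeAlgebra.ι ℂ (HGen.perm w) * FreeAlgebra.ι ℂ (HGen.perm w'))
        (FreeAlgebra.ι ℂ (HGen.perm (w * w')))
  | permOne :
      HRel ℓ (FreeAlgebra.ι ℂ (HGen.perm 1)) 1
  | epsComm (i j : Fin ℓ) :
      HRel ℓ (FreeAlgebra.ι ℂ (HGen.eps i) * FreeAlgebra.ι ℂ (HGen.eps j))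
        (FreeAlgebra.ι ℂ (HGen.eps j) * FreeAlgebra.ι ℂ (HGen.eps i))
  | cross (i j : Fin ℓ) (h : (i : ℕ) + 1 < ℓ) :
      HRel ℓ
        (FreeAlgebra.ι ℂ (HGen.perm (Equiv.swap i ⟨(i : ℕ) + 1, h⟩)) *
            FreeAlgebra.ι ℂ (HGen.eps j) -
          FreeAlgebra.ι ℂ (HGen.eps (Equiv.swap i ⟨(i : ℕ) + 1, h⟩ j)) *
            FreeAlgebra.ι ℂ (HGen.perm (Equiv.swap i ⟨(i : ℕ) + 1, h⟩)))
        ((-(((if j = i then 1 else 0) : ℂ) - (if j = ⟨(i : ℕ) + 1, h⟩ then 1 else 0))) • 1)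

/-- The degenerate affine Hecke algebra `H_ℓ`, as the algebra presented by the above
generators and relations. -/
abbrev Hecke (ℓ : ℕ) : Type := RingQuot (HRel ℓ)

/-- The image of `w ∈ W_ℓ` in `H_ℓ`. -/
def Hecke.sigma {ℓ : ℕ} (w : Equiv.Perm (Fin ℓ)) : Hecke ℓ :=
  RingQuot.mkAlgHom ℂ (HRel ℓ) (FreeAlgebra.ι ℂ (HGen.perm w))

/-- The image of `ε_i` in `H_ℓ`. -/
def Hecke.eps {ℓ : ℕ} (i : Fin ℓ) : Hecke ℓ :=
  RingQuot.mkAlgHom ℂ (HRel ℓ) (FreeAlgebra.ι ℂ (HGen.eps i))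

/-- The elements `y_m := ε_m − Σ_{j<m} s_{jm}` of `H_ℓ`. -/
def Hecke.y {ℓ : ℕ} (m : Fin ℓ) : Hecke ℓ :=
  Hecke.eps m - ∑ j ∈ Finset.univ.filter (fun j : Fin ℓ => j < m), Hecke.sigma (Equiv.swap j m)

/-- Index type for the Yangian generators `t_{ij}^{(d)}`. -/
def tIdx (n : ℕ) : Type := Fin n × Fin n × ℕ

/-- `t_{ij}^{(d)}` in the free algebra, for `d : ℤ`, with the convention
`t_{ij}^{(-1)} = δ_{ij}·1` (and junk value `0` for `d ≤ -2`, which never occurs). -/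
def tFree {n : ℕ} (i j : Fin n) (d : ℤ) : FreeAlgebra ℂ (tIdx n) :=
  if d = -1 then (if i = j then 1 else 0)
  else if 0 ≤ d then FreeAlgebra.ι ℂ ((i, j, d.toNat) : tIdx n) else 0

/-- Defining relations of the Yangian `Y(gl_n)`:
`[t_{ij}^{(r)}, t_{kl}^{(s−1)}] − [t_{ij}^{(r−1)}, t_{kl}^{(s)}]
  = t_{kj}^{(r−1)} t_{il}^{(s−1)} − t_{kj}^{(s−1)} t_{il}^{(r−1)}`. -/
inductive YRel (n : ℕ) : FreeAlgebra ℂ (tIdx n) → FreeAlgebra ℂ (tIdx n) → Prop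
  | rel (i j k l : Fin n) (r s : ℕ) :
      YRel n
        (tFree i j (r : ℤ) * tFree k l ((s : ℤ) - 1) - tFree k l ((s : ℤ) - 1) * tFree i j (r : ℤ)
          - (tFree i j ((r : ℤ) - 1) * tFree k l (s : ℤ)
              - tFree k l (s : ℤ) * tFree i j ((r : ℤ) - 1)))
        (tFree k j ((r : ℤ) - 1) * tFree i l ((s : ℤ) - 1) -
          tFree k j ((s : ℤ) - 1) * tFree i l ((r : ℤ) - 1))

/-- The Yangian `Y(gl_n)`. -/
abbrev Yangian (n : ℕ) : Type := RingQuot (YRel n)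

/-- The generator `t_{ij}^{(d)}`, `d ≥ 0`, of the Yangian. -/
def Yangian.t {n : ℕ} (i j : Fin n) (d : ℕ) : Yangian n :=
  RingQuot.mkAlgHom ℂ (YRel n) (FreeAlgebra.ι ℂ ((i, j, d) : tIdx n))

/-! ## The Drinfeld functor -/

/-- Words of length `ℓ` in the alphabet `{1,…,n}`: the standard basis of `(ℂ^n)^{⊗ℓ}`
is indexed by such words. -/
abbrev Word (ℓ n : ℕ) : Type := Fin ℓ → Fin n

/-- Concrete model for `M ⊗ (ℂ^n)^{⊗ℓ}`: functions from words to `M`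
(the value at a word is the coefficient of the corresponding basis vector). -/
abbrev MW (ℓ n : ℕ) (M : Type) : Type := Word ℓ n → M

section Dfun

variable {ℓ n : ℕ} {M : Type} [AddCommGroup M] [Module ℂ M]

/-- The operator `P_σ` permuting the tensor factors of `(ℂ^n)^{⊗ℓ}`. -/
def permOp (n : ℕ) {ℓ : ℕ} {M : Type} [AddCommGroup M] [Module ℂ M]
    (σ : Equiv.Perm (Fin ℓ)) : MW ℓ n M →ₗ[ℂ] MW ℓ n M where
  toFun f := fun w => f (w ∘ σ)
  map_add' _ _ := rfl
  map_smul' _ _ := rfl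

/-- The operator `τ_m(E_{ab})`, acting as the matrix unit `E_{ab}` on the `m`-th
tensor factor of `(ℂ^n)^{⊗ℓ}` and as the identity elsewhere. -/
def tauOp {ℓ n : ℕ} {M : Type} [AddCommGroup M] [Module ℂ M]
    (m : Fin ℓ) (a b : Fin n) : MW ℓ n M →ₗ[ℂ] MW ℓ n M where
  toFun f := fun w => if w m = a then f (Function.update w m b) else 0
  map_add' f g := by funext w; by_cases h : w m = a <;> simp [h]
  map_smul' c f := by funext w; by_cases h : w m = a <;> simp [h]

/-- The action of `h ∈ H_ℓ` on the coefficients (i.e. on the factor `M`). -/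
def hOp (n : ℕ) {ℓ : ℕ} {M : Type} [AddCommGroup M] [Module ℂ M]
    (ρ : Hecke ℓ →ₐ[ℂ] Module.End ℂ M) (h : Hecke ℓ) : MW ℓ n M →ₗ[ℂ] MW ℓ n M :=
  (ρ h).compLeft (Word ℓ n)

/-- The action of the transposition `s_{ij} ∈ W_ℓ` on `M ⊗ (ℂ^n)^{⊗ℓ}`, namely
`K_{ij} P_{ij}`. -/
def sOp (n : ℕ) {ℓ : ℕ} {M : Type} [AddCommGroup M] [Module ℂ M]
    (ρ : Hecke ℓ →ₐ[ℂ] Module.End ℂ M) (i j : Fin ℓ) : MW ℓ n M →ₗ[ℂ] MW ℓ n M :=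
  hOp n ρ (Hecke.sigma (Equiv.swap i j)) ∘ₗ permOp n (Equiv.swap i j)

/-- The subspace `N(M) = Σ_{i=1}^{ℓ-1} Im(s_i + 1)` of `M ⊗ (ℂ^n)^{⊗ℓ}`. -/
def NSub (n : ℕ) {ℓ : ℕ} {M : Type} [AddCommGroup M] [Module ℂ M]
    (ρ : Hecke ℓ →ₐ[ℂ] Module.End ℂ M) : Submodule ℂ (MW ℓ n M) :=
  ⨆ (i : Fin ℓ) (h : (i : ℕ) + 1 < ℓ),
    LinearMap.range (sOp n ρ i ⟨(i : ℕ) + 1, h⟩ + LinearMap.id)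

/-- The Drinfeld functor: `D_ℓ(M) = (M ⊗ (ℂ^n)^{⊗ℓ})/N(M)`. -/
abbrev Dmod (n : ℕ) {ℓ : ℕ} {M : Type} [AddCommGroup M] [Module ℂ M]
    (ρ : Hecke ℓ →ₐ[ℂ] Module.End ℂ M) : Type :=
  MW ℓ n M ⧸ NSub n ρ

/-- The operator `Σ_{m=1}^{ℓ} y_m^d ⊗ τ_m(E_{ab})` on `M ⊗ (ℂ^n)^{⊗ℓ}`. -/
def sumOp (n : ℕ) {ℓ : ℕ} {M : Type} [AddCommGroup M] [Module ℂ M]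
    (ρ : Hecke ℓ →ₐ[ℂ] Module.End ℂ M) (a b : Fin n) (d : ℕ) :
    MW ℓ n M →ₗ[ℂ] MW ℓ n M :=
  ∑ m : Fin ℓ, hOp n ρ ((Hecke.y m) ^ d) ∘ₗ tauOp m a b

/-- `π` is the Yangian action on `D_ℓ(M)` provided by Propositions 2.1 and 2.4 of
the paper: `t_{ab}^{(d)}` acts by the endomorphism induced by
`Σ_{m=1}^{ℓ} y_m^d ⊗ τ_m(E_{ab})`. -/
def IsDrinfeldAction (n : ℕ) {ℓ : ℕ} {M : Type} [AddCommGroup M] [Module ℂ M]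
    (ρ : Hecke ℓ →ₐ[ℂ] Module.End ℂ M)
    (π : Yangian n →ₐ[ℂ] Module.End ℂ (Dmod n ρ)) : Prop :=
  ∀ (a b : Fin n) (d : ℕ) (f : MW ℓ n M),
    π (Yangian.t a b d) (Submodule.Quotient.mk f) = Submodule.Quotient.mk (sumOp n ρ a b d f)

/-- A subspace stable under a Yangian action: a `Y(gl_n)`-submodule. -/
def YStable {n : ℕ} {V : Type} [AddCommGroup V] [Module ℂ V]
    (π : Yangian n →ₐ[ℂ] Module.End ℂ V) (q : Submodule ℂ V) : Prop :=
  ∀ (y : Yangian n) (x : V), x ∈ q → π y x ∈ q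

/-- A nonzero `Y(gl_n)`-module with no proper nonzero submodule: a simple module. -/
def YSimple {n : ℕ} {V : Type} [AddCommGroup V] [Module ℂ V]
    (π : Yangian n →ₐ[ℂ] Module.End ℂ V) : Prop :=
  Nontrivial V ∧ ∀ q : Submodule ℂ V, YStable π q → q = ⊥ ∨ q = ⊤

/-- A subspace stable under an `H_ℓ`-action: an `H_ℓ`-submodule. -/
def HStable {ℓ : ℕ} {M : Type} [AddCommGroup M] [Module ℂ M]
    (ρ : Hecke ℓ →ₐ[ℂ] Module.End ℂ M) (p : Submodule ℂ M) : Prop :=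
  ∀ (h : Hecke ℓ) (x : M), x ∈ p → ρ h x ∈ p

/-- A nonzero `H_ℓ`-module with no proper nonzero submodule: a simple module. -/
def HSimple {ℓ : ℕ} {M : Type} [AddCommGroup M] [Module ℂ M]
    (ρ : Hecke ℓ →ₐ[ℂ] Module.End ℂ M) : Prop :=
  Nontrivial M ∧ ∀ p : Submodule ℂ M, HStable ρ p → p = ⊥ ∨ p = ⊤

end Dfun

/-! ## Standard modules `K(λ,μ)` -/

section Standard

variable {r : ℕ}

/-- The offset `Σ_{j<k} ℓ_j` of the `k`-th block. -/
def off {r : ℕ} (L : Fin r → ℕ) (k : Fin r) : ℕ :=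
  ∑ j ∈ Finset.univ.filter (fun j : Fin r => j < k), L j

/-- `m ∈ {1,…,ℓ}` belongs to the `k`-th block of sizes `L = (ℓ_1,…,ℓ_r)`. -/
def inBlock {r : ℕ} (L : Fin r → ℕ) (k : Fin r) (m : ℕ) : Prop :=
  off L k ≤ m ∧ m < off L k + L k

/-- The left ideal of `H_ℓ` by which one quotients to obtain the standard module
`K(λ,μ) = H_ℓ ⊗_{H_{ℓ_1} ⊗ ⋯ ⊗ H_{ℓ_r}} (ℂ_{[μ_1,λ_1−1]} ⊗ ⋯ ⊗ ℂ_{[μ_r,λ_r−1]})`: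
it is generated by `ε_m − (μ_k + (m − off k))` for `m` in the `k`-th block, and by
`s_m − 1` for `m, m+1` in the same block. -/
def KIdeal (ℓ : ℕ) {r : ℕ} (L : Fin r → ℕ) (μ : Fin r → ℂ) :
    Submodule (Hecke ℓ) (Hecke ℓ) :=
  Submodule.span (Hecke ℓ)
    ({x | ∃ (m : Fin ℓ) (k : Fin r), inBlock L k (m : ℕ) ∧
        x = Hecke.eps m - (μ k + (((m : ℕ) - off L k : ℕ) : ℂ)) • 1} ∪
      {x | ∃ (m m' : Fin ℓ) (k : Fin r), (m' : ℕ) = (m : ℕ) + 1 ∧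
        inBlock L k (m : ℕ) ∧ inBlock L k (m' : ℕ) ∧
        x = Hecke.sigma (Equiv.swap m m') - 1})

/-- The standard module `K(λ,μ)`, realized as the quotient of `H_ℓ` by the
left ideal `KIdeal`. -/
abbrev KMod (ℓ : ℕ) {r : ℕ} (L : Fin r → ℕ) (μ : Fin r → ℂ) : Type :=
  Hecke ℓ ⧸ KIdeal ℓ L μ

/-- The `H_ℓ`-action on a quotient of `H_ℓ` by a left ideal, as an algebra map to
endomorphisms. -/
def quotRho {ℓ : ℕ} (I : Submodule (Hecke ℓ) (Hecke ℓ)) :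
    Hecke ℓ →ₐ[ℂ] Module.End ℂ (Hecke ℓ ⧸ I) :=
  Algebra.lsmul ℂ ℂ (Hecke ℓ ⧸ I)

end Standard

section HeckeLemmas

set_option linter.unusedSectionVars false

variable {ℓ : ℕ}

/-! ## Permutations -/

/-- Permutations preserving `f` are products of transpositions preserving `f`. -/
theorem perm_preserving_induction {α β : Type*} [Fintype α] [DecidableEq α] (f : α → β)
    {P : Equiv.Perm α → Prop} (h1 : P 1)
    (hs : ∀ i j, i ≠ j → f i = f j → ∀ σ, P σ → P (Equiv.swap i j * σ)) :
    ∀ σ : Equiv.Perm α, (∀ i, f (σ i) = f i) → P σ := by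
  intro σ
  induction hN : σ.support.card using Nat.strong_induction_on generalizing σ with
  | _ N ih =>
    intro hσ
    by_cases hone : σ = 1
    · rwa [hone]
    · obtain ⟨a, ha⟩ : ∃ a, σ a ≠ a := by
        by_contra! h
        exact hone (Equiv.ext h)
      have hlt := Equiv.Perm.card_support_swap_mul ha
      have := hs a (σ a) (Ne.symm ha) (hσ a).symm (Equiv.swap a (σ a) * σ)
        (ih _ (hN ▸ hlt) _ rfl (fun i => by
          rw [Equiv.Perm.mul_apply]
          rcases eq_or_ne (σ i) a with h | h
          · rw [h, Equiv.swap_apply_left, hσ, ← h, hσ]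
          rcases eq_or_ne (σ i) (σ a) with h' | h'
          · rw [h', Equiv.swap_apply_right, ← hσ a, ← h', hσ]
          · rw [Equiv.swap_apply_of_ne_of_ne h h', hσ]))
      rwa [← mul_assoc, Equiv.swap_mul_self, one_mul] at this

/-- The permutations of `Fin ℓ` fixing every point outside `[lo, hi)`. -/
def PermIco (ℓ lo hi : ℕ) : Subgroup (Equiv.Perm (Fin ℓ)) where
  carrier := {σ | ∀ i : Fin ℓ, ¬ (lo ≤ (i : ℕ) ∧ (i : ℕ) < hi) → σ i = i}
  mul_mem' := by
    intro a b ha hb i hi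
    rw [Equiv.Perm.mul_apply, hb i hi, ha i hi]
  one_mem' := fun _ _ => rfl
  inv_mem' := by
    intro a ha i hi
    rw [Equiv.Perm.inv_eq_iff_eq, ha i hi]

theorem permIco_apply_mem {lo hi : ℕ} {σ : Equiv.Perm (Fin ℓ)} (hσ : σ ∈ PermIco ℓ lo hi)
    {i : Fin ℓ} (hi' : lo ≤ (i : ℕ) ∧ (i : ℕ) < hi) : lo ≤ (σ i : ℕ) ∧ (σ i : ℕ) < hi := by
  by_contra h
  have := hσ _ h
  rw [σ.injective this] at h
  exact h hi'

theorem swap_mem_permIco {lo hi : ℕ} {i j : Fin ℓ} (h1 : lo ≤ (i : ℕ) ∧ (i : ℕ) < hi)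
    (h2 : lo ≤ (j : ℕ) ∧ (j : ℕ) < hi) : Equiv.swap i j ∈ PermIco ℓ lo hi := by
  intro k hk
  apply Equiv.swap_apply_of_ne_of_ne
  · rintro rfl; exact hk h1
  · rintro rfl; exact hk h2

theorem permIco_induction {lo hi : ℕ} {P : Equiv.Perm (Fin ℓ) → Prop} (h1 : P 1)
    (hs : ∀ m m' : Fin ℓ, lo ≤ (m : ℕ) → (m' : ℕ) = m + 1 → (m' : ℕ) < hi →
      ∀ σ, P σ → P (Equiv.swap m m' * σ)) :
    ∀ σ ∈ PermIco ℓ lo hi, P σ := by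
  have key : ∀ d : ℕ, ∀ a b : Fin ℓ, lo ≤ (a : ℕ) → (b : ℕ) = a + d + 1 → (b : ℕ) < hi →
      ∀ σ, P σ → P (Equiv.swap a b * σ) := by
    intro d
    induction d with
    | zero => intro a b ha hb hb' σ hσ; exact hs a b ha (by omega) hb' σ hσ
    | succ d ih =>
      intro a b ha hb hb' σ hσ
      have hb1 : (b : ℕ) - 1 < ℓ := by omega
      set c : Fin ℓ := ⟨(b : ℕ) - 1, hb1⟩ with hc
      have hcv : (c : ℕ) = b - 1 := rfl
      have hca : c ≠ a := by intro h; rw [Fin.ext_iff] at h; omega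
      have hba : b ≠ a := by intro h; rw [Fin.ext_iff] at h; omega
      have hcb : c ≠ b := by intro h; rw [Fin.ext_iff] at h; omega
      have e : Equiv.swap a b = Equiv.swap c b * (Equiv.swap a c * Equiv.swap c b) := by
        rw [Equiv.swap_comm a b, ← Equiv.swap_mul_swap_mul_swap hca.symm hba.symm, mul_assoc]
      rw [e, mul_assoc, mul_assoc]
      refine hs c b (by omega) (by omega) hb' _ (ih a c ha (by omega) (by omega) _ ?_)
      exact hs c b (by omega) (by omega) hb' _ hσ
  intro σ hσ
  refine perm_preserving_induction
    (fun i : Fin ℓ => if lo ≤ (i : ℕ) ∧ (i : ℕ) < hi then none else some i) h1 ?_ σ ?_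
  · intro i j hij hf σ hσ
    by_cases hi' : lo ≤ (i : ℕ) ∧ (i : ℕ) < hi
    · by_cases hj : lo ≤ (j : ℕ) ∧ (j : ℕ) < hi
      · rcases lt_or_gt_of_ne (fun h => hij (Fin.ext h) : (i : ℕ) ≠ j) with h | h
        · exact key (j - i - 1) i j hi'.1 (by omega) hj.2 σ hσ
        · rw [Equiv.swap_comm]
          exact key (i - j - 1) j i hj.1 (by omega) hi'.2 σ hσ
      · simp [hi', hj] at hf
    · by_cases hj : lo ≤ (j : ℕ) ∧ (j : ℕ) < hi
      · simp [hi', hj] at hf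
      · simp [hi', hj] at hf; exact absurd hf hij
  · intro i
    by_cases hi' : lo ≤ (i : ℕ) ∧ (i : ℕ) < hi
    · simp only [permIco_apply_mem hσ hi', hi', and_self, if_true]
    · rw [hσ i hi']

theorem mem_permIco_full (σ : Equiv.Perm (Fin ℓ)) : σ ∈ PermIco ℓ 0 ℓ := by
  intro i hi; exact absurd ⟨Nat.zero_le _, i.2⟩ hi

/-! ## The degenerate affine Hecke algebra -/

/-- A copy of the degenerate affine Hecke algebra with a separately declared ring structure. -/
def HeckeAlg (ℓ : ℕ) : Type := Hecke ℓ

instance : Ring (HeckeAlg ℓ) := inferInstanceAs (Ring (Hecke ℓ))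
instance : Algebra ℂ (HeckeAlg ℓ) := inferInstanceAs (Algebra ℂ (Hecke ℓ))

namespace HeckeAlg

/-- The identification of the two copies of the Hecke algebra. -/
def ofHecke : Hecke ℓ ≃ₐ[ℂ] HeckeAlg ℓ := AlgEquiv.refl

/-- The image of `w ∈ W_ℓ`. -/
def sigma (w : Equiv.Perm (Fin ℓ)) : HeckeAlg ℓ := ofHecke (Hecke.sigma w)

/-- The image of `ε_i`. -/
def eps (i : Fin ℓ) : HeckeAlg ℓ := ofHecke (Hecke.eps i)

/-- The element `y_m`. -/
def y (m : Fin ℓ) : HeckeAlg ℓ := ofHecke (Hecke.y m)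

theorem sigma_mul (w w' : Equiv.Perm (Fin ℓ)) : sigma w * sigma w' = sigma (w * w') := by
  unfold sigma
  rw [← map_mul]
  congr 1
  unfold Hecke.sigma
  rw [← map_mul]
  exact RingQuot.mkAlgHom_rel ℂ (HRel.permMul w w')

theorem sigma_one : sigma (1 : Equiv.Perm (Fin ℓ)) = 1 := by
  unfold sigma Hecke.sigma
  rw [RingQuot.mkAlgHom_rel ℂ (HRel.permOne), map_one, map_one]

theorem eps_comm (i j : Fin ℓ) : eps i * eps j = eps j * eps i := by
  unfold eps Hecke.eps
  rw [← map_mul, ← map_mul, RingQuot.mkAlgHom_rel ℂ (HRel.epsComm i j), map_mul, map_mul]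

theorem sigma_mul_eps (i i' j : Fin ℓ) (h : (i' : ℕ) = i + 1) :
    sigma (Equiv.swap i i') * eps j = eps (Equiv.swap i i' j) * sigma (Equiv.swap i i')
      + ((if j = i' then 1 else 0) - (if j = i then 1 else 0)) := by
  have hi : (i : ℕ) + 1 < ℓ := by rw [← h]; exact i'.2
  obtain rfl : i' = ⟨(i : ℕ) + 1, hi⟩ := Fin.ext h
  have := congrArg ofHecke (RingQuot.mkAlgHom_rel ℂ (HRel.cross i j hi))
  rw [map_sub, map_mul, map_mul, map_smul, map_one, map_sub, map_mul, map_mul, map_smul, map_one,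
    sub_eq_iff_eq_add] at this
  unfold sigma eps Hecke.sigma Hecke.eps
  rw [this, add_comm]
  congr 1
  split_ifs <;> simp

theorem sigma_swap_mul_self (i j : Fin ℓ) :
    sigma (Equiv.swap i j) * sigma (Equiv.swap i j) = 1 := by
  rw [sigma_mul, Equiv.swap_mul_self, sigma_one]

/-- The relative Jucys–Murphy sum `Σ_{lo ≤ j < m} s_{jm}`. -/
def jm (lo : ℕ) (m : Fin ℓ) : HeckeAlg ℓ :=
  ∑ j : Fin ℓ, if lo ≤ (j : ℕ) ∧ j < m then sigma (Equiv.swap j m) else 0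

/-- `ε_m − Σ_{lo ≤ j < m} s_{jm}`. -/
def yRel (lo : ℕ) (m : Fin ℓ) : HeckeAlg ℓ := eps m - jm lo m

theorem y_eq_yRel (m : Fin ℓ) : y m = yRel 0 m := by
  unfold y yRel jm eps sigma Hecke.y
  rw [Finset.sum_filter, map_sub, map_sum]
  simp only [Nat.zero_le, true_and, apply_ite, map_zero]

theorem sigma_mul_sigma_swap (σ : Equiv.Perm (Fin ℓ)) (i j : Fin ℓ) :
    sigma σ * sigma (Equiv.swap i j) = sigma (Equiv.swap (σ i) (σ j)) * sigma σ := by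
  rw [sigma_mul, sigma_mul, Equiv.mul_swap_eq_swap_mul]

theorem sigma_mul_jm (lo : ℕ) (i i' m : Fin ℓ) (h : (i' : ℕ) = i + 1) (hlo : lo ≤ (i : ℕ)) :
    sigma (Equiv.swap i i') * jm lo m = jm lo (Equiv.swap i i' m) * sigma (Equiv.swap i i')
      + ((if m = i' then 1 else 0) - (if m = i then 1 else 0)) := by
  have hne : i ≠ i' := by intro h'; rw [Fin.ext_iff] at h'; omega
  set s := Equiv.swap i i' with hs
  have e1 : sigma s * jm lo m = (∑ j : Fin ℓ, if lo ≤ (s j : ℕ) ∧ s j < m then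
      sigma (Equiv.swap j (s m)) else 0) * sigma s := by
    unfold jm
    rw [Finset.mul_sum, Finset.sum_mul, ← Equiv.sum_comp s]
    refine Finset.sum_congr rfl fun j _ => ?_
    split_ifs
    · rw [sigma_mul_sigma_swap, hs, Equiv.swap_apply_self]
    · simp
  rw [e1]
  have hcond : ∀ j : Fin ℓ, (lo ≤ (s j : ℕ) ↔ lo ≤ (j : ℕ)) := by
    intro j
    rcases eq_or_ne j i with rfl | h1
    · rw [hs, Equiv.swap_apply_left]; omega
    rcases eq_or_ne j i' with rfl | h2
    · rw [hs, Equiv.swap_apply_right]; omega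
    · rw [hs, Equiv.swap_apply_of_ne_of_ne h1 h2]
  have hval : ∀ j : Fin ℓ, j ≠ i → j ≠ i' → s j = j := fun j h1 h2 =>
    Equiv.swap_apply_of_ne_of_ne h1 h2
  have hsi : s i = i' := Equiv.swap_apply_left _ _
  have hsi' : s i' = i := Equiv.swap_apply_right _ _
  rcases eq_or_ne m i with rfl | h1
  · rw [hsi]
    have : jm lo i' = (∑ j : Fin ℓ, if lo ≤ (s j : ℕ) ∧ s j < m then
      sigma (Equiv.swap j i') else 0) + sigma s := by
      unfold jm
      rw [← Finset.sum_erase_add _ _ (Finset.mem_univ m),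
        ← Finset.sum_erase_add (Finset.univ) (fun j : Fin ℓ => if lo ≤ (s j : ℕ) ∧ s j < m then
        sigma (Equiv.swap j i') else 0) (Finset.mem_univ m)]
      rw [if_pos (show lo ≤ (m : ℕ) ∧ m < i' from ⟨hlo, by rw [Fin.lt_def]; omega⟩),
        if_neg (by rw [hsi, Fin.lt_def]; omega), add_zero]
      congr 1
      refine Finset.sum_congr rfl fun j hj => ?_
      have hj' : j ≠ m := Finset.ne_of_mem_erase hj
      refine if_congr (and_congr (hcond _).symm ?_) rfl rfl
      rcases eq_or_ne j i' with rfl | h2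
      · rw [hsi']; simp
      · rw [hval j hj' h2, Fin.lt_def, Fin.lt_def]
        have : (j : ℕ) ≠ m := fun h => hj' (Fin.ext h)
        omega
    rw [this, add_mul, if_neg hne, if_pos rfl, hs, sigma_swap_mul_self]
    abel
  rcases eq_or_ne m i' with rfl | h2
  · rw [hsi']
    have : (∑ j : Fin ℓ, if lo ≤ (s j : ℕ) ∧ s j < m then
      sigma (Equiv.swap j i) else 0) = jm lo i + sigma s := by
      unfold jm
      rw [← Finset.sum_erase_add _ _ (Finset.mem_univ m),
        ← Finset.sum_erase_add (Finset.univ) (fun j : Fin ℓ => if lo ≤ (j : ℕ) ∧ j < i then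
        sigma (Equiv.swap j i) else 0) (Finset.mem_univ m)]
      rw [if_pos (by rw [hsi', Fin.lt_def]; omega), if_neg (by rw [Fin.lt_def]; omega), add_zero,
        hs, Equiv.swap_comm m i, ← hs]
      congr 1
      refine Finset.sum_congr rfl fun j hj => ?_
      have hj' : j ≠ m := Finset.ne_of_mem_erase hj
      refine if_congr (and_congr (hcond _) ?_) rfl rfl
      rcases eq_or_ne j i with rfl | h2
      · rw [hsi]; simp
      · rw [hval j h2 hj', Fin.lt_def, Fin.lt_def]
        have : (j : ℕ) ≠ i := fun h => h2 (Fin.ext h)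
        omega
    rw [this, add_mul, if_pos rfl, if_neg h1, hs, sigma_swap_mul_self]
    abel
  · rw [hval m h1 h2, if_neg h1, if_neg h2, sub_zero, add_zero]
    congr 1
    unfold jm
    refine Finset.sum_congr rfl fun j _ => ?_
    refine if_congr (and_congr (hcond _) ?_) rfl rfl
    have hmi : (m : ℕ) ≠ i := fun h => h1 (Fin.ext h)
    have hmi' : (m : ℕ) ≠ i' := fun h => h2 (Fin.ext h)
    rcases eq_or_ne j i with rfl | h3
    · rw [hsi, Fin.lt_def, Fin.lt_def]; omega
    rcases eq_or_ne j i' with rfl | h4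
    · rw [hsi', Fin.lt_def, Fin.lt_def]; omega
    · rw [hval j h3 h4]

theorem sigma_mul_yRel {lo hi : ℕ} (σ : Equiv.Perm (Fin ℓ)) (hσ : σ ∈ PermIco ℓ lo hi) (m : Fin ℓ) :
    sigma σ * yRel lo m = yRel lo (σ m) * sigma σ := by
  refine permIco_induction (P := fun σ => sigma σ * yRel lo m = yRel lo (σ m) * sigma σ)
    ?_ ?_ σ hσ
  · rw [sigma_one, one_mul, mul_one, Equiv.Perm.one_apply]
  · intro i i' hlo h _ σ hσ
    rw [← sigma_mul, mul_assoc, hσ, ← mul_assoc, ← mul_assoc]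
    congr 1
    unfold yRel
    rw [mul_sub, sigma_mul_eps i i' _ h, sigma_mul_jm lo i i' _ h hlo, Equiv.Perm.mul_apply,
      sub_mul]
    abel

theorem sigma_mul_y (σ : Equiv.Perm (Fin ℓ)) (m : Fin ℓ) :
    sigma σ * y m = y (σ m) * sigma σ := by
  rw [y_eq_yRel, y_eq_yRel, sigma_mul_yRel σ (mem_permIco_full σ)]

/-- A permutation of strands in `[lo, hi)` commutes with `ε_m` for `m` outside. -/
theorem sigma_mul_eps_of_notMem {lo hi : ℕ} {σ : Equiv.Perm (Fin ℓ)} (hσ : σ ∈ PermIco ℓ lo hi)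
    {m : Fin ℓ} (hm : ¬ (lo ≤ (m : ℕ) ∧ (m : ℕ) < hi)) : sigma σ * eps m = eps m * sigma σ := by
  refine permIco_induction (P := fun σ => sigma σ * eps m = eps m * sigma σ)
    ?_ ?_ σ hσ
  · rw [sigma_one, one_mul, mul_one]
  · intro i i' hlo h h' σ hσ
    have h1 : m ≠ i := by rintro rfl; exact hm ⟨hlo, by omega⟩
    have h2 : m ≠ i' := by rintro rfl; exact hm ⟨by omega, h'⟩
    rw [← sigma_mul, mul_assoc, hσ, ← mul_assoc, sigma_mul_eps i i' _ h, if_neg h1, if_neg h2,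
      Equiv.swap_apply_of_ne_of_ne h1 h2, sub_zero, add_zero, mul_assoc]

/-- Induction principle: `H_ℓ` is spanned from `1` by left multiplication by generators. -/
theorem mem_of_left_mul (S : Submodule ℂ (HeckeAlg ℓ)) (h1 : (1 : HeckeAlg ℓ) ∈ S)
    (hσ : ∀ σ, ∀ x ∈ S, sigma σ * x ∈ S) (hε : ∀ i, ∀ x ∈ S, eps i * x ∈ S) (x : HeckeAlg ℓ) :
    x ∈ S := by
  obtain ⟨x, rfl⟩ := ofHecke.surjective x
  obtain ⟨a, rfl⟩ := RingQuot.mkAlgHom_surjective ℂ (HRel ℓ) x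
  suffices h : ∀ y ∈ S, ofHecke (RingQuot.mkAlgHom ℂ (HRel ℓ) a) * y ∈ S by
    simpa using h 1 h1
  induction a using FreeAlgebra.induction with
  | grade0 c =>
    intro y hy
    rw [AlgHom.commutes, AlgEquiv.commutes, ← Algebra.smul_def]
    exact S.smul_mem _ hy
  | grade1 g =>
    intro y hy
    cases g with
    | perm w => exact hσ w y hy
    | eps i => exact hε i y hy
  | mul a b ha hb => intro y hy; rw [map_mul, map_mul, mul_assoc]; exact ha _ (hb _ hy)
  | add a b ha hb => intro y hy; rw [map_add, map_add, add_mul]; exact S.add_mem (ha _ hy) (hb _ hy)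

theorem y_commutator (i j : Fin ℓ) (hij : i ≠ j) :
    y i * y j - y j * y i = - ((y i - y j) * sigma (Equiv.swap i j)) := by
  have hℓ : 1 < ℓ := by
    have h1 := i.2
    have h2 := j.2
    have h3 : (i : ℕ) ≠ j := fun h => hij (Fin.ext h)
    omega
  set a : Fin ℓ := ⟨0, by omega⟩ with ha
  set b : Fin ℓ := ⟨1, hℓ⟩ with hb
  have hab : a ≠ b := by intro h; rw [Fin.ext_iff] at h; simp [ha, hb] at h
  have hya : y a = eps a := by
    rw [y_eq_yRel]; unfold yRel jm
    rw [Finset.sum_eq_zero, sub_zero]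
    intro j _
    rw [if_neg]; rw [Fin.lt_def]; simp [ha]
  have hyb : y b = eps b - sigma (Equiv.swap a b) := by
    rw [y_eq_yRel]; unfold yRel jm
    rw [Finset.sum_eq_single a, if_pos]
    · exact ⟨Nat.zero_le _, by rw [Fin.lt_def]; simp [ha, hb]⟩
    · intro j _ hj
      rw [if_neg]
      rintro ⟨_, h⟩
      rw [Fin.lt_def] at h
      apply hj; apply Fin.ext; simp [ha, hb] at h ⊢; exact h
    · simp
  have base : y a * y b - y b * y a = - ((y a - y b) * sigma (Equiv.swap a b)) := by
    have hc := eps_comm a b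
    have hs := sigma_mul_y (Equiv.swap a b) a
    rw [Equiv.swap_apply_left] at hs
    have e1 : y a * y b - y b * y a = -(y a * sigma (Equiv.swap a b)) +
        sigma (Equiv.swap a b) * y a := by
      rw [hyb, hya, mul_sub, sub_mul, hc]; abel
    rw [e1, hs, sub_mul]; abel
  obtain ⟨σ, hσa, hσb⟩ : ∃ σ : Equiv.Perm (Fin ℓ), σ a = i ∧ σ b = j := by
    have hne : Equiv.swap a i b ≠ i := by
      intro h
      have : b = a := (Equiv.swap a i).injective (by rw [h, Equiv.swap_apply_left])
      exact hab this.symm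
    refine ⟨Equiv.swap (Equiv.swap a i b) j * Equiv.swap a i, ?_, ?_⟩
    · rw [Equiv.Perm.mul_apply, Equiv.swap_apply_left,
        Equiv.swap_apply_of_ne_of_ne hne.symm hij]
    · rw [Equiv.Perm.mul_apply, Equiv.swap_apply_left]
  have h2 : sigma σ * (y a * y b - y b * y a) = (y i * y j - y j * y i) * sigma σ := by
    rw [mul_sub, ← mul_assoc, ← mul_assoc, sigma_mul_y, sigma_mul_y, mul_assoc, mul_assoc,
      sigma_mul_y, sigma_mul_y, hσa, hσb, sub_mul, mul_assoc, mul_assoc]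
  have h3 : sigma σ * (-((y a - y b) * sigma (Equiv.swap a b))) =
      (-((y i - y j) * sigma (Equiv.swap i j))) * sigma σ := by
    rw [mul_neg, neg_mul, ← mul_assoc, mul_sub, sigma_mul_y, sigma_mul_y, ← sub_mul, mul_assoc,
      sigma_mul_sigma_swap, hσa, hσb, mul_assoc]
  have h4 : (y i * y j - y j * y i) * sigma σ =
      (-((y i - y j) * sigma (Equiv.swap i j))) * sigma σ := by
    rw [← h2, base, h3]
  have h5 := congrArg (· * sigma σ⁻¹) h4
  simpa only [mul_assoc, sigma_mul, mul_inv_cancel, sigma_one, mul_one] using h5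

end HeckeAlg

namespace HeckeAlg

/-! ### Intertwining elements -/

/-- `ε_i` with a natural-number index. -/
def epsN (ℓ i : ℕ) : HeckeAlg ℓ := if h : i < ℓ then eps ⟨i, h⟩ else 0

/-- `s_i` with a natural-number index. -/
def simpleN (ℓ i : ℕ) : HeckeAlg ℓ :=
  if h : i + 1 < ℓ then sigma (Equiv.swap ⟨i, by omega⟩ ⟨i + 1, h⟩) else 1

theorem epsN_val (m : Fin ℓ) : epsN ℓ m = eps m := by simp [epsN]

theorem epsN_comm (i j : ℕ) : epsN ℓ i * epsN ℓ j = epsN ℓ j * epsN ℓ i := by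
  unfold epsN
  split_ifs <;> simp [eps_comm]

theorem simpleN_sq (i : ℕ) : simpleN ℓ i * simpleN ℓ i = 1 := by
  unfold simpleN
  split_ifs <;> simp [sigma_swap_mul_self]

theorem simpleN_epsN (i : ℕ) (h : i + 1 < ℓ) :
    simpleN ℓ i * epsN ℓ i = epsN ℓ (i + 1) * simpleN ℓ i - 1 := by
  unfold simpleN epsN
  rw [dif_pos h, dif_pos (by omega : i < ℓ), dif_pos h, sigma_mul_eps _ _ _ rfl,
    Equiv.swap_apply_left, if_pos rfl, if_neg (by simp [Fin.ext_iff])]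
  abel

theorem simpleN_epsN_succ (i : ℕ) (h : i + 1 < ℓ) :
    simpleN ℓ i * epsN ℓ (i + 1) = epsN ℓ i * simpleN ℓ i + 1 := by
  unfold simpleN epsN
  rw [dif_pos h, dif_pos h, dif_pos (by omega : i < ℓ), sigma_mul_eps _ _ _ rfl,
    Equiv.swap_apply_right, if_pos rfl, if_neg (by simp [Fin.ext_iff])]
  abel

theorem simpleN_epsN_of_ne (i j : ℕ) (h1 : j ≠ i) (h2 : j ≠ i + 1) :
    simpleN ℓ i * epsN ℓ j = epsN ℓ j * simpleN ℓ i := by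
  unfold simpleN epsN
  by_cases h : i + 1 < ℓ
  · by_cases hj : j < ℓ
    · rw [dif_pos h, dif_pos hj, sigma_mul_eps _ _ _ rfl, if_neg (by simpa [Fin.ext_iff]),
        if_neg (by simpa [Fin.ext_iff]), Equiv.swap_apply_of_ne_of_ne (by simpa [Fin.ext_iff])
        (by simpa [Fin.ext_iff]), sub_zero, add_zero]
    · simp [hj]
  · simp [h]

theorem simpleN_comm (i j : ℕ) (h : i + 1 < j) :
    simpleN ℓ i * simpleN ℓ j = simpleN ℓ j * simpleN ℓ i := by
  unfold simpleN
  split_ifs with h1 h2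
  · rw [sigma_mul_sigma_swap, Equiv.swap_apply_of_ne_of_ne, Equiv.swap_apply_of_ne_of_ne] <;>
      simp [Fin.ext_iff] <;> omega
  all_goals simp

theorem simpleN_braid (i : ℕ) (h : i + 2 < ℓ) :
    simpleN ℓ i * simpleN ℓ (i + 1) * simpleN ℓ i =
      simpleN ℓ (i + 1) * simpleN ℓ i * simpleN ℓ (i + 1) := by
  unfold simpleN
  rw [dif_pos (by omega), dif_pos (by omega)]
  simp only [sigma_mul]
  congr 1
  set a : Fin ℓ := ⟨i, by omega⟩
  set b : Fin ℓ := ⟨i + 1, by omega⟩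
  set c : Fin ℓ := ⟨i + 1 + 1, by omega⟩
  have hab : a ≠ b := by simp [a, b, Fin.ext_iff]
  have hac : a ≠ c := by simp [a, c, Fin.ext_iff]; omega
  have hbc : c ≠ b := by simp [b, c, Fin.ext_iff]
  have h1 := Equiv.swap_mul_swap_mul_swap hab hac
  have h2 := Equiv.swap_mul_swap_mul_swap hbc hac.symm
  rw [h1, Equiv.swap_comm a b, Equiv.swap_comm b c, h2, Equiv.swap_comm]

/-- The intertwining element `s_i (ε_i - ε_{i+1}) + 1`. -/
def phi (ℓ i : ℕ) : HeckeAlg ℓ := simpleN ℓ i * (epsN ℓ i - epsN ℓ (i + 1)) + 1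

theorem phi_epsN (i : ℕ) (h : i + 1 < ℓ) : phi ℓ i * epsN ℓ i = epsN ℓ (i + 1) * phi ℓ i := by
  have h1 := simpleN_epsN i h
  have h2 := epsN_comm (ℓ := ℓ) i (i + 1)
  unfold phi
  linear_combination (norm := noncomm_ring) h1 * (epsN ℓ i - epsN ℓ (i + 1)) + simpleN ℓ i * h2

theorem phi_epsN_succ (i : ℕ) (h : i + 1 < ℓ) :
    phi ℓ i * epsN ℓ (i + 1) = epsN ℓ i * phi ℓ i := by
  have h1 := simpleN_epsN_succ i h
  have h2 := epsN_comm (ℓ := ℓ) i (i + 1)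
  unfold phi
  linear_combination (norm := noncomm_ring) h1 * (epsN ℓ i - epsN ℓ (i + 1)) + simpleN ℓ i * h2

theorem phi_epsN_of_ne (i j : ℕ) (h1 : j ≠ i) (h2 : j ≠ i + 1) :
    phi ℓ i * epsN ℓ j = epsN ℓ j * phi ℓ i := by
  have h3 := simpleN_epsN_of_ne (ℓ := ℓ) i j h1 h2
  have h4 := epsN_comm (ℓ := ℓ) i j
  have h5 := epsN_comm (ℓ := ℓ) (i + 1) j
  unfold phi
  linear_combination (norm := noncomm_ring) h3 * (epsN ℓ i - epsN ℓ (i + 1))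
    + simpleN ℓ i * h4 - simpleN ℓ i * h5

theorem phi_sq (i : ℕ) (h : i + 1 < ℓ) :
    phi ℓ i * phi ℓ i = 1 - (epsN ℓ i - epsN ℓ (i + 1)) ^ 2 := by
  have h0 := simpleN_sq (ℓ := ℓ) i
  have h1 := simpleN_epsN i h
  have h2 := simpleN_epsN_succ i h
  have h3 := epsN_comm (ℓ := ℓ) i (i + 1)
  have h4 : simpleN ℓ i * (epsN ℓ i - epsN ℓ (i + 1)) =
      -((epsN ℓ i - epsN ℓ (i + 1)) * simpleN ℓ i) - (1 + 1) := by
    linear_combination (norm := noncomm_ring) h1 - h2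
  unfold phi
  generalize epsN ℓ i - epsN ℓ (i + 1) = d at *
  linear_combination (norm := noncomm_ring) h4 * (simpleN ℓ i * d) - d * h0 * d

theorem phi_comm (i j : ℕ) (h : i + 1 < j) : phi ℓ i * phi ℓ j = phi ℓ j * phi ℓ i := by
  have h1 := phi_epsN_of_ne (ℓ := ℓ) i j (by omega) (by omega)
  have h2 := phi_epsN_of_ne (ℓ := ℓ) i (j + 1) (by omega) (by omega)
  have h3 : phi ℓ i * simpleN ℓ j = simpleN ℓ j * phi ℓ i := by
    have e1 := simpleN_comm (ℓ := ℓ) i j h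
    have e2 := simpleN_epsN_of_ne (ℓ := ℓ) j i (by omega) (by omega)
    have e3 := simpleN_epsN_of_ne (ℓ := ℓ) j (i + 1) (by omega) (by omega)
    unfold phi
    linear_combination (norm := noncomm_ring) e1 * (epsN ℓ i - epsN ℓ (i + 1))
      - simpleN ℓ i * e2 + simpleN ℓ i * e3
  rw [show phi ℓ j = simpleN ℓ j * (epsN ℓ j - epsN ℓ (j + 1)) + 1 from rfl]
  generalize phi ℓ i = f at *
  linear_combination (norm := noncomm_ring) h3 * (epsN ℓ j - epsN ℓ (j + 1))
    + simpleN ℓ j * h1 - simpleN ℓ j * h2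

theorem phi_braid (i : ℕ) (h : i + 2 < ℓ) :
    phi ℓ i * phi ℓ (i + 1) * phi ℓ i = phi ℓ (i + 1) * phi ℓ i * phi ℓ (i + 1) := by
  have hs := simpleN_braid i h
  have a1 := phi_epsN (ℓ := ℓ) i (by omega)
  have a2 := phi_epsN_succ (ℓ := ℓ) i (by omega)
  have a3 := phi_epsN_of_ne (ℓ := ℓ) i (i + 1 + 1) (by omega) (by omega)
  have b1 := phi_epsN_of_ne (ℓ := ℓ) (i + 1) i (by omega) (by omega)
  have b2 := phi_epsN (i + 1) h
  have b3 := phi_epsN_succ (i + 1) h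
  have sq1 := phi_sq (ℓ := ℓ) i (by omega)
  have sq2 := phi_sq (i + 1) h
  have s11 := simpleN_epsN (ℓ := ℓ) i (by omega)
  have s12 := simpleN_epsN_succ (ℓ := ℓ) i (by omega)
  have s13 := simpleN_epsN_of_ne (ℓ := ℓ) i (i + 1 + 1) (by omega) (by omega)
  have s21 := simpleN_epsN_of_ne (ℓ := ℓ) (i + 1) i (by omega) (by omega)
  have s22 := simpleN_epsN (i + 1) h
  have s23 := simpleN_epsN_succ (i + 1) h
  have q1 := simpleN_sq (ℓ := ℓ) i
  have q2 := simpleN_sq (ℓ := ℓ) (i + 1)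
  have e12 := epsN_comm (ℓ := ℓ) i (i + 1)
  have e13 := epsN_comm (ℓ := ℓ) i (i + 1 + 1)
  have e23 := epsN_comm (ℓ := ℓ) (i + 1) (i + 1 + 1)
  have f1 : phi ℓ i = simpleN ℓ i * (epsN ℓ i - epsN ℓ (i + 1)) + 1 := rfl
  have f2 : phi ℓ (i + 1) = simpleN ℓ (i + 1) * (epsN ℓ (i + 1) - epsN ℓ (i + 1 + 1)) + 1 := rfl
  generalize phi ℓ i = p1 at *
  generalize phi ℓ (i + 1) = p2 at *
  generalize simpleN ℓ i = s1 at *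
  generalize simpleN ℓ (i + 1) = s2 at *
  generalize epsN ℓ i = x1 at *
  generalize epsN ℓ (i + 1) = x2 at *
  generalize epsN ℓ (i + 1 + 1) = x3 at *
  have c1 : (x1 - x2) * s2 = s2 * (x1 - x3) + 1 := by
    linear_combination (norm := noncomm_ring) -s21 + s23
  have c2 : (x2 - x3) * s1 = s1 * (x1 - x3) + 1 := by
    linear_combination (norm := noncomm_ring) - s11 + s13
  have c3 : (x1 - x3) * s1 = s1 * (x2 - x3) - 1 := by
    linear_combination (norm := noncomm_ring) - s12 + s13
  have c4 : (x1 - x3) * s2 = s2 * (x1 - x2) - 1 := by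
    linear_combination (norm := noncomm_ring) - s21 + s22
  have k1 : p1 * s2 * p1 = s1 * s2 * s1 * ((x2 - x3) * (x1 - x2)) + s1 * s2 * (x2 - x3) + s1
      + s2 * s1 * (x1 - x2) + s2 + (x1 - x2) := by
    rw [f1]
    linear_combination (norm := noncomm_ring) s1 * c1 * (s1 * (x1 - x2)) + s1 * s2 * c3 * (x1 - x2)
      + s1 * c1 + q1 * (x1 - x2)
  have k2 : p2 * s1 * p2 = s2 * s1 * s2 * ((x1 - x2) * (x2 - x3)) + s2 * s1 * (x1 - x2) + s2
      + s1 * s2 * (x2 - x3) + s1 + (x2 - x3) := by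
    rw [f2]
    linear_combination (norm := noncomm_ring) s2 * c2 * (s2 * (x2 - x3)) + s2 * s1 * c4 * (x2 - x3)
      + s2 * c2 + q2 * (x2 - x3)
  have l1 : p1 * p2 * p1 = p1 * s2 * p1 * (x1 - x3) + p1 * p1 := by
    rw [f2]
    linear_combination (norm := noncomm_ring) p1 * s2 * (- a1 + a3)
  have l2 : p2 * p1 * p2 = p2 * s1 * p2 * (x1 - x3) + p2 * p2 := by
    rw [f1]
    linear_combination (norm := noncomm_ring) p2 * s1 * (- b1 + b3)
  have hd : (x1 - x2) * (x2 - x3) = (x2 - x3) * (x1 - x2) := by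
    linear_combination (norm := noncomm_ring) e12 - e13 + e23
  rw [l1, l2, k1, k2, sq1, sq2, hs, hd]
  linear_combination (norm := noncomm_ring) e12 - e13 + e23

end HeckeAlg

namespace HeckeAlg

/-- The intertwiner moving the strand `i` across the `m` following strands. -/
def moveStrand (ℓ i : ℕ) : ℕ → HeckeAlg ℓ
  | 0 => 1
  | m + 1 => phi ℓ (i + m) * moveStrand ℓ i m

theorem moveStrand_comm (i m : ℕ) (z : HeckeAlg ℓ)
    (h : ∀ t < m, phi ℓ (i + t) * z = z * phi ℓ (i + t)) :
    moveStrand ℓ i m * z = z * moveStrand ℓ i m := by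
  induction m with
  | zero => simp [moveStrand]
  | succ m ih =>
    rw [moveStrand, mul_assoc, ih (fun t ht => h t (by omega)), ← mul_assoc, h m (by omega),
      mul_assoc]

theorem moveStrand_epsN_self (i m : ℕ) (h : i + m < ℓ) :
    moveStrand ℓ i m * epsN ℓ i = epsN ℓ (i + m) * moveStrand ℓ i m := by
  induction m with
  | zero => simp [moveStrand]
  | succ m ih =>
    rw [moveStrand, mul_assoc, ih (by omega), ← mul_assoc, phi_epsN _ (by omega), mul_assoc,
      ← add_assoc]

theorem moveStrand_epsN_of_lt (i m t : ℕ) (h : i + m < ℓ) (ht : t < m) :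
    moveStrand ℓ i m * epsN ℓ (i + t + 1) = epsN ℓ (i + t) * moveStrand ℓ i m := by
  induction m with
  | zero => omega
  | succ m ih =>
    rw [moveStrand, mul_assoc]
    rcases Nat.lt_succ_iff_lt_or_eq.mp ht with h' | rfl
    · rw [ih (by omega) h', ← mul_assoc, phi_epsN_of_ne _ _ (by omega) (by omega), mul_assoc]
    · rw [moveStrand_comm _ _ _ (fun s hs => phi_epsN_of_ne _ _ (by omega) (by omega)), ← mul_assoc,
        phi_epsN_succ _ (by omega), mul_assoc]

theorem moveStrand_epsN_of_gt (i m j : ℕ) (h : j < i ∨ i + m < j) :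
    moveStrand ℓ i m * epsN ℓ j = epsN ℓ j * moveStrand ℓ i m :=
  moveStrand_comm _ _ _ (fun t ht => phi_epsN_of_ne _ _ (by omega) (by omega))

theorem moveStrand_comm_phi (i m j : ℕ) (h : j + 1 < i ∨ i + m < j) :
    moveStrand ℓ i m * phi ℓ j = phi ℓ j * moveStrand ℓ i m :=
  moveStrand_comm _ _ _ (fun t ht => by
    rcases h with h | h
    · exact (phi_comm _ _ (by omega)).symm
    · exact phi_comm _ _ (by omega))

theorem phi_mul_moveStrand (i m t : ℕ) (h : i + m < ℓ) (ht : t + 1 < m) :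
    phi ℓ (i + t) * moveStrand ℓ i m = moveStrand ℓ i m * phi ℓ (i + t + 1) := by
  induction m with
  | zero => omega
  | succ m ih =>
    rcases Nat.lt_succ_iff_lt_or_eq.mp ht with h' | h'
    · rw [moveStrand, mul_assoc, ← ih (by omega) h', ← mul_assoc, ← mul_assoc,
        phi_comm (i + t) (i + m) (by omega)]
    · obtain rfl := h'
      rw [moveStrand, moveStrand, ← mul_assoc, ← mul_assoc, ← add_assoc, phi_braid _ (by omega),
        mul_assoc, mul_assoc, ← moveStrand_comm_phi _ _ _ (by omega), mul_assoc, mul_assoc]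

theorem moveStrand_pair (i m : ℕ) (h : i + m + 1 < ℓ) :
    phi ℓ (i + m) * (moveStrand ℓ i m * moveStrand ℓ (i + 1) m) =
      moveStrand ℓ i m * moveStrand ℓ (i + 1) m * phi ℓ i := by
  induction m with
  | zero => simp [moveStrand]
  | succ m ih =>
    have e : moveStrand ℓ i (m + 1) * moveStrand ℓ (i + 1) (m + 1) =
        phi ℓ (i + m) * phi ℓ (i + m + 1) * (moveStrand ℓ i m * moveStrand ℓ (i + 1) m) := by
      rw [moveStrand, moveStrand, show i + 1 + m = i + m + 1 by omega, mul_assoc,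
        ← mul_assoc (moveStrand ℓ i m), moveStrand_comm_phi _ _ _ (by omega)]
      simp only [mul_assoc]
    have h1 := ih (by omega)
    have h2 := phi_braid (ℓ := ℓ) (i + m) (by omega)
    rw [e, ← add_assoc]
    linear_combination (norm := noncomm_ring)
      phi ℓ (i + m) * phi ℓ (i + m + 1) * h1 - h2 * (moveStrand ℓ i m * moveStrand ℓ (i + 1) m)

/-- The intertwiner moving the `p` strands starting at `i` across the `q` following ones. -/
def moveBlock (ℓ : ℕ) : ℕ → ℕ → ℕ → HeckeAlg ℓ
  | _, 0, _ => 1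
  | i, p + 1, q => moveStrand ℓ i q * moveBlock ℓ (i + 1) p q

theorem moveBlock_comm_phi (i p q j : ℕ) (h : j + 1 < i) :
    moveBlock ℓ i p q * phi ℓ j = phi ℓ j * moveBlock ℓ i p q := by
  induction p generalizing i with
  | zero => simp [moveBlock]
  | succ p ih =>
    rw [moveBlock, mul_assoc, ih _ (by omega), ← mul_assoc, moveStrand_comm_phi _ _ _ (by omega),
      mul_assoc]

theorem moveBlock_comm_epsN (i p q j : ℕ) (h : j < i) :
    moveBlock ℓ i p q * epsN ℓ j = epsN ℓ j * moveBlock ℓ i p q := by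
  induction p generalizing i with
  | zero => simp [moveBlock]
  | succ p ih =>
    rw [moveBlock, mul_assoc, ih _ (by omega), ← mul_assoc, moveStrand_epsN_of_gt _ _ _ (by omega),
      mul_assoc]

theorem moveBlock_epsN_left (i p q t : ℕ) (h : i + p + q ≤ ℓ) (ht : t < p) :
    moveBlock ℓ i p q * epsN ℓ (i + t) = epsN ℓ (i + q + t) * moveBlock ℓ i p q := by
  induction p generalizing i t with
  | zero => omega
  | succ p ih =>
    rw [moveBlock, mul_assoc]
    rcases t with _ | t
    · rw [add_zero, moveBlock_comm_epsN _ _ _ _ (by omega), ← mul_assoc,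
        moveStrand_epsN_self _ _ (by omega), mul_assoc, add_zero]
    · rw [show i + (t + 1) = i + 1 + t by omega, ih _ _ (by omega) (by omega), ← mul_assoc,
        moveStrand_epsN_of_gt _ _ _ (by omega), mul_assoc, show i + 1 + q + t = i + q + (t + 1) by
        omega]

theorem moveBlock_epsN_right (i p q t : ℕ) (h : i + p + q ≤ ℓ) (ht : t < q) :
    moveBlock ℓ i p q * epsN ℓ (i + p + t) = epsN ℓ (i + t) * moveBlock ℓ i p q := by
  induction p generalizing i with
  | zero => simp [moveBlock]
  | succ p ih =>
    rw [moveBlock, mul_assoc, show i + (p + 1) + t = i + 1 + p + t by omega, ih _ (by omega),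
      ← mul_assoc, show i + 1 + t = i + t + 1 by omega, moveStrand_epsN_of_lt _ _ _ (by omega) ht,
      mul_assoc]

theorem phi_mul_moveBlock_right (i p q t : ℕ) (h : i + p + q ≤ ℓ) (ht : t + 1 < q) :
    phi ℓ (i + t) * moveBlock ℓ i p q = moveBlock ℓ i p q * phi ℓ (i + p + t) := by
  induction p generalizing i with
  | zero => simp [moveBlock]
  | succ p ih =>
    rw [moveBlock, ← mul_assoc, phi_mul_moveStrand _ _ _ (by omega) ht, mul_assoc, mul_assoc,
      show i + t + 1 = i + 1 + t by omega, ih _ (by omega),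
      show i + 1 + p + t = i + (p + 1) + t by omega]

theorem phi_mul_moveBlock_left (i p q t : ℕ) (h : i + p + q ≤ ℓ) (ht : t + 1 < p) :
    phi ℓ (i + q + t) * moveBlock ℓ i p q = moveBlock ℓ i p q * phi ℓ (i + t) := by
  induction p generalizing i t with
  | zero => omega
  | succ p ih =>
    rcases t with _ | t
    · obtain ⟨p, rfl⟩ : ∃ p', p = p' + 1 := ⟨p - 1, by omega⟩
      have h1 := moveStrand_pair (ℓ := ℓ) i q (by omega)
      have h2 := moveBlock_comm_phi (ℓ := ℓ) (i + 1 + 1) p q i (by omega)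
      rw [moveBlock, moveBlock, add_zero, add_zero]
      linear_combination (norm := noncomm_ring) h1 * moveBlock ℓ (i + 1 + 1) p q
        - moveStrand ℓ i q * moveStrand ℓ (i + 1) q * h2
    · rw [moveBlock, ← mul_assoc, ← moveStrand_comm_phi _ _ _ (by omega), mul_assoc, mul_assoc,
        show i + q + (t + 1) = i + 1 + q + t by omega, ih _ _ (by omega) (by omega),
        show i + (t + 1) = i + 1 + t by omega]

variable {M : Type} [AddCommGroup M] [Module ℂ M] [Module (HeckeAlg ℓ) M]
  [IsScalarTower ℂ (HeckeAlg ℓ) M]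

instance hecke_smulComm : SMulCommClass (HeckeAlg ℓ) ℂ M :=
  IsScalarTower.to_smulCommClass' (R := ℂ) (A := HeckeAlg ℓ) (M := M)

theorem weight_transport {b e e' : HeckeAlg ℓ} {x : M} {c : ℂ} (h : b * e = e' * b)
    (hx : e • x = c • x) : e' • b • x = c • b • x := by
  rw [← mul_smul, ← h, mul_smul, hx, smul_comm]

theorem phi_smul_ne_zero {i : ℕ} (h : i + 1 < ℓ) {x : M} {a b : ℂ} (hx : x ≠ 0)
    (ha : epsN ℓ i • x = a • x) (hb : epsN ℓ (i + 1) • x = b • x) (hab : (a - b) ^ 2 ≠ 1) :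
    phi ℓ i • x ≠ 0 := by
  intro h0
  have : (phi ℓ i * phi ℓ i) • x = 0 := by rw [mul_smul, h0, smul_zero]
  have hd : (epsN ℓ i - epsN ℓ (i + 1)) • x = (a - b) • x := by
    rw [sub_smul, ha, hb, sub_smul]
  rw [phi_sq i h, sub_smul, one_smul, pow_two, mul_smul, hd, smul_comm, hd, smul_smul] at this
  have e : (1 - (a - b) ^ 2) • x = 0 := by rw [sub_smul, one_smul, pow_two]; exact this
  rcases smul_eq_zero.mp e with h | h
  · exact hab (by linear_combination -h)
  · exact hx h

theorem moveStrand_smul_ne_zero {i m : ℕ} (h : i + m < ℓ) {x : M} {a : ℂ} {b : ℕ → ℂ} (hx : x ≠ 0)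
    (ha : epsN ℓ i • x = a • x) (hb : ∀ t < m, epsN ℓ (i + 1 + t) • x = b t • x)
    (hab : ∀ t < m, (a - b t) ^ 2 ≠ 1) : moveStrand ℓ i m • x ≠ 0 := by
  induction m with
  | zero => simpa [moveStrand]
  | succ m ih =>
    rw [moveStrand, mul_smul]
    refine phi_smul_ne_zero (a := a) (b := b m) (by omega)
      (ih (by omega) (fun t ht => hb t (by omega)) (fun t ht => hab t (by omega))) ?_ ?_
      (hab m (by omega))
    · exact weight_transport (moveStrand_epsN_self _ _ (by omega)) ha
    · refine weight_transport (moveStrand_epsN_of_gt _ _ _ (by omega)) ?_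
      rw [show i + m + 1 = i + 1 + m by omega]; exact hb m (by omega)

theorem moveBlock_smul_ne_zero {i p q : ℕ} (h : i + p + q ≤ ℓ) {x : M} {a : ℕ → ℂ} {b : ℕ → ℂ}
    (hx : x ≠ 0)
    (ha : ∀ t < p, epsN ℓ (i + t) • x = a t • x) (hb : ∀ t < q, epsN ℓ (i + p + t) • x = b t • x)
    (hab : ∀ s < p, ∀ t < q, (a s - b t) ^ 2 ≠ 1) : moveBlock ℓ i p q • x ≠ 0 := by
  induction p generalizing i a with
  | zero => simpa [moveBlock]
  | succ p ih =>
    rw [moveBlock, mul_smul]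
    refine moveStrand_smul_ne_zero (a := a 0) (b := b) (by omega)
      (ih (a := fun t => a (t + 1)) (by omega) ?_ ?_ (fun s hs t ht => hab _ (by omega) t ht)) ?_ ?_
      (fun t ht => hab 0 (by omega) t ht)
    · intro t ht
      have := ha (t + 1) (by omega)
      rwa [show i + (t + 1) = i + 1 + t by omega] at this
    · intro t ht
      have := hb t ht
      rwa [show i + (p + 1) + t = i + 1 + p + t by omega] at this
    · exact weight_transport (moveBlock_comm_epsN _ _ _ _ (by omega))
        (by simpa using ha 0 (by omega))
    · intro t ht
      refine weight_transport (moveBlock_epsN_right _ _ _ _ (by omega) ht) ?_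
      have := hb t ht
      rwa [show i + (p + 1) + t = i + 1 + p + t by omega] at this

end HeckeAlg

namespace HeckeAlg

/-! ### Local subalgebras and segment types -/

/-- The subalgebra generated by the strands in `[lo, hi)`. -/
def loc (ℓ lo hi : ℕ) : Subalgebra ℂ (HeckeAlg ℓ) :=
  Algebra.adjoin ℂ ({x | ∃ m : Fin ℓ, (lo ≤ (m : ℕ) ∧ (m : ℕ) < hi) ∧ x = eps m} ∪
    {x | ∃ σ ∈ PermIco ℓ lo hi, x = sigma σ})

theorem eps_mem_loc {lo hi : ℕ} {m : Fin ℓ} (h : lo ≤ (m : ℕ) ∧ (m : ℕ) < hi) :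
    eps m ∈ loc ℓ lo hi := Algebra.subset_adjoin (Or.inl ⟨m, h, rfl⟩)

theorem sigma_mem_loc {lo hi : ℕ} {σ : Equiv.Perm (Fin ℓ)} (h : σ ∈ PermIco ℓ lo hi) :
    sigma σ ∈ loc ℓ lo hi := Algebra.subset_adjoin (Or.inr ⟨σ, h, rfl⟩)

theorem permIco_mono {lo hi lo' hi' : ℕ} (h1 : lo' ≤ lo) (h2 : hi ≤ hi') :
    PermIco ℓ lo hi ≤ PermIco ℓ lo' hi' :=
  fun _ hσ i hi => hσ i (fun h => hi ⟨by omega, by omega⟩)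

theorem loc_mono {lo hi lo' hi' : ℕ} (h1 : lo' ≤ lo) (h2 : hi ≤ hi') :
    loc ℓ lo hi ≤ loc ℓ lo' hi' := by
  refine Algebra.adjoin_mono ?_
  rintro x (⟨m, hm, rfl⟩ | ⟨σ, hσ, rfl⟩)
  · exact Or.inl ⟨m, ⟨by omega, by omega⟩, rfl⟩
  · exact Or.inr ⟨σ, permIco_mono h1 h2 hσ, rfl⟩

theorem commute_of_mem_loc {lo hi : ℕ} {z : HeckeAlg ℓ}
    (h1 : ∀ m : Fin ℓ, (lo ≤ (m : ℕ) ∧ (m : ℕ) < hi) → eps m * z = z * eps m)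
    (h2 : ∀ σ ∈ PermIco ℓ lo hi, sigma σ * z = z * sigma σ) {x : HeckeAlg ℓ}
    (hx : x ∈ loc ℓ lo hi) : x * z = z * x := by
  induction hx using Algebra.adjoin_induction with
  | mem x h =>
    rcases h with ⟨m, hm, rfl⟩ | ⟨σ, hσ, rfl⟩
    · exact h1 m hm
    · exact h2 σ hσ
  | algebraMap r => exact Algebra.commutes r z
  | add x y _ _ hx hy => rw [add_mul, mul_add, hx, hy]
  | mul x y _ _ hx hy => rw [mul_assoc, hy, ← mul_assoc, hx, mul_assoc]

theorem sigma_comm_of_disjoint {lo hi lo' hi' : ℕ} (h : hi ≤ lo' ∨ hi' ≤ lo)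
    {σ τ : Equiv.Perm (Fin ℓ)} (hσ : σ ∈ PermIco ℓ lo hi) (hτ : τ ∈ PermIco ℓ lo' hi') :
    sigma σ * sigma τ = sigma τ * sigma σ := by
  rw [sigma_mul, sigma_mul]
  congr 1
  have : Equiv.Perm.Disjoint σ τ := by
    intro i
    by_cases hi1 : lo ≤ (i : ℕ) ∧ (i : ℕ) < hi
    · exact Or.inr (hτ i (by omega))
    · exact Or.inl (hσ i hi1)
  exact this.commute

theorem loc_commute {lo hi lo' hi' : ℕ} (h : hi ≤ lo' ∨ hi' ≤ lo) {x z : HeckeAlg ℓ}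
    (hx : x ∈ loc ℓ lo hi) (hz : z ∈ loc ℓ lo' hi') : x * z = z * x := by
  refine commute_of_mem_loc ?_ ?_ hx
  · intro m hm
    refine (commute_of_mem_loc ?_ ?_ hz).symm
    · intro m' _; exact eps_comm _ _
    · intro τ hτ
      exact sigma_mul_eps_of_notMem hτ (by omega)
  · intro σ hσ
    refine (commute_of_mem_loc ?_ ?_ hz).symm
    · intro m' hm'
      exact (sigma_mul_eps_of_notMem hσ (by omega)).symm
    · intro τ hτ
      exact (sigma_comm_of_disjoint h hσ hτ).symm

variable {M : Type} [AddCommGroup M] [Module ℂ M] [Module (HeckeAlg ℓ) M]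
  [IsScalarTower ℂ (HeckeAlg ℓ) M]

/-- `x` transforms, under the strands `p, p+1, …`, like the generating vector of the standard
module attached to the list `l` of segments (given by start and length). -/
def HasType : ℕ → List (ℂ × ℕ) → M → Prop
  | _, [], _ => True
  | p, (a, k) :: t, x =>
      (∀ m : Fin ℓ, p ≤ (m : ℕ) → (m : ℕ) < p + k → eps m • x = (a + ((m : ℕ) - p)) • x) ∧
      (∀ σ ∈ PermIco ℓ p (p + k), sigma σ • x = x) ∧ HasType (p + k) t x

/-- The total length of a list of segments. -/
def total (l : List (ℂ × ℕ)) : ℕ := (l.map Prod.snd).sum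

@[simp] theorem total_nil : total [] = 0 := rfl
@[simp] theorem total_cons (s : ℂ × ℕ) (l) : total (s :: l) = s.2 + total l := rfl
@[simp] theorem total_append (l l') : total (l ++ l') = total l + total l' := by
  simp [total]

theorem hasType_append (p : ℕ) (l l' : List (ℂ × ℕ)) (x : M) :
    HasType (ℓ := ℓ) p (l ++ l') x ↔
      HasType (ℓ := ℓ) p l x ∧ HasType (ℓ := ℓ) (p + total l) l' x := by
  induction l generalizing p with
  | nil => simp [HasType]
  | cons s t ih =>
    obtain ⟨a, k⟩ := s
    simp only [List.cons_append, HasType, ih, total_cons, and_assoc, add_assoc]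

theorem HasType.smul_of_commute {l : List (ℂ × ℕ)} {p : ℕ} {x : M}
    (hx : HasType (ℓ := ℓ) p l x) {lo hi : ℕ} (h : hi ≤ p ∨ p + total l ≤ lo) {b : HeckeAlg ℓ}
    (hb : b ∈ loc ℓ lo hi) : HasType (ℓ := ℓ) p l (b • x) := by
  induction l generalizing p with
  | nil => trivial
  | cons s t ih =>
    obtain ⟨a, k⟩ := s
    obtain ⟨h1, h2, h3⟩ := hx
    simp only [total_cons] at h
    refine ⟨?_, ?_, ih h3 (by omega)⟩
    · intro m hm hm'
      rw [← mul_smul, loc_commute (lo := p) (hi := p + k) (by omega) (eps_mem_loc ⟨hm, hm'⟩) hb,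
        mul_smul, h1 m hm hm',
        smul_comm]
    · intro σ hσ
      rw [← mul_smul, loc_commute (lo := p) (hi := p + k) (by omega) (sigma_mem_loc hσ) hb,
        mul_smul, h2 σ hσ]

/-- At every position there is a local element of the Hecke algebra moving all nonzero vectors of
type `l` (in any module) to nonzero vectors of type `l'`. -/
def Reach (ℓ : ℕ) (l l' : List (ℂ × ℕ)) : Prop :=
  total l' = total l ∧
  ∀ p : ℕ, p + total l ≤ ℓ → ∃ b ∈ loc ℓ p (p + total l),
    ∀ (M : Type) [AddCommGroup M] [Module ℂ M] [Module (HeckeAlg ℓ) M]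
      [IsScalarTower ℂ (HeckeAlg ℓ) M] (x : M), x ≠ 0 → HasType (ℓ := ℓ) p l x →
      b • x ≠ 0 ∧ HasType (ℓ := ℓ) p l' (b • x)

theorem Reach.refl (l : List (ℂ × ℕ)) : Reach ℓ l l :=
  ⟨rfl, fun p _ => ⟨1, one_mem _, fun M _ _ _ _ x hx h => ⟨by rwa [one_smul], by rwa [one_smul]⟩⟩⟩

theorem Reach.trans {l l' l'' : List (ℂ × ℕ)} (h : Reach ℓ l l') (h' : Reach ℓ l' l'') :
    Reach ℓ l l'' := by
  refine ⟨h'.1.trans h.1, fun p hp => ?_⟩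
  obtain ⟨b, hb, hbM⟩ := h.2 p hp
  obtain ⟨c, hc, hcM⟩ := h'.2 p (by rwa [h.1])
  rw [h.1] at hc
  refine ⟨c * b, mul_mem hc hb, fun M _ _ _ _ x hx ht => ?_⟩
  rw [mul_smul]
  exact hcM M (b • x) (hbM M x hx ht).1 (hbM M x hx ht).2

theorem Reach.append {l l' : List (ℂ × ℕ)} (h : Reach ℓ l l') (A B : List (ℂ × ℕ)) :
    Reach ℓ (A ++ l ++ B) (A ++ l' ++ B) := by
  refine ⟨by simp [h.1], fun p hp => ?_⟩
  simp only [total_append] at hp ⊢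
  obtain ⟨b, hb, hbM⟩ := h.2 (p + total A) (by omega)
  refine ⟨b, loc_mono (by omega) (by omega) hb, fun M _ _ _ _ x hx ht => ?_⟩
  rw [hasType_append, hasType_append] at ht
  obtain ⟨⟨hA, hl⟩, hB⟩ := ht
  simp only [total_append] at hB
  obtain ⟨hbx, hbt⟩ := hbM M x hx hl
  refine ⟨hbx, ?_⟩
  rw [hasType_append, hasType_append]
  refine ⟨⟨hA.smul_of_commute (Or.inr le_rfl) hb, hbt⟩, ?_⟩
  rw [total_append, h.1]
  exact hB.smul_of_commute (Or.inl (by omega)) hb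

theorem Reach.append_right {l l' : List (ℂ × ℕ)} (h : Reach ℓ l l') (B : List (ℂ × ℕ)) :
    Reach ℓ (l ++ B) (l' ++ B) := by
  simpa using h.append [] B

theorem Reach.append_left {l l' : List (ℂ × ℕ)} (h : Reach ℓ l l') (A : List (ℂ × ℕ)) :
    Reach ℓ (A ++ l) (A ++ l') := by
  simpa using h.append A []

/-- A segment may be cut in two. -/
theorem Reach.split (a : ℂ) (j k : ℕ) : Reach ℓ [(a, j + k)] [(a, j), (a + j, k)] := by
  refine ⟨by simp, fun p hp => ⟨1, one_mem _, fun M _ _ _ _ x hx ht => ⟨by rwa [one_smul], ?_⟩⟩⟩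
  rw [one_smul]
  obtain ⟨h1, h2, _⟩ := ht
  refine ⟨fun m hm hm' => h1 m hm (by omega), fun σ hσ => h2 σ (permIco_mono le_rfl (by omega) hσ),
    fun m hm hm' => ?_, fun σ hσ => h2 σ (permIco_mono (by omega) (by omega) hσ), trivial⟩
  rw [h1 m (by omega) (by omega)]
  congr 1
  push_cast
  ring

theorem hasType_pair {p q k : ℕ} (a b : ℂ) (x : M) :
    HasType (ℓ := ℓ) p [(a, q), (b, k)] x ↔
    ((∀ m : Fin ℓ, p ≤ (m : ℕ) → (m : ℕ) < p + q → eps m • x = (a + ((m : ℕ) - p)) • x) ∧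
      (∀ σ ∈ PermIco ℓ p (p + q), sigma σ • x = x)) ∧
    ((∀ m : Fin ℓ, p + q ≤ (m : ℕ) → (m : ℕ) < p + q + k →
        eps m • x = (b + ((m : ℕ) - (p + q : ℕ))) • x) ∧
      (∀ σ ∈ PermIco ℓ (p + q) (p + q + k), sigma σ • x = x)) := by
  simp [HasType, and_assoc]

theorem phi_mem_loc {lo hi i : ℕ} (h1 : lo ≤ i) (h2 : i + 1 < hi) : phi ℓ i ∈ loc ℓ lo hi := by
  by_cases hi' : i + 1 < ℓ
  · unfold phi simpleN epsN
    rw [dif_pos hi', dif_pos (by omega), dif_pos hi']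
    refine add_mem (mul_mem (sigma_mem_loc (swap_mem_permIco ?_ ?_))
      (sub_mem (eps_mem_loc ?_) (eps_mem_loc ?_))) (one_mem _) <;> constructor <;> simp <;> omega
  · unfold phi simpleN epsN
    rw [dif_neg hi', dif_neg (c := i + 1 < ℓ) hi', one_mul, sub_zero]
    refine add_mem ?_ (one_mem _)
    split_ifs
    · exact eps_mem_loc ⟨h1, by simp; omega⟩
    · exact zero_mem _

theorem moveStrand_mem_loc {lo hi i m : ℕ} (h1 : lo ≤ i) (h2 : i + m < hi) :
    moveStrand ℓ i m ∈ loc ℓ lo hi := by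
  induction m with
  | zero => exact one_mem _
  | succ m ih => exact mul_mem (phi_mem_loc (by omega) (by omega)) (ih (by omega))

theorem moveBlock_mem_loc {lo hi i p q : ℕ} (h1 : lo ≤ i) (h2 : i + p + q ≤ hi) :
    moveBlock ℓ i p q ∈ loc ℓ lo hi := by
  induction p generalizing i with
  | zero => exact one_mem _
  | succ p ih => exact mul_mem (moveStrand_mem_loc h1 (by omega)) (ih (by omega) (by omega))

/-- On a vector with ascending weights `c, c + 1`, being killed by `phi` means being `s`-invariant. -/
theorem phi_smul_eq_zero_iff {i : ℕ} {x : M} {c : ℂ}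
    (ha : epsN ℓ i • x = c • x) (hb : epsN ℓ (i + 1) • x = (c + 1) • x) :
    phi ℓ i • x = 0 ↔ simpleN ℓ i • x = x := by
  have hd : (epsN ℓ i - epsN ℓ (i + 1)) • x = (-1 : ℂ) • x := by
    rw [sub_smul, ha, hb, ← sub_smul]; congr 1; ring
  unfold phi
  rw [add_smul, mul_smul, hd, smul_comm, one_smul, neg_smul, one_smul, neg_add_eq_zero]

theorem block_weights {p k : ℕ} (hp : p + k ≤ ℓ) {a : ℂ} {x : M} :
    (∀ m : Fin ℓ, p ≤ (m : ℕ) → (m : ℕ) < p + k → eps m • x = (a + ((m : ℕ) - (p : ℕ))) • x) ↔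
      ∀ t < k, epsN ℓ (p + t) • x = (a + (t : ℂ)) • x := by
  constructor
  · intro h t ht
    have := h ⟨p + t, by omega⟩ (by simp) (by simp; omega)
    rw [← epsN_val] at this
    rw [this]; congr 1; push_cast; ring
  · intro h m hm hm'
    have := h (m - p) (by omega)
    rw [show p + ((m : ℕ) - p) = m by omega, epsN_val, Nat.cast_sub hm] at this
    exact this

theorem block_inv {p k : ℕ} (hp : p + k ≤ ℓ) {x : M} :
    (∀ σ ∈ PermIco ℓ p (p + k), sigma σ • x = x) ↔
      ∀ t, t + 1 < k → simpleN ℓ (p + t) • x = x := by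
  constructor
  · intro h t ht
    unfold simpleN
    rw [dif_pos (by omega)]
    exact h _ (swap_mem_permIco (by simp; omega) (by simp; omega))
  · intro h σ hσ
    refine permIco_induction (P := fun σ => sigma σ • x = x) (by rw [sigma_one, one_smul]) ?_ σ hσ
    intro m m' hm hm' hlt σ hσ
    rw [← sigma_mul, mul_smul, hσ]
    have := h (m - p) (by omega)
    unfold simpleN at this
    rw [dif_pos (by omega)] at this
    have e1 : (⟨p + (m - p), by omega⟩ : Fin ℓ) = m := Fin.ext (by simp; omega)
    have e2 : (⟨p + (m - p) + 1, by omega⟩ : Fin ℓ) = m' := Fin.ext (by simp; omega)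
    rwa [e1, e2] at this

/-- Two segments with no linked pair of weights may be exchanged. -/
theorem Reach.generic_swap (a b : ℂ) (q k : ℕ)
    (h : ∀ s < q, ∀ t < k, ((a + (s : ℂ)) - (b + (t : ℂ))) ^ 2 ≠ 1) :
    Reach ℓ [(a, q), (b, k)] [(b, k), (a, q)] := by
  refine ⟨by simp [add_comm], fun p hp => ?_⟩
  simp only [total_cons, total_nil] at hp ⊢
  refine ⟨moveBlock ℓ p q k, moveBlock_mem_loc le_rfl (by omega), fun M _ _ _ _ x hx ht => ?_⟩
  rw [hasType_pair, block_weights (by omega), block_inv (by omega),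
    block_weights (by omega), block_inv (by omega)] at ht
  obtain ⟨⟨h1, h2⟩, h3, h4⟩ := ht
  refine ⟨moveBlock_smul_ne_zero (by omega) hx h1 h3 h, ?_⟩
  have w1 : ∀ t < k, epsN ℓ (p + t) • moveBlock ℓ p q k • x = (b + (t : ℂ)) • moveBlock ℓ p q k • x :=
    fun t ht => weight_transport (moveBlock_epsN_right _ _ _ _ (by omega) ht) (h3 t ht)
  have w2 : ∀ t < q, epsN ℓ (p + k + t) • moveBlock ℓ p q k • x =
      (a + (t : ℂ)) • moveBlock ℓ p q k • x :=
    fun t ht => weight_transport (moveBlock_epsN_left _ _ _ _ (by omega) ht) (h1 t ht)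
  rw [hasType_pair, block_weights (by omega), block_inv (by omega),
    block_weights (by omega), block_inv (by omega)]
  refine ⟨⟨w1, fun t ht => ?_⟩, w2, fun t ht => ?_⟩
  · rw [← phi_smul_eq_zero_iff (w1 t (by omega)), ← mul_smul,
      phi_mul_moveBlock_right _ _ _ _ (by omega) ht, mul_smul,
      (phi_smul_eq_zero_iff (h3 t (by omega)) ?_).2 (h4 t ht), smul_zero]
    · rw [add_assoc (p + q), h3 _ ht]; congr 1; push_cast; ring
    · rw [add_assoc p, w1 _ ht]; congr 1; push_cast; ring
  · rw [← phi_smul_eq_zero_iff (w2 t (by omega)), ← mul_smul,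
      phi_mul_moveBlock_left _ _ _ _ (by omega) ht, mul_smul,
      (phi_smul_eq_zero_iff (h1 t (by omega)) ?_).2 (h2 t ht), smul_zero]
    · rw [add_assoc p, h1 _ ht]; congr 1; push_cast; ring
    · rw [add_assoc (p + k), w2 _ ht]; congr 1; push_cast; ring

end HeckeAlg

namespace HeckeAlg

/-! ### Symmetrisation -/

open Classical in
/-- The permutations of the strands in `[lo, hi)`, as a finite set. -/
def permFinset (ℓ lo hi : ℕ) : Finset (Equiv.Perm (Fin ℓ)) :=
  Finset.univ.filter (· ∈ PermIco ℓ lo hi)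

theorem mem_permFinset {lo hi : ℕ} {σ : Equiv.Perm (Fin ℓ)} :
    σ ∈ permFinset ℓ lo hi ↔ σ ∈ PermIco ℓ lo hi := by
  simp [permFinset]

/-- The strands in `[lo, hi)`. -/
def strands (ℓ lo hi : ℕ) : Finset (Fin ℓ) :=
  Finset.univ.filter (fun i => lo ≤ (i : ℕ) ∧ (i : ℕ) < hi)

theorem mem_strands {lo hi : ℕ} {i : Fin ℓ} :
    i ∈ strands ℓ lo hi ↔ lo ≤ (i : ℕ) ∧ (i : ℕ) < hi := by simp [strands]

theorem card_strands {lo k : ℕ} (h : lo + k ≤ ℓ) : (strands ℓ lo (lo + k)).card = k := by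
  have : strands ℓ lo (lo + k) = (Finset.univ : Finset (Fin k)).image
      (fun t : Fin k => (⟨lo + (t : ℕ), by omega⟩ : Fin ℓ)) := by
    ext i
    simp only [mem_strands, Finset.mem_image, Finset.mem_univ, true_and]
    constructor
    · intro hi; exact ⟨⟨i - lo, by omega⟩, by ext; simp; omega⟩
    · rintro ⟨t, rfl⟩; simp
  rw [this, Finset.card_image_of_injective, Finset.card_univ, Fintype.card_fin]
  intro a b hab
  simp only [Fin.mk.injEq] at hab
  exact Fin.ext (by omega)

/-- The sum of all permutations of the strands in `[lo, hi)`. -/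
def symm (ℓ lo hi : ℕ) : HeckeAlg ℓ := ∑ σ ∈ permFinset ℓ lo hi, sigma σ

theorem symm_mem_loc (lo hi : ℕ) : symm ℓ lo hi ∈ loc ℓ lo hi :=
  sum_mem fun _ hσ => sigma_mem_loc (mem_permFinset.1 hσ)

theorem sigma_mul_symm {lo hi : ℕ} {π : Equiv.Perm (Fin ℓ)} (hπ : π ∈ PermIco ℓ lo hi) :
    sigma π * symm ℓ lo hi = symm ℓ lo hi := by
  unfold symm
  rw [Finset.mul_sum]
  refine Finset.sum_nbij (π * ·) ?_ ?_ ?_ ?_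
  · intro σ hσ
    simp only [mem_permFinset] at hσ ⊢
    exact mul_mem hπ hσ
  · intro a _ b _ h; exact mul_left_cancel h
  · intro σ hσ
    simp only [Finset.mem_coe, mem_permFinset] at hσ
    exact ⟨π⁻¹ * σ, by simpa only [Finset.mem_coe, mem_permFinset] using mul_mem (inv_mem hπ) hσ,
      by simp⟩
  · intro σ _; rw [sigma_mul]

theorem symm_mul_sigma {lo hi : ℕ} {π : Equiv.Perm (Fin ℓ)} (hπ : π ∈ PermIco ℓ lo hi) :
    symm ℓ lo hi * sigma π = symm ℓ lo hi := by
  unfold symm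
  rw [Finset.sum_mul]
  refine Finset.sum_nbij (· * π) ?_ ?_ ?_ ?_
  · intro σ hσ
    simp only [mem_permFinset] at hσ ⊢
    exact mul_mem hσ hπ
  · intro a _ b _ h; exact mul_right_cancel h
  · intro σ hσ
    simp only [Finset.mem_coe, mem_permFinset] at hσ
    exact ⟨σ * π⁻¹, by simpa only [Finset.mem_coe, mem_permFinset] using mul_mem hσ (inv_mem hπ),
      by simp⟩
  · intro σ _; rw [sigma_mul]

variable {M : Type} [AddCommGroup M] [Module ℂ M] [Module (HeckeAlg ℓ) M]
  [IsScalarTower ℂ (HeckeAlg ℓ) M]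

open Classical in
/-- The sum of `σ x` over the permutations `σ` of `[lo, hi)` with `σ Q` disjoint from `R`. -/
def avoidSum (lo hi : ℕ) (Q R : Finset (Fin ℓ)) (x : M) : M :=
  ∑ σ ∈ permFinset ℓ lo hi, if ∀ i ∈ Q, σ i ∉ R then sigma σ • x else 0

theorem sigma_smul_avoidSum {lo hi : ℕ} (Q R : Finset (Fin ℓ)) (x : M) {π : Equiv.Perm (Fin ℓ)}
    (hπ : π ∈ PermIco ℓ lo hi) :
    sigma π • avoidSum lo hi Q R x = avoidSum lo hi Q (R.map π.toEmbedding) x := by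
  unfold avoidSum
  rw [Finset.smul_sum]
  refine Finset.sum_nbij (π * ·) ?_ ?_ ?_ ?_
  · intro σ hσ
    simp only [mem_permFinset] at hσ ⊢
    exact mul_mem hπ hσ
  · intro a _ b _ h; exact mul_left_cancel h
  · intro σ hσ
    simp only [Finset.mem_coe, mem_permFinset] at hσ
    exact ⟨π⁻¹ * σ, by simpa only [Finset.mem_coe, mem_permFinset] using mul_mem (inv_mem hπ) hσ,
      by simp⟩
  · intro σ _
    simp only [smul_ite, smul_zero, ← mul_smul, sigma_mul, Equiv.Perm.mul_apply,
      Finset.mem_map_equiv, Equiv.symm_apply_apply]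

/-- Vanishing of `avoidSum` only depends on the size of the set to be avoided. -/
theorem avoidSum_eq_zero_of_card {lo hi : ℕ} (Q : Finset (Fin ℓ)) (x : M) {R0 : Finset (Fin ℓ)}
    (hR0 : R0 ⊆ strands ℓ lo hi) (h0 : avoidSum lo hi Q R0 x = 0) (R : Finset (Fin ℓ))
    (hR : R ⊆ strands ℓ lo hi) (hc : R.card = R0.card) : avoidSum lo hi Q R x = 0 := by
  induction hN : (R \ R0).card using Nat.strong_induction_on generalizing R with
  | _ N ih =>
    by_cases hs : R ⊆ R0
    · rwa [Finset.eq_of_subset_of_card_le hs hc.ge]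
    · obtain ⟨a, ha, ha0⟩ := Finset.not_subset.1 hs
      obtain ⟨b, hb, hb0⟩ : ∃ b ∈ R0, b ∉ R := by
        by_contra! h
        exact hs (Finset.eq_of_subset_of_card_le h hc.le).ge
      have hsw : Equiv.swap a b ∈ PermIco ℓ lo hi :=
        swap_mem_permIco (mem_strands.1 (hR ha)) (mem_strands.1 (hR0 hb))
      have hlt : ((R.map (Equiv.swap a b).toEmbedding) \ R0).card < (R \ R0).card := by
        apply Finset.card_lt_card
        rw [Finset.ssubset_iff_of_subset]
        · refine ⟨a, by simp [ha, ha0], ?_⟩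
          simp [Finset.mem_map_equiv, hb0]
        · intro c hc
          rw [Finset.mem_sdiff, Finset.mem_map_equiv, Equiv.symm_swap] at hc
          rw [Finset.mem_sdiff]
          refine ⟨?_, hc.2⟩
          have hcb : c ≠ b := fun h => hc.2 (h ▸ hb)
          rcases eq_or_ne c a with rfl | hca
          · exact ha
          · rw [Equiv.swap_apply_of_ne_of_ne hca hcb] at hc; exact hc.1
      have := ih _ (hN ▸ hlt) (R.map (Equiv.swap a b).toEmbedding) ?_ (by rw [Finset.card_map, hc]) rfl
      · rw [← sigma_smul_avoidSum Q R x hsw] at this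
        have h2 := congrArg (fun z => sigma (Equiv.swap a b) • z) this
        simpa only [← mul_smul, sigma_swap_mul_self, one_smul, smul_zero] using h2
      · intro c hc
        rw [Finset.mem_map_equiv, Equiv.symm_swap] at hc
        rw [mem_strands]
        have := permIco_apply_mem hsw (mem_strands.1 (hR hc))
        rwa [Equiv.swap_apply_self] at this

theorem sum_avoidSum_insert {lo hi : ℕ} (Q : Finset (Fin ℓ)) (x : M) (R : Finset (Fin ℓ))
    (hQ : Q ⊆ strands ℓ lo hi) (hR : R ⊆ strands ℓ lo hi) :
    ∑ a ∈ strands ℓ lo hi \ R, avoidSum lo hi Q (insert a R) x =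
      (((strands ℓ lo hi).card : ℂ) - R.card - Q.card) • avoidSum lo hi Q R x := by
  classical
  unfold avoidSum
  rw [Finset.sum_comm, Finset.smul_sum]
  refine Finset.sum_congr rfl fun σ hσ => ?_
  rw [mem_permFinset] at hσ
  split_ifs with h
  · rw [← Finset.sum_filter, Finset.sum_const, ← Nat.cast_smul_eq_nsmul ℂ]
    congr 1
    have : (strands ℓ lo hi \ R).filter (fun a => ∀ i ∈ Q, σ i ∉ insert a R) =
        (strands ℓ lo hi \ R) \ (Q.map σ.toEmbedding) := by
      ext a
      simp only [Finset.mem_filter, Finset.mem_sdiff, Finset.mem_insert, not_or,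
        Finset.mem_map_equiv]
      refine and_congr_right fun ha => ?_
      constructor
      · intro h1 h2; exact (h1 _ h2).1 (by simp)
      · intro h1 i hi; exact ⟨fun h3 => h1 (by rw [← h3]; simpa using hi), h i hi⟩
    rw [this, Finset.card_sdiff_of_subset, Finset.card_sdiff_of_subset hR, Finset.card_map]
    · have h3 : R.card + Q.card ≤ (strands ℓ lo hi).card := by
        rw [← Finset.card_map σ.toEmbedding (s := Q), ← Finset.card_union_of_disjoint]
        · apply Finset.card_le_card
          apply Finset.union_subset hR
          intro c hc
          rw [Finset.mem_map_equiv] at hc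
          have := permIco_apply_mem hσ (mem_strands.1 (hQ hc))
          rw [Equiv.apply_symm_apply] at this
          exact mem_strands.2 this
        · rw [Finset.disjoint_left]
          intro c hc hc'
          rw [Finset.mem_map_equiv] at hc'
          exact h _ hc' (by simpa using hc)
      rw [Nat.cast_sub (by omega), Nat.cast_sub (by omega)]
    · intro c hc
      rw [Finset.mem_map_equiv] at hc
      have := permIco_apply_mem hσ (mem_strands.1 (hQ hc))
      rw [Equiv.apply_symm_apply] at this
      rw [Finset.mem_sdiff]
      refine ⟨mem_strands.2 this, fun hcR => h _ hc (by simpa using hcR)⟩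
  · rw [smul_zero]
    refine Finset.sum_eq_zero fun a _ => if_neg fun h1 => h fun i hi => ?_
    exact fun h2 => h1 i hi (Finset.mem_insert_of_mem h2)

/-- Inclusion–exclusion: if all `avoidSum`s over subsets of `Q` vanish then so does `x`. -/
theorem eq_zero_of_avoidSum {lo hi : ℕ} (Q : Finset (Fin ℓ)) (x : M)
    (hinv : ∀ σ ∈ PermIco ℓ lo hi, (∀ i ∈ Q, σ i ∈ Q) → sigma σ • x = x)
    (h0 : ∀ R ⊆ Q, avoidSum lo hi Q R x = 0) : x = 0 := by
  classical
  have h1 : ∑ R ∈ Q.powerset, ((-1 : ℤ) ^ R.card) • avoidSum lo hi Q R x = 0 :=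
    Finset.sum_eq_zero fun R hR => by rw [h0 R (Finset.mem_powerset.1 hR), smul_zero]
  unfold avoidSum at h1
  simp only [Finset.smul_sum] at h1
  rw [Finset.sum_comm] at h1
  have h2 : ∀ σ ∈ permFinset ℓ lo hi, (∑ R ∈ Q.powerset, ((-1 : ℤ) ^ R.card) •
      (if ∀ i ∈ Q, σ i ∉ R then sigma σ • x else 0)) =
        if ∀ i ∈ Q, σ i ∈ Q then x else 0 := by
    intro σ hσ
    rw [mem_permFinset] at hσ
    simp only [smul_ite, smul_zero]
    rw [← Finset.sum_filter]
    have : Q.powerset.filter (fun R => ∀ i ∈ Q, σ i ∉ R) =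
        (Q \ Q.map σ.toEmbedding).powerset := by
      ext R
      simp only [Finset.mem_filter, Finset.mem_powerset, Finset.subset_sdiff]
      refine and_congr_right fun _ => ?_
      rw [Finset.disjoint_left]
      constructor
      · intro h c hc hc'
        rw [Finset.mem_map_equiv] at hc'
        exact h _ hc' (by simpa using hc)
      · intro h i hi hR
        exact h hR (by simpa [Finset.mem_map_equiv] using hi)
    rw [this, ← Finset.sum_smul, Finset.sum_powerset_neg_one_pow_card]
    by_cases hQ : ∀ i ∈ Q, σ i ∈ Q
    · have hsub : Q.map σ.toEmbedding ⊆ Q := by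
        intro c hc
        obtain ⟨i, hi, rfl⟩ := Finset.mem_map.1 hc
        exact hQ i hi
      have heq := Finset.eq_of_subset_of_card_le hsub (by rw [Finset.card_map])
      rw [if_pos hQ, if_pos (by rw [heq, Finset.sdiff_self]), one_smul, hinv σ hσ hQ]
    · rw [if_neg hQ, if_neg, zero_smul]
      intro he
      rw [Finset.sdiff_eq_empty_iff_subset] at he
      have heq := Finset.eq_of_subset_of_card_le he (by rw [Finset.card_map])
      apply hQ
      intro i hi
      rw [heq]; simpa [Finset.mem_map_equiv] using hi
  rw [Finset.sum_congr rfl h2, ← Finset.sum_filter, Finset.sum_const,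
    ← Nat.cast_smul_eq_nsmul ℂ, smul_eq_zero] at h1
  refine h1.resolve_left ?_
  rw [← ne_eq, Nat.cast_ne_zero, Finset.card_ne_zero]
  exact ⟨1, by rw [Finset.mem_filter, mem_permFinset]; exact ⟨one_mem _, fun i hi => hi⟩⟩

/-- If the average of a vector, invariant under the permutations of the first `q` and of the last
`k` strands, over the first `k ≥ q` strands vanishes, then it is zero. -/
theorem eq_zero_of_symm_smul {p q k : ℕ} (hp : p + q + k ≤ ℓ) (hqk : q ≤ k) {x : M}
    (h1 : ∀ σ ∈ PermIco ℓ p (p + q), sigma σ • x = x)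
    (h2 : ∀ σ ∈ PermIco ℓ (p + q) (p + q + k), sigma σ • x = x)
    (h0 : symm ℓ p (p + k) • x = 0) : x = 0 := by
  set lo := p
  set hi := p + q + k
  set Q := strands ℓ p (p + q) with hQdef
  set R0 := strands ℓ (p + k) (p + k + q) with hR0def
  have hQI : Q ⊆ strands ℓ lo hi := fun i h => mem_strands.2 (by
    have := mem_strands.1 h; omega)
  have hRI : R0 ⊆ strands ℓ lo hi := fun i h => mem_strands.2 (by
    have := mem_strands.1 h; omega)
  have hinv : ∀ σ ∈ PermIco ℓ lo hi, (∀ i ∈ Q, σ i ∈ Q) → sigma σ • x = x := by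
    intro σ hσ hσQ
    have hmap : Q.map σ.toEmbedding = Q := by
      refine Finset.eq_of_subset_of_card_le (fun c hc => ?_) (by rw [Finset.card_map])
      obtain ⟨i, hi, rfl⟩ := Finset.mem_map.1 hc
      exact hσQ i hi
    have hiff : ∀ i, σ i ∈ Q ↔ i ∈ Q := by
      intro i
      refine ⟨fun h => ?_, hσQ i⟩
      rw [← hmap, Finset.mem_map_equiv, Equiv.symm_apply_apply] at h
      exact h
    refine perm_preserving_induction
      (fun i : Fin ℓ => if i ∈ Q then 0 else if i ∈ strands ℓ lo hi then 1 else (i : ℕ) + 2)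
      (P := fun σ => sigma σ • x = x) (by rw [sigma_one, one_smul]) ?_ σ ?_
    · intro i j hij hf τ hτ
      rw [← sigma_mul, mul_smul, hτ]
      simp only [hQdef, mem_strands] at hf
      have hne : (i : ℕ) ≠ j := fun h => hij (Fin.ext h)
      have : (p ≤ (i : ℕ) ∧ (i : ℕ) < p + q) ∧ (p ≤ (j : ℕ) ∧ (j : ℕ) < p + q) ∨
          (p + q ≤ (i : ℕ) ∧ (i : ℕ) < p + q + k) ∧ (p + q ≤ (j : ℕ) ∧ (j : ℕ) < p + q + k) := by
        split_ifs at hf <;> omega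
      rcases this with ⟨h, h'⟩ | ⟨h, h'⟩
      · exact h1 _ (swap_mem_permIco h h')
      · exact h2 _ (swap_mem_permIco h h')
    · intro i
      simp only [hiff i]
      by_cases hi1 : i ∈ strands ℓ lo hi
      · have hσi : σ i ∈ strands ℓ lo hi :=
          mem_strands.2 (permIco_apply_mem hσ (mem_strands.1 hi1))
        simp only [hi1, hσi, if_true]
      · rw [hσ i (fun h => hi1 (mem_strands.2 h))]
  -- vanishing for the initial set
  have key : ∀ σ ∈ PermIco ℓ lo hi, (∀ i ∈ Q, σ i ∉ R0) → symm ℓ p (p + k) • sigma σ • x = 0 := by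
    intro σ
    induction hN : (Q.filter (fun i => σ i ≠ i)).card using Nat.strong_induction_on generalizing σ with
    | _ N ih =>
      intro hσ hσR
      by_cases hfix : ∀ i ∈ Q, σ i = i
      · rw [hinv σ hσ (fun i hi => by rw [hfix i hi]; exact hi), h0]
      · push Not at hfix
        obtain ⟨i, hi, hne⟩ := hfix
        have hmem : ∀ j ∈ Q, p ≤ (σ j : ℕ) ∧ (σ j : ℕ) < p + k := by
          intro j hj
          have a1 := permIco_apply_mem hσ (mem_strands.1 (hQI hj))
          have a2 := hσR j hj
          rw [hR0def, mem_strands] at a2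
          omega
        have hi' := mem_strands.1 hi
        have hsw : Equiv.swap i (σ i) ∈ PermIco ℓ p (p + k) :=
          swap_mem_permIco (by omega) (hmem i hi)
        have := ih _ ?_ (Equiv.swap i (σ i) * σ) rfl
          (mul_mem (permIco_mono le_rfl (by omega) hsw) hσ) ?_
        · rwa [← sigma_mul, mul_smul, ← mul_smul, symm_mul_sigma hsw] at this
        · rw [← hN]
          apply Finset.card_lt_card
          rw [Finset.ssubset_iff_of_subset]
          · refine ⟨i, by simp [hi, hne], ?_⟩
            rw [Finset.mem_filter, not_and_not_right]
            intro _
            rw [Equiv.Perm.mul_apply, Equiv.swap_apply_right]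
          · intro j hj
            rw [Finset.mem_filter] at hj ⊢
            refine ⟨hj.1, fun hσj => hj.2 ?_⟩
            rw [Equiv.Perm.mul_apply, hσj]
            apply Equiv.swap_apply_of_ne_of_ne
            · rintro rfl; exact hne hσj
            · intro h; rw [h] at hσj; exact hne (σ.injective hσj)
        · intro j hj
          rw [Equiv.Perm.mul_apply, hR0def, mem_strands]
          have := permIco_apply_mem hsw (hmem j hj)
          omega
  have hS0 : avoidSum lo hi Q R0 x = 0 := by
    have e1 : symm ℓ p (p + k) • avoidSum lo hi Q R0 x = 0 := by
      unfold avoidSum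
      rw [Finset.smul_sum]
      refine Finset.sum_eq_zero fun σ hσ => ?_
      rw [mem_permFinset] at hσ
      split_ifs with h
      · exact key σ hσ h
      · rw [smul_zero]
    have e2 : symm ℓ p (p + k) • avoidSum lo hi Q R0 x =
        ((permFinset ℓ p (p + k)).card : ℂ) • avoidSum lo hi Q R0 x := by
      unfold symm
      rw [Finset.sum_smul, Nat.cast_smul_eq_nsmul ℂ, ← Finset.sum_const]
      refine Finset.sum_congr rfl fun π hπ => ?_
      rw [mem_permFinset] at hπ
      rw [sigma_smul_avoidSum Q R0 x (permIco_mono le_rfl (by omega) hπ)]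
      congr 1
      ext c
      rw [Finset.mem_map_equiv]
      constructor
      · intro hc
        have := hπ (π.symm c) (fun h => by have := mem_strands.1 hc; omega)
        rw [Equiv.apply_symm_apply] at this
        rwa [← this] at hc
      · intro hc
        have := hπ c (fun h => by have := mem_strands.1 hc; omega)
        rw [(Equiv.symm_apply_eq π).2 this.symm]
        exact hc
    rw [e2, smul_eq_zero] at e1
    refine e1.resolve_left ?_
    rw [← ne_eq, Nat.cast_ne_zero, Finset.card_ne_zero]
    exact ⟨1, mem_permFinset.2 (one_mem _)⟩
  have hcR0 : R0.card = q := card_strands (by omega)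
  have hcQ : Q.card = q := card_strands (by omega)
  have hcI : (strands ℓ lo hi).card = q + k := by
    have := card_strands (ℓ := ℓ) (lo := p) (k := q + k) (by omega)
    rwa [← add_assoc] at this
  -- all sizes at most `q`
  have hall : ∀ d ≤ q, ∀ R ⊆ strands ℓ lo hi, R.card = q - d → avoidSum lo hi Q R x = 0 := by
    intro d
    induction d with
    | zero =>
      intro _ R hR hc
      exact avoidSum_eq_zero_of_card Q x hRI hS0 R hR (by rw [hc, hcR0, Nat.sub_zero])
    | succ d ih =>
      intro hd R hR hc
      have := sum_avoidSum_insert Q x R hQI hR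
      rw [Finset.sum_eq_zero] at this
      · have h3 := smul_eq_zero.1 this.symm
        refine h3.resolve_left ?_
        rw [hcI, hcQ, hc, sub_sub, ← Nat.cast_add, sub_eq_zero]
        intro h
        have := Nat.cast_injective h
        omega
      · intro a ha
        rw [Finset.mem_sdiff] at ha
        apply ih (by omega)
        · exact Finset.insert_subset ha.1 hR
        · rw [Finset.card_insert_of_notMem ha.2]; omega
  refine eq_zero_of_avoidSum (lo := lo) (hi := hi) Q x hinv fun R hR => ?_
  have hle := Finset.card_le_card hR
  exact hall (q - R.card) (by omega) R (hR.trans hQI) (by omega)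

end HeckeAlg

namespace HeckeAlg

variable {M : Type} [AddCommGroup M] [Module ℂ M] [Module (HeckeAlg ℓ) M]
  [IsScalarTower ℂ (HeckeAlg ℓ) M]

theorem jm_smul (lo : ℕ) (m : Fin ℓ) (x : M) :
    jm lo m • x = ∑ j ∈ strands ℓ lo m, sigma (Equiv.swap j m) • x := by
  unfold jm strands
  rw [Finset.sum_smul, Finset.sum_filter]
  refine Finset.sum_congr rfl fun j _ => ?_
  simp only [Fin.lt_def, ite_smul, zero_smul]

theorem jm_smul_of_inv {lo : ℕ} {m : Fin ℓ} (h : lo ≤ (m : ℕ)) {x : M}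
    (hx : ∀ j : Fin ℓ, lo ≤ (j : ℕ) → (j : ℕ) < m → sigma (Equiv.swap j m) • x = x) :
    jm lo m • x = (((m : ℕ) : ℂ) - lo) • x := by
  obtain ⟨k, hk⟩ := Nat.exists_eq_add_of_le h
  rw [jm_smul, Finset.sum_congr rfl (g := fun _ => x), Finset.sum_const,
    ← Nat.cast_smul_eq_nsmul ℂ, hk, card_strands (by omega)]
  · congr 1; push_cast; ring
  · intro j hj
    rw [mem_strands] at hj
    exact hx j hj.1 hj.2

theorem strands_union {a b c : ℕ} (h : a ≤ b) (h' : b ≤ c) :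
    strands ℓ a c = strands ℓ a b ∪ strands ℓ b c := by
  ext i; simp only [mem_strands, Finset.mem_union]; omega

theorem strands_disjoint (a b c : ℕ) : Disjoint (strands ℓ a b) (strands ℓ b c) := by
  rw [Finset.disjoint_left]; intro i; simp only [mem_strands]; omega

/-- The part of the symmetriser consisting of the permutations taking `i` to `m`. -/
def symmPart (ℓ lo hi : ℕ) (m i : Fin ℓ) : HeckeAlg ℓ :=
  ∑ σ ∈ permFinset ℓ lo hi with σ⁻¹ m = i, sigma σ

theorem symmPart_mul_swap {lo hi : ℕ} {m i j : Fin ℓ} (hi' : i ∈ strands ℓ lo hi)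
    (hj : j ∈ strands ℓ lo hi) :
    symmPart ℓ lo hi m i * sigma (Equiv.swap j i) = symmPart ℓ lo hi m j := by
  have hsw : Equiv.swap j i ∈ PermIco ℓ lo hi :=
    swap_mem_permIco (mem_strands.1 hj) (mem_strands.1 hi')
  unfold symmPart
  rw [Finset.sum_mul]
  refine Finset.sum_nbij' (· * Equiv.swap j i) (· * Equiv.swap j i) ?_ ?_ ?_ ?_ ?_
  · intro σ hσ
    rw [Finset.mem_filter, mem_permFinset] at hσ ⊢
    exact ⟨mul_mem hσ.1 hsw, by rw [mul_inv_rev, Equiv.Perm.mul_apply, hσ.2, Equiv.swap_inv,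
      Equiv.swap_apply_right]⟩
  · intro σ hσ
    rw [Finset.mem_filter, mem_permFinset] at hσ ⊢
    exact ⟨mul_mem hσ.1 hsw, by rw [mul_inv_rev, Equiv.Perm.mul_apply, hσ.2, Equiv.swap_inv,
      Equiv.swap_apply_left]⟩
  · intro σ _; simp
  · intro σ _; simp
  · intro σ _; rw [sigma_mul]

theorem yRel_mul_symm_smul {lo hi : ℕ} {m : Fin ℓ} (hm : m ∈ strands ℓ lo hi) (x : M) :
    yRel lo m • symm ℓ lo hi • x =
      ∑ i ∈ strands ℓ lo hi, symmPart ℓ lo hi m i • yRel lo i • x := by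
  unfold symm symmPart
  rw [Finset.sum_smul, Finset.smul_sum,
    ← Finset.sum_fiberwise_of_maps_to (s := permFinset ℓ lo hi) (t := strands ℓ lo hi)
      (g := fun σ => σ⁻¹ m)]
  · refine Finset.sum_congr rfl fun i _ => ?_
    rw [Finset.sum_smul]
    refine Finset.sum_congr rfl fun σ hσ => ?_
    rw [Finset.mem_filter, mem_permFinset] at hσ
    have : m = σ i := by rw [← hσ.2]; simp
    rw [← mul_smul, ← mul_smul, sigma_mul_yRel σ hσ.1, this]
  · intro σ hσ
    rw [mem_permFinset] at hσ
    exact mem_strands.2 (permIco_apply_mem (inv_mem hσ) (mem_strands.1 hm))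

theorem symm_smul_eq_sum_symmPart {lo hi : ℕ} {m : Fin ℓ} (hm : m ∈ strands ℓ lo hi) (x : M) :
    symm ℓ lo hi • x = ∑ i ∈ strands ℓ lo hi, symmPart ℓ lo hi m i • x := by
  unfold symm symmPart
  rw [Finset.sum_smul,
    ← Finset.sum_fiberwise_of_maps_to (s := permFinset ℓ lo hi) (t := strands ℓ lo hi)
      (g := fun σ => σ⁻¹ m)]
  · exact Finset.sum_congr rfl fun i _ => by rw [Finset.sum_smul]
  · intro σ hσ
    rw [mem_permFinset] at hσ
    exact mem_strands.2 (permIco_apply_mem (inv_mem hσ) (mem_strands.1 hm))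

/-- A segment may be exchanged with a longer segment having the same end. -/
theorem Reach.same_end_swap (a b : ℂ) (q k : ℕ) (hqk : q ≤ k) (hab : a + q = b + k) :
    Reach ℓ [(a, q), (b, k)] [(b, k), (a, q)] := by
  refine ⟨by simp [add_comm], fun p hp => ?_⟩
  simp only [total_cons, total_nil] at hp ⊢
  refine ⟨symm ℓ p (p + k), loc_mono le_rfl (by omega) (symm_mem_loc p (p + k)),
    fun M _ _ _ _ x hx ht => ?_⟩
  rw [hasType_pair] at ht
  obtain ⟨⟨h1, h2⟩, h3, h4⟩ := ht
  refine ⟨fun h0 => hx (eq_zero_of_symm_smul (by omega) hqk h2 h4 h0), ?_⟩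
  have hyQ : ∀ i ∈ strands ℓ p (p + q), yRel p i • x = a • x := by
    intro i hi
    rw [mem_strands] at hi
    unfold yRel
    rw [sub_smul, h1 i hi.1 hi.2, jm_smul_of_inv hi.1, ← sub_smul]
    · congr 1; ring
    · intro j hj hji
      exact h2 _ (swap_mem_permIco ⟨hj, by omega⟩ hi)
  have hyB : ∀ i ∈ strands ℓ (p + q) (p + k), yRel p i • x =
      b • x - ∑ j ∈ strands ℓ p (p + q), sigma (Equiv.swap j i) • x := by
    intro i hi
    rw [mem_strands] at hi
    have e := jm_smul_of_inv (lo := p + q) (m := i) (x := x) hi.1 (fun j hj hji =>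
      h4 _ (swap_mem_permIco ⟨hj, by omega⟩ ⟨hi.1, by omega⟩))
    rw [jm_smul] at e
    unfold yRel
    rw [sub_smul, h3 i hi.1 (by omega), jm_smul, strands_union (b := p + q) (by omega) hi.1,
      Finset.sum_union (strands_disjoint _ _ _), e, add_comm (Finset.sum _ _), ← sub_sub,
      ← sub_smul]
    congr 2; push_cast; ring
  have hyP : ∀ m ∈ strands ℓ p (p + k), yRel p m • symm ℓ p (p + k) • x =
      b • symm ℓ p (p + k) • x := by
    intro m hm
    rw [yRel_mul_symm_smul hm, symm_smul_eq_sum_symmPart hm, strands_union (b := p + q) (by omega) (by omega),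
      Finset.sum_union (strands_disjoint _ _ _), Finset.sum_union (strands_disjoint _ _ _)]
    have e1 : ∑ i ∈ strands ℓ p (p + q), symmPart ℓ p (p + k) m i • yRel p i • x =
        a • ∑ i ∈ strands ℓ p (p + q), symmPart ℓ p (p + k) m i • x := by
      rw [Finset.smul_sum]
      exact Finset.sum_congr rfl fun i hi => by rw [hyQ i hi, smul_comm]
    have e2 : ∑ i ∈ strands ℓ (p + q) (p + k), symmPart ℓ p (p + k) m i • yRel p i • x =
        b • ∑ i ∈ strands ℓ (p + q) (p + k), symmPart ℓ p (p + k) m i • x -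
          ((k : ℂ) - q) • ∑ i ∈ strands ℓ p (p + q), symmPart ℓ p (p + k) m i • x := by
      have hc : (strands ℓ (p + q) (p + k)).card = k - q := by
        have := card_strands (ℓ := ℓ) (lo := p + q) (k := k - q) (by omega)
        rwa [show p + q + (k - q) = p + k by omega] at this
      rw [Finset.smul_sum, ← Nat.cast_sub hqk, ← hc, Nat.cast_smul_eq_nsmul, ← Finset.sum_const,
        ← Finset.sum_sub_distrib]
      refine Finset.sum_congr rfl fun i hi => ?_
      rw [hyB i hi, smul_sub, smul_comm, Finset.smul_sum]
      congr 1
      refine Finset.sum_congr rfl fun j hj => ?_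
      rw [mem_strands] at hi hj
      rw [← mul_smul, symmPart_mul_swap (mem_strands.2 (by omega)) (mem_strands.2 (by omega))]
    rw [e1, e2, smul_add, show a = b + ((k : ℂ) - q) by linear_combination hab, add_smul]
    abel
  rw [hasType_pair]
  refine ⟨⟨fun m hm hm' => ?_, fun σ hσ => by rw [← mul_smul, sigma_mul_symm hσ]⟩,
    fun m hm hm' => ?_, fun σ hσ => ?_⟩
  · have e := jm_smul_of_inv (lo := p) (m := m) (x := symm ℓ p (p + k) • x) hm (fun j hj hji => by
      rw [← mul_smul, sigma_mul_symm (swap_mem_permIco ⟨hj, by omega⟩ ⟨hm, hm'⟩)])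
    have e2 := hyP m (mem_strands.2 ⟨hm, hm'⟩)
    unfold yRel at e2
    rw [sub_smul, e, sub_eq_iff_eq_add, ← add_smul] at e2
    exact e2
  · rw [← mul_smul, loc_commute (lo := p + k) (hi := p + k + q) (lo' := p) (hi' := p + k)
      (Or.inr le_rfl) (eps_mem_loc ⟨hm, hm'⟩) (symm_mem_loc _ _), mul_smul, h3 m (by omega) (by omega),
      smul_comm]
    congr 1; push_cast; linear_combination -hab
  · rw [← mul_smul, loc_commute (lo := p + k) (hi := p + k + q) (lo' := p) (hi' := p + k)
      (Or.inr le_rfl) (sigma_mem_loc hσ) (symm_mem_loc _ _), mul_smul,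
      h4 σ (permIco_mono (by omega) (by omega) hσ)]

end HeckeAlg

namespace HeckeAlg

/-! ### Extracting the last letters of a dominant list of segments -/

/-- `z - z'` is not a negative integer. -/
def DomC (z z' : ℂ) : Prop := ∀ m : ℕ, z - z' ≠ -((m : ℂ) + 1)

/-- The (exclusive) ends of the segments form a dominant sequence. -/
def DomList (l : List (ℂ × ℕ)) : Prop :=
  l.Pairwise fun s t => DomC (s.1 + s.2) (t.1 + t.2)

/-- A list of points as a list of segments of length one. -/
def singles (Z : List ℂ) : List (ℂ × ℕ) := Z.map fun z => (z, 1)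

@[simp] theorem singles_append (Z Z' : List ℂ) : singles (Z ++ Z') = singles Z ++ singles Z' := by
  simp [singles]

theorem singles_singleton (z : ℂ) : singles [z] = [(z, 1)] := rfl

theorem total_singles (Z : List ℂ) : total (singles Z) = Z.length := by
  induction Z with
  | nil => rfl
  | cons z Z ih => simp only [singles, List.map_cons, total_cons, List.length_cons] at ih ⊢; omega

theorem Reach.generic_single {z a : ℂ} {k : ℕ} (h : ∀ n : ℤ, n ≤ 0 → z - (a + k) ≠ n) :
    Reach ℓ [(z, 1), (a, k)] [(a, k), (z, 1)] := by
  apply Reach.generic_swap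
  intro s hs t ht h1
  obtain rfl : s = 0 := by omega
  rw [Nat.cast_zero, add_zero, pow_two, mul_self_eq_one_iff] at h1
  rcases h1 with h1 | h1
  · refine h (1 - ((k : ℤ) - t)) (by omega) ?_
    push_cast; linear_combination h1
  · refine h (-1 - ((k : ℤ) - t)) (by omega) ?_
    push_cast; linear_combination h1

theorem Reach.pass_singles {a : ℂ} {k : ℕ} (Z : List ℂ)
    (h : ∀ z ∈ Z, ∀ n : ℤ, n ≤ 0 → z - (a + k) ≠ n) :
    Reach ℓ (singles Z ++ [(a, k)]) ((a, k) :: singles Z) := by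
  induction Z with
  | nil => exact Reach.refl _
  | cons z Z ih =>
    have h1 := (ih fun z hz => h z (List.mem_cons_of_mem _ hz)).append_left [(z, 1)]
    have h2 := (Reach.generic_single (ℓ := ℓ) (h z List.mem_cons_self)).append_right (singles Z)
    exact h1.trans h2

theorem Reach.extract_one {a : ℂ} {k : ℕ} (Z : List ℂ) (hZ : Z.Pairwise DomC)
    (hz : ∀ z ∈ Z, DomC z (a + k)) :
    ∃ Z' : List ℂ, Z'.Perm (Z ++ [a + k]) ∧ Z'.Pairwise DomC ∧
      Reach ℓ (singles Z ++ [(a, k + 1)]) ((a, k) :: singles Z') := by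
  induction Z using List.reverseRecOn with
  | nil => exact ⟨[a + k], List.Perm.refl _, List.pairwise_singleton _ _, Reach.split a k 1⟩
  | append_singleton Z z ih =>
    rw [List.pairwise_append] at hZ
    obtain ⟨hZ1, -, hZ2⟩ := hZ
    have hZ2' : ∀ z' ∈ Z, DomC z' z := fun z' h => hZ2 z' h z (List.mem_singleton_self z)
    -- the segment jumps over the last letter
    have jump : Reach ℓ [(z, 1), (a, k + 1)] [(a, k + 1), (z, 1)] → DomC (a + k) z →
        ∃ Z' : List ℂ, Z'.Perm ((Z ++ [z]) ++ [a + k]) ∧ Z'.Pairwise DomC ∧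
          Reach ℓ (singles (Z ++ [z]) ++ [(a, k + 1)]) ((a, k) :: singles Z') := by
      intro hR hd
      obtain ⟨Z', hp, hd', hr⟩ := ih hZ1 fun z' h => hz z' (List.mem_append_left _ h)
      refine ⟨Z' ++ [z], ?_, ?_, ?_⟩
      · refine (hp.append_right [z]).trans ?_
        rw [List.append_assoc, List.append_assoc]
        exact List.Perm.append_left _ List.perm_append_comm
      · rw [List.pairwise_append]
        refine ⟨hd', List.pairwise_singleton _ _, fun c hc d hd1 => ?_⟩
        rw [List.mem_singleton] at hd1
        subst hd1
        have := hp.mem_iff.1 hc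
        rw [List.mem_append, List.mem_singleton] at this
        rcases this with h | rfl
        · exact hZ2' c h
        · exact hd
      · have h1 := hR.append_left (singles Z)
        have h2 := hr.append_right [(z, 1)]
        rw [List.append_assoc] at h2
        rw [singles_append, singles_append, singles_singleton, List.append_assoc]
        exact h1.trans h2
    by_cases hinteger : ∃ n : ℤ, z - (a + k) = n
    · obtain ⟨n, hn⟩ := hinteger
      have hn0 : 0 ≤ n := by
        by_contra! hneg
        refine hz z (by simp) (-n - 1).toNat ?_
        have : (((-n - 1).toNat : ℤ) : ℂ) = ((-n - 1 : ℤ) : ℂ) := by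
          congr 1; omega
        rw [Int.cast_natCast] at this
        rw [this, hn]; push_cast; ring
      rcases hn0.eq_or_lt with rfl | hpos
      · rw [Int.cast_zero, sub_eq_zero] at hn
        refine jump (Reach.same_end_swap z a 1 (k + 1) (by omega) (by rw [hn]; push_cast; ring)) ?_
        intro m hm
        rw [hn, sub_self] at hm
        have : (m : ℂ) + 1 = 0 := by linear_combination hm
        exact Nat.cast_add_one_ne_zero m this
      · refine ⟨(Z ++ [z]) ++ [a + k], List.Perm.refl _, ?_, ?_⟩
        · rw [List.pairwise_append, List.pairwise_append]
          refine ⟨⟨hZ1, List.pairwise_singleton _ _, hZ2⟩, List.pairwise_singleton _ _, ?_⟩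
          intro c hc d hd
          rw [List.mem_singleton] at hd
          subst hd
          exact hz c hc
        · have h1 := (Reach.split (ℓ := ℓ) a k 1).append_left (singles (Z ++ [z]))
          refine h1.trans ?_
          have h2 : Reach ℓ (singles (Z ++ [z]) ++ [(a, k)]) ((a, k) :: singles (Z ++ [z])) := by
            apply Reach.pass_singles
            intro c hc i hi h
            rcases hi.eq_or_lt with rfl | hi'
            · rw [Int.cast_zero, sub_eq_zero] at h
              rw [List.mem_append, List.mem_singleton] at hc
              rcases hc with hc | rfl
              · refine hZ2' c hc (n - 1).toNat ?_
                have : (((n - 1).toNat : ℤ) : ℂ) = ((n - 1 : ℤ) : ℂ) := by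
                  congr 1; omega
                rw [Int.cast_natCast] at this
                rw [this, h]; push_cast; linear_combination -hn
              · rw [h, sub_self] at hn
                exact absurd (by exact_mod_cast hn) hpos.ne
            · refine hz c hc (-i - 1).toNat ?_
              have : (((-i - 1).toNat : ℤ) : ℂ) = ((-i - 1 : ℤ) : ℂ) := by
                congr 1; omega
              rw [Int.cast_natCast] at this
              rw [this, h]; push_cast; ring
          have h3 := h2.append_right [(a + k, 1)]
          rw [List.append_assoc] at h3
          rw [singles_append _ [a + (k : ℂ)], singles_singleton]
          exact h3
    · push Not at hinteger
      refine jump (Reach.generic_single fun n _ h => hinteger (n + 1) ?_) fun m h => hinteger (m + 1) ?_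
      · push_cast at h ⊢; linear_combination h
      · push_cast; linear_combination -h

theorem Reach.extract (l : List (ℂ × ℕ)) (hpos : ∀ s ∈ l, 0 < s.2) (hd : DomList l) :
    ∃ Z : List ℂ, Z.Perm (l.map fun s => s.1 + s.2 - 1) ∧ Z.Pairwise DomC ∧
      Reach ℓ l (l.map (fun s => (s.1, s.2 - 1)) ++ singles Z) := by
  induction l using List.reverseRecOn with
  | nil => exact ⟨[], List.Perm.refl _, List.Pairwise.nil, Reach.refl _⟩
  | append_singleton l s ih =>
    unfold DomList at hd
    rw [List.pairwise_append] at hd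
    obtain ⟨Z, hp, hZ, hr⟩ := ih (fun t ht => hpos t (List.mem_append_left _ ht)) hd.1
    obtain ⟨a, k⟩ := s
    obtain ⟨k, rfl⟩ : ∃ k', k = k' + 1 := ⟨k - 1, by have := hpos (a, k) (by simp); simp at this; omega⟩
    obtain ⟨Z', hp', hZ', hr'⟩ := Reach.extract_one (ℓ := ℓ) (a := a) (k := k) Z hZ (by
      intro z hz m hm
      have := hp.mem_iff.1 hz
      rw [List.mem_map] at this
      obtain ⟨t, ht, rfl⟩ := this
      refine hd.2.2 t ht _ (List.mem_singleton_self _) m ?_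
      push_cast
      linear_combination hm)
    refine ⟨Z', hp'.trans ?_, hZ', ?_⟩
    · rw [List.map_append]
      refine (hp.append_right _).trans (List.Perm.of_eq ?_)
      simp; ring
    · have h1 := hr.append_right [(a, k + 1)]
      rw [List.append_assoc] at h1
      have h2 := hr'.append_left (l.map (fun s => (s.1, s.2 - 1)))
      simpa using h1.trans h2

end HeckeAlg

namespace HeckeAlg

/-! ### Sign vectors -/

/-- The product of `u - ε_m` over the strands `m ∈ [lo, lo + k)`. -/
def charProd (ℓ lo : ℕ) (u : ℂ) : ℕ → HeckeAlg ℓ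
  | 0 => 1
  | k + 1 => charProd ℓ lo u k * (algebraMap ℂ _ u - epsN ℓ (lo + k))

theorem charProd_commute (lo k : ℕ) (u : ℂ) {z : HeckeAlg ℓ}
    (hz : ∀ i, lo ≤ i → i < lo + k → z * epsN ℓ i = epsN ℓ i * z) :
    z * charProd ℓ lo u k = charProd ℓ lo u k * z := by
  induction k with
  | zero => exact Commute.one_right z
  | succ k ih =>
    unfold charProd
    rw [← mul_assoc, ih fun i h1 h2 => hz i h1 (by omega), mul_assoc, mul_assoc]
    congr 1
    rw [mul_sub, sub_mul, hz _ (by omega) (by omega), Algebra.commutes]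

theorem charProd_succ (lo k : ℕ) (u : ℂ) :
    charProd ℓ lo u (k + 1) = charProd ℓ (lo + 1) u k * (algebraMap ℂ _ u - epsN ℓ lo) := by
  have h : (algebraMap ℂ (HeckeAlg ℓ) u - epsN ℓ lo) * charProd ℓ (lo + 1) u k =
      charProd ℓ (lo + 1) u k * (algebraMap ℂ _ u - epsN ℓ lo) := by
    apply charProd_commute
    intro i _ _
    rw [mul_sub, sub_mul, epsN_comm, Algebra.commutes]
  rw [← h]; clear h
  induction k with
  | zero => simp [charProd]
  | succ k ih =>
    rw [charProd, ih, charProd, mul_assoc, show lo + 1 + k = lo + (k + 1) by omega]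

theorem simpleN_mul_charProd (lo k : ℕ) (u : ℂ) (hk : lo + k ≤ ℓ) (i : ℕ) (h1 : lo ≤ i)
    (h2 : i + 1 < lo + k) :
    simpleN ℓ i * charProd ℓ lo u k = charProd ℓ lo u k * simpleN ℓ i := by
  induction k with
  | zero => omega
  | succ k ih =>
    rcases Nat.lt_or_ge (i + 1) (lo + k) with h | h
    · have e := simpleN_epsN_of_ne (ℓ := ℓ) i (lo + k) (by omega) (by omega)
      have e2 := ih (by omega) h
      unfold charProd
      rw [← mul_assoc, e2, mul_assoc, mul_assoc]
      congr 1
      rw [mul_sub, sub_mul, e, Algebra.commutes]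
    · obtain ⟨k, rfl⟩ : ∃ k', k = k' + 1 := ⟨k - 1, by omega⟩
      obtain rfl : i = lo + k := by omega
      have e := charProd_commute (ℓ := ℓ) lo k u (z := simpleN ℓ (lo + k))
        (fun j _ _ => simpleN_epsN_of_ne (lo + k) j (by omega) (by omega))
      have f1 := simpleN_epsN (ℓ := ℓ) (lo + k) (by omega)
      have f2 := simpleN_epsN_succ (ℓ := ℓ) (lo + k) (by omega)
      unfold charProd charProd
      rw [mul_assoc, ← mul_assoc, e, mul_assoc, mul_assoc]
      congr 1
      rw [← add_assoc lo k 1]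
      have hc := Algebra.commutes (A := HeckeAlg ℓ) u (simpleN ℓ (lo + k))
      have hc1 := Algebra.commutes (A := HeckeAlg ℓ) u (epsN ℓ (lo + k))
      have hc2 := Algebra.commutes (A := HeckeAlg ℓ) u (epsN ℓ (lo + k + 1))
      have hee := epsN_comm (ℓ := ℓ) (lo + k) (lo + k + 1)
      generalize simpleN ℓ (lo + k) = s at *
      generalize epsN ℓ (lo + k) = a at *
      generalize epsN ℓ (lo + k + 1) = b at *
      generalize algebraMap ℂ (HeckeAlg ℓ) u = U at *
      linear_combination (norm := noncomm_ring) -(hc * U) - U * hc + hc * b - U * f2 - f1 * U +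
        b * hc + hc2 * s - hc1 * s + f1 * b + b * f2 - hee * s

theorem charProd_central {lo k : ℕ} (hk : lo + k ≤ ℓ) (u : ℂ) {x : HeckeAlg ℓ}
    (hx : x ∈ loc ℓ lo (lo + k)) : x * charProd ℓ lo u k = charProd ℓ lo u k * x := by
  refine commute_of_mem_loc ?_ ?_ hx
  · intro m _
    apply charProd_commute
    intro i _ _
    rw [← epsN_val, epsN_comm]
  · intro σ hσ
    refine permIco_induction (P := fun σ => sigma σ * charProd ℓ lo u k = charProd ℓ lo u k * sigma σ)
      (by rw [sigma_one, one_mul, mul_one]) ?_ σ hσ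
    intro m m' hm hm' hlt σ hσ
    have e := simpleN_mul_charProd (ℓ := ℓ) lo k u hk m hm (by omega)
    unfold simpleN at e
    rw [dif_pos (by omega)] at e
    have e2 : (⟨(m : ℕ) + 1, by omega⟩ : Fin ℓ) = m' := Fin.ext hm'.symm
    rw [e2] at e
    rw [← sigma_mul, mul_assoc, hσ, ← mul_assoc, ← mul_assoc, ← e]

variable {M : Type} [AddCommGroup M] [Module ℂ M] [Module (HeckeAlg ℓ) M]
  [IsScalarTower ℂ (HeckeAlg ℓ) M]

/-- Transpositions of strands in `[lo, hi)` act by `-1`. -/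
def Anti (lo hi : ℕ) (x : M) : Prop :=
  ∀ i j : Fin ℓ, i ≠ j → i ∈ strands ℓ lo hi → j ∈ strands ℓ lo hi →
    sigma (Equiv.swap i j) • x = -x

theorem sigma_mul_jm_of_lt {lo : ℕ} {m : Fin ℓ} {σ : Equiv.Perm (Fin ℓ)}
    (hσ : σ ∈ PermIco ℓ lo m) : sigma σ * jm lo m = jm lo m * sigma σ := by
  have h1 := sigma_mul_yRel σ hσ m
  rw [hσ m (by omega)] at h1
  have h2 := sigma_mul_eps_of_notMem hσ (m := m) (by omega)
  unfold yRel at h1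
  rw [mul_sub, sub_mul, h2, sub_right_inj] at h1
  exact h1

theorem jm_mem_loc {lo hi : ℕ} {m : Fin ℓ} (hm : (m : ℕ) < hi) : jm lo m ∈ loc ℓ lo hi := by
  unfold jm
  refine sum_mem fun j _ => ?_
  split_ifs with h
  · have := h.2; rw [Fin.lt_def] at this
    exact sigma_mem_loc (swap_mem_permIco (by omega) (by omega))
  · exact zero_mem _

theorem charProd_smul_comm (lo k : ℕ) (u : ℂ) (hk : lo + k ≤ ℓ) {x : HeckeAlg ℓ}
    (hx : x ∈ loc ℓ lo (lo + k)) (v : M) :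
    charProd ℓ lo u k • x • v = x • charProd ℓ lo u k • v := by
  rw [← mul_smul, ← charProd_central hk u hx, mul_smul]

theorem sign_step_ne_zero {lo k : ℕ} (hk : lo + k < ℓ) {v : M} (hv : v ≠ 0) {z : ℂ} {c : ℂ → ℂ}
    (hz : eps ⟨lo + k, hk⟩ • v = z • v) (ha : Anti (ℓ := ℓ) lo (lo + k) v)
    (hF : ∀ u, charProd ℓ lo u k • v = c u • v) (hc : c (z - 1) ≠ 0) :
    (1 - jm lo ⟨lo + k, hk⟩ : HeckeAlg ℓ) • v ≠ 0 := by
  intro h0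
  set m : Fin ℓ := ⟨lo + k, hk⟩ with hm
  rw [sub_smul, one_smul, sub_eq_zero] at h0
  rcases Nat.eq_zero_or_pos k with rfl | hkpos
  · rw [jm_smul, show strands ℓ lo m = ∅ from by
      ext i; simp [mem_strands, hm], Finset.sum_empty] at h0
    exact hv h0
  set b : Fin ℓ := ⟨lo, by omega⟩ with hb
  have hbm : (b : ℕ) < m := by simp [hb, hm, hkpos]
  have hy : yRel lo m • v = (z - 1) • v := by
    unfold yRel; rw [sub_smul, hz, ← h0, sub_smul, one_smul]
  have hyb : yRel lo b = epsN ℓ lo := by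
    unfold yRel jm
    rw [Finset.sum_eq_zero, sub_zero, hb, epsN, dif_pos]
    intro j _
    rw [if_neg]; rw [Fin.lt_def]; simp [hb]
  have hb0 : charProd ℓ lo (z - 1) k • sigma (Equiv.swap b m) • v = 0 := by
    obtain ⟨k, rfl⟩ : ∃ k', k = k' + 1 := ⟨k - 1, by omega⟩
    have e := sigma_mul_yRel (lo := lo) (hi := ℓ) (Equiv.swap b m)
      (swap_mem_permIco ⟨by simp [hb], by simp⟩ ⟨by simp [hm], by simp⟩) m
    rw [Equiv.swap_apply_right, hyb] at e
    rw [charProd_succ, mul_smul, sub_smul, ← mul_smul (epsN ℓ lo), ← e, mul_smul, hy,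
      smul_comm (sigma (Equiv.swap b m)) (z - 1) v, algebraMap_smul, sub_self, smul_zero]
  have hj0 : ∀ j ∈ strands ℓ lo m, charProd ℓ lo (z - 1) k • sigma (Equiv.swap j m) • v = 0 := by
    intro j hj
    have hj' := mem_strands.1 hj
    rcases eq_or_ne j b with rfl | hjb
    · exact hb0
    · have hjm : j ≠ m := by rintro rfl; omega
      have hbm' : b ≠ m := by rintro h; rw [h] at hbm; omega
      have e : Equiv.swap j m = Equiv.swap b j * Equiv.swap b m * Equiv.swap b j := by
        rw [Equiv.swap_comm b m, Equiv.swap_mul_swap_mul_swap hbm'.symm hjm.symm]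
      have hmem : b ∈ strands ℓ lo (lo + k) := mem_strands.2 (by simp [hb]; omega)
      rw [e, ← sigma_mul, ← sigma_mul, mul_smul, mul_smul, ha b j hjb.symm hmem hj, smul_neg,
        smul_neg,
        smul_neg, charProd_smul_comm _ _ _ (by omega)
          (sigma_mem_loc (swap_mem_permIco (mem_strands.1 hmem) hj')), hb0, smul_zero, neg_zero]
  have hfin : charProd ℓ lo (z - 1) k • v = 0 := by
    rw [h0, jm_smul, Finset.smul_sum]
    exact Finset.sum_eq_zero hj0
  rw [hF, smul_eq_zero] at hfin
  exact hfin.elim hc hv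

theorem sign_step_anti {lo k : ℕ} (hk : lo + k < ℓ) {v : M} (ha : Anti (ℓ := ℓ) lo (lo + k) v) :
    Anti (ℓ := ℓ) lo (lo + k + 1) ((1 - jm lo ⟨lo + k, hk⟩ : HeckeAlg ℓ) • v) := by
  set m : Fin ℓ := ⟨lo + k, hk⟩ with hm
  have hcase : ∀ i ∈ strands ℓ lo (lo + k), sigma (Equiv.swap i m) • (1 - jm lo m : HeckeAlg ℓ) • v =
      -((1 - jm lo m : HeckeAlg ℓ) • v) := by
    intro i hi
    have hi' := mem_strands.1 hi
    rw [sub_smul, one_smul, smul_sub, jm_smul, ← Finset.add_sum_erase _ _ hi, smul_add, ← mul_smul,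
      sigma_swap_mul_self, one_smul, Finset.smul_sum]
    have : ∑ j ∈ (strands ℓ lo m).erase i, sigma (Equiv.swap i m) • sigma (Equiv.swap j m) • v =
        - ∑ j ∈ (strands ℓ lo m).erase i, sigma (Equiv.swap j m) • v := by
      rw [← Finset.sum_neg_distrib]
      refine Finset.sum_congr rfl fun j hj => ?_
      rw [Finset.mem_erase] at hj
      have hj' := mem_strands.1 hj.2
      have hjm : j ≠ m := by rintro rfl; omega
      have him : i ≠ m := by rintro rfl; simp [hm] at hi'
      have e : Equiv.swap i m * Equiv.swap j m = Equiv.swap j m * Equiv.swap i j := by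
        rw [Equiv.swap_mul_eq_mul_swap, Equiv.swap_inv, Equiv.swap_apply_right,
          Equiv.swap_apply_of_ne_of_ne hj.1.symm him]
      rw [← mul_smul, sigma_mul, e, ← sigma_mul, mul_smul, ha i j hj.1.symm hi hj.2, smul_neg]
    rw [this]
    abel
  intro i j hij hi hj
  have hi' := mem_strands.1 hi
  have hj' := mem_strands.1 hj
  rcases eq_or_ne j m with rfl | hjm
  · refine hcase i (mem_strands.2 ⟨hi'.1, ?_⟩)
    have : (i : ℕ) ≠ lo + k := fun h => hij (Fin.ext h)
    omega
  rcases eq_or_ne i m with rfl | him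
  · rw [Equiv.swap_comm]
    refine hcase j (mem_strands.2 ⟨hj'.1, ?_⟩)
    have : (j : ℕ) ≠ lo + k := fun h => hjm (Fin.ext h)
    omega
  have e1 : (i : ℕ) ≠ lo + k := fun h => him (Fin.ext h)
  have e2 : (j : ℕ) ≠ lo + k := fun h => hjm (Fin.ext h)
  have e := sigma_mul_jm_of_lt (lo := lo) (m := m) (σ := Equiv.swap i j)
    (swap_mem_permIco ⟨hi'.1, by simp [hm]; omega⟩ ⟨hj'.1, by simp [hm]; omega⟩)
  rw [← mul_smul, mul_sub, e, mul_one, ← one_mul (sigma (Equiv.swap i j)), ← mul_assoc, ← sub_mul,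
    mul_one,
    mul_smul, ha i j hij (mem_strands.2 ⟨hi'.1, by omega⟩) (mem_strands.2 ⟨hj'.1, by omega⟩),
    smul_neg]

/-- A nonzero vector of dominant weight generates, under the strands `[lo, lo + Z.length)`, a
nonzero vector on which the permutations act by the sign. -/
theorem exists_sign (Z : List ℂ) (hZ : Z.Pairwise DomC) (lo : ℕ) (hlo : lo + Z.length ≤ ℓ) (x : M)
    (hx : x ≠ 0) (ht : HasType (ℓ := ℓ) lo (singles Z) x) :
    ∃ h ∈ loc ℓ lo (lo + Z.length), h • x ≠ 0 ∧ Anti (ℓ := ℓ) lo (lo + Z.length) (h • x) ∧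
      ∀ u, charProd ℓ lo u Z.length • h • x = (Z.map (u - ·)).prod • h • x := by
  induction Z using List.reverseRecOn with
  | nil =>
    refine ⟨1, one_mem _, by rwa [one_smul], ?_, fun u => ?_⟩
    · intro i j _ hi _
      rw [mem_strands] at hi; simp at hi; omega
    · simp [charProd]
  | append_singleton Z z ih =>
    rw [List.pairwise_append] at hZ
    rw [singles_append, hasType_append, total_singles] at ht
    rw [List.length_append, List.length_singleton] at hlo ⊢
    obtain ⟨h, hh, hne, ha, hF⟩ := ih hZ.1 (by omega) ht.1
    have hk : lo + Z.length < ℓ := by omega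
    have hz : eps ⟨lo + Z.length, hk⟩ • h • x = z • h • x := by
      have e := ht.2.1 ⟨lo + Z.length, hk⟩ (by simp) (by simp)
      rw [← mul_smul, ← loc_commute (lo := lo) (hi := lo + Z.length) (lo' := lo + Z.length)
        (hi' := lo + Z.length + 1) (Or.inl le_rfl) hh (eps_mem_loc (by simp)), mul_smul, e]
      rw [smul_comm]; congr 1; push_cast; ring
    have hmem : (1 - jm lo ⟨lo + Z.length, hk⟩ : HeckeAlg ℓ) ∈ loc ℓ lo (lo + (Z.length + 1)) :=
      sub_mem (one_mem _) (jm_mem_loc (by simp))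
    refine ⟨(1 - jm lo ⟨lo + Z.length, hk⟩) * h, mul_mem hmem (loc_mono le_rfl (by omega) hh),
      ?_, ?_, ?_⟩
    · rw [mul_smul]
      refine sign_step_ne_zero hk hne hz ha hF ?_
      apply List.prod_ne_zero
      intro h0
      rw [List.mem_map] at h0
      obtain ⟨z', hz', h1⟩ := h0
      refine hZ.2.2 z' hz' z (List.mem_singleton_self z) 0 ?_
      push_cast; linear_combination -h1
    · rw [mul_smul]; exact sign_step_anti hk ha
    · intro u
      have hF' : charProd ℓ lo u (Z.length + 1) • h • x =
          ((Z ++ [z]).map (u - ·)).prod • h • x := by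
        rw [charProd, mul_smul, sub_smul (algebraMap ℂ (HeckeAlg ℓ) u), algebraMap_smul, epsN,
          dif_pos hk, hz, ← sub_smul, smul_comm (charProd _ _ _ _) (u - z), hF,
          List.map_append, List.prod_append, smul_smul, mul_comm]
        simp
      rw [mul_smul, charProd_smul_comm _ _ _ (by omega) hmem, hF', smul_comm]

end HeckeAlg

namespace HeckeAlg

/-! ### Degenerate Whittaker vectors -/

variable {M : Type} [AddCommGroup M] [Module ℂ M] [Module (HeckeAlg ℓ) M]
  [IsScalarTower ℂ (HeckeAlg ℓ) M]

theorem charProd_mem_loc {lo k hi : ℕ} (u : ℂ) (hk : lo + k ≤ hi) (hh : hi ≤ ℓ) :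
    charProd ℓ lo u k ∈ loc ℓ lo hi := by
  induction k with
  | zero => exact one_mem _
  | succ k ih =>
    refine mul_mem (ih (by omega)) (sub_mem (Subalgebra.algebraMap_mem _ _) ?_)
    rw [epsN, dif_pos (by omega)]
    exact eps_mem_loc (by simp; omega)

/-- The number of letters of the segments outside of the `j` last letters of each segment. -/
def cut (l : List (ℂ × ℕ)) (j : ℕ) : ℕ := (l.map fun s => s.2 - j).sum

/-- The polynomial with roots the `j`-th letters, counted from the end, of the segments. -/
def levelPoly (l : List (ℂ × ℕ)) (j : ℕ) (u : ℂ) : ℂ :=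
  (l.map fun s => if j < s.2 then u - (s.1 + s.2 - 1 - j) else 1).prod

/-- Remove the empty segments. -/
def nonempties (l : List (ℂ × ℕ)) : List (ℂ × ℕ) := l.filter fun s => 0 < s.2

/-- Remove the last letter of each segment. -/
def shorten (l : List (ℂ × ℕ)) : List (ℂ × ℕ) := l.map fun s => (s.1, s.2 - 1)

theorem cut_zero (l : List (ℂ × ℕ)) : cut l 0 = total l := by
  simp [cut, total]

theorem cut_nonempties (l : List (ℂ × ℕ)) (j : ℕ) : cut (nonempties l) j = cut l j := by
  induction l with
  | nil => rfl
  | cons s t ih =>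
    unfold cut nonempties at *
    rw [List.filter_cons]
    split_ifs with h
    · rw [List.map_cons, List.map_cons, List.sum_cons, List.sum_cons, ih]
    · simp at h
      rw [ih, List.map_cons, List.sum_cons, h]; simp

theorem levelPoly_nonempties (l : List (ℂ × ℕ)) (j : ℕ) (u : ℂ) :
    levelPoly (nonempties l) j u = levelPoly l j u := by
  induction l with
  | nil => rfl
  | cons s t ih =>
    unfold levelPoly nonempties at *
    rw [List.filter_cons]
    split_ifs with h
    · rw [List.map_cons, List.map_cons, List.prod_cons, List.prod_cons, ih]
    · simp at h
      rw [ih, List.map_cons, List.prod_cons, h]; simp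

theorem HasType.nonempties {p : ℕ} {l : List (ℂ × ℕ)} {x : M} (h : HasType (ℓ := ℓ) p l x) :
    HasType (ℓ := ℓ) p (nonempties l) x := by
  induction l generalizing p with
  | nil => trivial
  | cons s t ih =>
    obtain ⟨a, k⟩ := s
    unfold HeckeAlg.nonempties
    rw [List.filter_cons]
    split_ifs with hk
    · exact ⟨h.1, h.2.1, ih h.2.2⟩
    · simp at hk
      subst hk
      exact ih h.2.2

theorem cut_shorten (l : List (ℂ × ℕ)) (j : ℕ) : cut (shorten l) j = cut l (j + 1) := by
  unfold cut shorten
  rw [List.map_map]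
  congr 1
  refine List.map_congr_left fun s _ => ?_
  simp only [Function.comp]; omega

theorem levelPoly_shorten (l : List (ℂ × ℕ)) (hpos : ∀ s ∈ l, 0 < s.2) (j : ℕ) (u : ℂ) :
    levelPoly (shorten l) j u = levelPoly l (j + 1) u := by
  unfold levelPoly shorten
  rw [List.map_map]
  congr 1
  refine List.map_congr_left fun s hs => ?_
  have := hpos s hs
  simp only [Function.comp]
  by_cases h : j + 1 < s.2
  · rw [if_pos h, if_pos (by omega), Nat.cast_sub (by omega)]; push_cast; ring
  · rw [if_neg h, if_neg (by omega)]

theorem DomList.shorten {l : List (ℂ × ℕ)} (hd : DomList l) (hpos : ∀ s ∈ l, 0 < s.2) :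
    DomList (shorten l) := by
  unfold DomList HeckeAlg.shorten at *
  rw [List.pairwise_map]
  refine List.Pairwise.imp_of_mem (fun {s t} hs ht h => ?_) hd
  intro m
  have e := h m
  rw [Nat.cast_sub (hpos s hs), Nat.cast_sub (hpos t ht)]
  intro e'
  apply e
  rw [← e']; push_cast; ring

theorem total_shorten (l : List (ℂ × ℕ)) (hpos : ∀ s ∈ l, 0 < s.2) :
    total (shorten l) + l.length = total l := by
  induction l with
  | nil => rfl
  | cons s t ih =>
    have := ih fun s hs => hpos s (List.mem_cons_of_mem _ hs)
    have h2 := hpos s List.mem_cons_self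
    unfold shorten at *
    simp only [List.map_cons, total_cons, List.length_cons]
    omega

/-- A nonzero vector of dominant type generates a degenerate Whittaker vector: on the strands of
each level, the permutations act by the sign and the polynomial `∏ (u - ε_m)` acts by the
corresponding level polynomial. -/
theorem exists_whittaker (N : ℕ) (l : List (ℂ × ℕ)) (hN : ∀ s ∈ l, s.2 ≤ N) (hd : DomList l)
    (hl : total l ≤ ℓ) (x : M) (hx : x ≠ 0) (ht : HasType (ℓ := ℓ) 0 l x) :
    ∃ h ∈ loc ℓ 0 (total l), h • x ≠ 0 ∧ ∀ j < N,
      Anti (ℓ := ℓ) (cut l (j + 1)) (cut l j) (h • x) ∧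
      ∀ u, charProd ℓ (cut l (j + 1)) u (cut l j - cut l (j + 1)) • h • x =
        levelPoly l j u • h • x := by
  induction N generalizing l x with
  | zero => exact ⟨1, one_mem _, by rwa [one_smul], fun j hj => absurd hj (by omega)⟩
  | succ N ih =>
    have key : ∀ l : List (ℂ × ℕ), (∀ s ∈ l, 0 < s.2) → (∀ s ∈ l, s.2 ≤ N + 1) → DomList l →
        total l ≤ ℓ → HasType (ℓ := ℓ) 0 l x →
        ∃ h ∈ loc ℓ 0 (total l), h • x ≠ 0 ∧ ∀ j < N + 1,
          Anti (ℓ := ℓ) (cut l (j + 1)) (cut l j) (h • x) ∧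
          ∀ u, charProd ℓ (cut l (j + 1)) u (cut l j - cut l (j + 1)) • h • x =
            levelPoly l j u • h • x := by
      clear hN hd hl ht l
      intro l hpos hN hd hl ht
      obtain ⟨Z, hp, hZ, hr⟩ := Reach.extract (ℓ := ℓ) l hpos hd
      change Reach ℓ l (shorten l ++ singles Z) at hr
      have hZl : Z.length = l.length := by rw [hp.length_eq, List.length_map]
      have htot := total_shorten l hpos
      obtain ⟨b, hb, hbM⟩ := hr.2 0 (by omega)
      obtain ⟨hbx, hbt⟩ := hbM M x hx ht
      rw [zero_add] at hb
      rw [hasType_append, zero_add] at hbt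
      obtain ⟨h1, hh1, hne1, ha1, hF1⟩ := exists_sign Z hZ (total (shorten l)) (by omega) (b • x)
        hbx hbt.2
      obtain ⟨h2, hh2, hne2, h3⟩ := ih (shorten l)
        (fun s hs => by
          obtain ⟨t, ht', rfl⟩ := List.mem_map.1 hs
          have := hN t ht'
          simp only; omega)
        (hd.shorten hpos) (by omega) (h1 • b • x) hne1
        (hbt.1.smul_of_commute (Or.inr (by omega)) hh1)
      rw [hZl, htot] at hh1
      rw [hZl, htot] at ha1
      have hcomm : ∀ z ∈ loc ℓ (total (shorten l)) (total l), ∀ v : M, z • h2 • v = h2 • z • v := by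
        intro z hz v
        rw [← mul_smul, ← mul_smul, loc_commute (Or.inr le_rfl) hz hh2]
      have hc1 : cut l (0 + 1) = total (shorten l) := by rw [← cut_shorten, cut_zero]
      refine ⟨h2 * (h1 * b), mul_mem (loc_mono le_rfl (by omega) hh2)
        (mul_mem (loc_mono (by omega) le_rfl hh1) hb), by rwa [mul_smul, mul_smul], ?_⟩
      intro j hj
      rw [mul_smul, mul_smul]
      rcases j with _ | j
      · rw [hc1, cut_zero]
        constructor
        · intro i j hij hi hj
          rw [hcomm _ (sigma_mem_loc (swap_mem_permIco (mem_strands.1 hi) (mem_strands.1 hj))),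
            ha1 i j hij hi hj, smul_neg]
        · intro u
          rw [hcomm _ (charProd_mem_loc u (by omega) hl),
            show total l - total (shorten l) = Z.length by omega, hF1, smul_comm h2]
          congr 1
          rw [(hp.map _).prod_eq, List.map_map]
          unfold levelPoly
          congr 1
          refine List.map_congr_left fun s hs => ?_
          rw [if_pos (hpos s hs)]
          simp
      · have := h3 j (by omega)
        rwa [cut_shorten, cut_shorten, show (levelPoly (shorten l) j) = levelPoly l (j + 1) from
          funext fun u => levelPoly_shorten l hpos j u] at this
    have hsub : ∀ s ∈ nonempties l, s ∈ l := fun s hs => (List.mem_filter.1 hs).1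
    have htn : total (nonempties l) = total l := by rw [← cut_zero, cut_nonempties, cut_zero]
    have := key (nonempties l) (fun s hs => by simpa using (List.mem_filter.1 hs).2)
      (fun s hs => hN s (hsub s hs)) (hd.filter _) (by omega) ht.nonempties
    simpa only [htn, cut_nonempties, levelPoly_nonempties] using this

end HeckeAlg

namespace HeckeAlg

/-! ### Elementary tensors in `D_ℓ(M)` -/

section Tens

variable {n : ℕ} {M : Type} [AddCommGroup M] [Module ℂ M]

/-- The class of `x ⊗ e_w` in `D_ℓ(M)`. -/
def tens (n : ℕ) (ρ : Hecke ℓ →ₐ[ℂ] Module.End ℂ M) (w : Word ℓ n) (x : M) : Dmod n ρ :=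
  Submodule.Quotient.mk (Pi.single w x)

theorem tens_add (ρ : Hecke ℓ →ₐ[ℂ] Module.End ℂ M) (w : Word ℓ n) (x x' : M) :
    tens n ρ w (x + x') = tens n ρ w x + tens n ρ w x' := by
  unfold tens; rw [Pi.single_add]; rfl

theorem tens_smul (ρ : Hecke ℓ →ₐ[ℂ] Module.End ℂ M) (w : Word ℓ n) (c : ℂ) (x : M) :
    tens n ρ w (c • x) = c • tens n ρ w x := by
  unfold tens; rw [Pi.single_smul]; rfl

theorem tens_zero (ρ : Hecke ℓ →ₐ[ℂ] Module.End ℂ M) (w : Word ℓ n) :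
    tens n ρ w 0 = 0 := by
  unfold tens; rw [Pi.single_zero]; rfl

theorem tens_neg (ρ : Hecke ℓ →ₐ[ℂ] Module.End ℂ M) (w : Word ℓ n) (x : M) :
    tens n ρ w (-x) = - tens n ρ w x := by
  rw [← neg_one_smul ℂ x, tens_smul, neg_one_smul]

theorem mk_eq_sum_tens (ρ : Hecke ℓ →ₐ[ℂ] Module.End ℂ M) (f : MW ℓ n M) :
    (Submodule.Quotient.mk f : Dmod n ρ) = ∑ w, tens n ρ w (f w) := by
  conv_lhs => rw [← Finset.univ_sum_single f]
  exact map_sum (NSub n ρ).mkQ _ _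

theorem permOp_single (σ : Equiv.Perm (Fin ℓ)) (w : Word ℓ n) (x : M) :
    permOp n σ (Pi.single w x) = Pi.single (w ∘ σ.symm) x := by
  funext v
  change (Pi.single w x : MW ℓ n M) (v ∘ σ) = _
  by_cases h : v = w ∘ σ.symm
  · subst h
    rw [Pi.single_eq_same, Function.comp_assoc, Equiv.symm_comp_self, Function.comp_id,
      Pi.single_eq_same]
  · rw [Pi.single_eq_of_ne h, Pi.single_eq_of_ne]
    rintro rfl
    apply h
    rw [Function.comp_assoc, Equiv.self_comp_symm, Function.comp_id]

theorem hOp_single (ρ : Hecke ℓ →ₐ[ℂ] Module.End ℂ M) (h : Hecke ℓ) (w : Word ℓ n) (x : M) :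
    hOp n ρ h (Pi.single w x) = Pi.single w (ρ h x) := by
  funext v
  change ρ h ((Pi.single w x : MW ℓ n M) v) = _
  by_cases e : v = w
  · subst e; simp
  · rw [Pi.single_eq_of_ne e, Pi.single_eq_of_ne e, map_zero]

theorem tauOp_single (m : Fin ℓ) (a b : Fin n) (w : Word ℓ n) (x : M) :
    tauOp m a b (Pi.single w x) = if w m = b then Pi.single (Function.update w m a) x else 0 := by
  funext v
  change (if v m = a then (Pi.single w x : MW ℓ n M) (Function.update v m b) else 0) = _
  by_cases hv : v m = a
  · rw [if_pos hv]
    by_cases hw : Function.update v m b = w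
    · subst hw
      rw [Pi.single_eq_same, Function.update_self, if_pos rfl, Function.update_idem, ← hv,
        Function.update_eq_self, Pi.single_eq_same]
    · rw [Pi.single_eq_of_ne hw]
      split_ifs with hb
      · rw [Pi.single_eq_of_ne]
        rintro rfl
        apply hw
        rw [Function.update_idem, ← hb, Function.update_eq_self]
      · rfl
  · rw [if_neg hv]
    split_ifs with hb
    · rw [Pi.single_eq_of_ne]
      rintro rfl
      exact hv (Function.update_self ..)
    · rfl

theorem sumOp_single (ρ : Hecke ℓ →ₐ[ℂ] Module.End ℂ M) (a b : Fin n) (d : ℕ) (w : Word ℓ n) (x : M) :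
    sumOp n ρ a b d (Pi.single w x) =
      ∑ m : Fin ℓ, if w m = b then Pi.single (Function.update w m a) (ρ (Hecke.y m ^ d) x) else 0 := by
  unfold sumOp
  rw [LinearMap.sum_apply]
  refine Finset.sum_congr rfl fun m _ => ?_
  rw [LinearMap.comp_apply, tauOp_single]
  split_ifs
  · rw [hOp_single]
  · rw [map_zero]

theorem tens_adjacent (ρ : Hecke ℓ →ₐ[ℂ] Module.End ℂ M) (i i' : Fin ℓ) (hi : (i' : ℕ) = i + 1)
    (w : Word ℓ n) (x : M) :
    tens n ρ (w ∘ Equiv.swap i i') (ρ (Hecke.sigma (Equiv.swap i i')) x) = - tens n ρ w x := by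
  rw [← add_eq_zero_iff_eq_neg]
  unfold tens
  rw [← Submodule.Quotient.mk_add, Submodule.Quotient.mk_eq_zero]
  have hlt : (i : ℕ) + 1 < ℓ := by omega
  obtain rfl : i' = ⟨i + 1, hlt⟩ := Fin.ext hi
  refine Submodule.mem_iSup_of_mem i (Submodule.mem_iSup_of_mem hlt ⟨Pi.single w x, ?_⟩)
  rw [LinearMap.add_apply, LinearMap.id_apply]
  unfold sOp
  rw [LinearMap.comp_apply, permOp_single, hOp_single, Equiv.symm_swap]

end Tens

section TensSmul

variable {n : ℕ} {M : Type} [AddCommGroup M] [Module ℂ M] [Module (HeckeAlg ℓ) M]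
  [IsScalarTower ℂ (HeckeAlg ℓ) M]

theorem tens_perm (ρ : Hecke ℓ →ₐ[ℂ] Module.End ℂ M) (hρ : ∀ h x, ρ h x = ofHecke h • x)
    (σ : Equiv.Perm (Fin ℓ)) (w : Word ℓ n) (x : M) :
    tens n ρ w (sigma σ • x) = ((Equiv.Perm.sign σ : ℤ) : ℂ) • tens n ρ (w ∘ σ) x := by
  refine permIco_induction (P := fun σ => ∀ w : Word ℓ n, tens n ρ w (sigma σ • x) =
    ((Equiv.Perm.sign σ : ℤ) : ℂ) • tens n ρ (w ∘ σ) x) ?_ ?_ σ (mem_permIco_full σ) w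
  · intro w
    rw [sigma_one, one_smul, Equiv.Perm.sign_one]; simp
  · intro i i' _ hi _ σ ih w
    have hne : i ≠ i' := by rintro rfl; omega
    have e := tens_adjacent ρ i i' hi (w ∘ Equiv.swap i i') (sigma σ • x)
    rw [hρ] at e
    rw [← sigma_mul, mul_smul, Equiv.Perm.sign_mul, Equiv.Perm.sign_swap hne]
    have e2 : w ∘ Equiv.swap i i' ∘ Equiv.swap i i' = w := by
      funext k; simp
    rw [Function.comp_assoc, e2] at e
    change tens n ρ w (sigma (Equiv.swap i i') • sigma σ • x) = _ at e
    rw [e, ih, Function.comp_assoc, ← Equiv.Perm.coe_mul, ← neg_smul]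
    congr 1
    push_cast; ring

end TensSmul

end HeckeAlg

namespace HeckeAlg

/-! ### Filtration of `H_ℓ` by the degree in the `y_m` -/

/-- The product `y_{m_1} ⋯ y_{m_d}`. -/
def yProd (L : List (Fin ℓ)) : HeckeAlg ℓ := (L.map y).prod

/-- The span of the elements `σ y_{m_1} ⋯ y_{m_d}` with `d < k`. -/
def filLt (ℓ k : ℕ) : Submodule ℂ (HeckeAlg ℓ) :=
  Submodule.span ℂ {h | ∃ (σ : Equiv.Perm (Fin ℓ)) (L : List (Fin ℓ)), L.length < k ∧
    h = sigma σ * yProd L}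

theorem mem_filLt {k : ℕ} (σ : Equiv.Perm (Fin ℓ)) {L : List (Fin ℓ)} (h : L.length < k) :
    sigma σ * yProd L ∈ filLt ℓ k := Submodule.subset_span ⟨σ, L, h, rfl⟩

theorem filLt_mono {k k' : ℕ} (h : k ≤ k') : filLt ℓ k ≤ filLt ℓ k' := by
  refine Submodule.span_mono ?_
  rintro x ⟨σ, L, hL, rfl⟩
  exact ⟨σ, L, by omega, rfl⟩

theorem sigma_mul_mem_filLt (τ : Equiv.Perm (Fin ℓ)) {k : ℕ} {x : HeckeAlg ℓ} (hx : x ∈ filLt ℓ k) :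
    sigma τ * x ∈ filLt ℓ k := by
  refine Submodule.span_induction (p := fun x _ => sigma τ * x ∈ filLt ℓ k) ?_ ?_ ?_ ?_ hx
  · rintro x ⟨σ, L, hL, rfl⟩
    rw [← mul_assoc, sigma_mul]; exact mem_filLt _ hL
  · rw [mul_zero]; exact zero_mem _
  · intro x z _ _ h1 h2; rw [mul_add]; exact add_mem h1 h2
  · intro c x _ h; rw [mul_smul_comm]; exact Submodule.smul_mem _ _ h

theorem y_mul_mem_filLt (m : Fin ℓ) {k : ℕ} {x : HeckeAlg ℓ} (hx : x ∈ filLt ℓ k) :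
    y m * x ∈ filLt ℓ (k + 1) := by
  refine Submodule.span_induction (p := fun x _ => y m * x ∈ filLt ℓ (k + 1)) ?_ ?_ ?_ ?_ hx
  · rintro x ⟨σ, L, hL, rfl⟩
    have e := sigma_mul_y σ (σ.symm m)
    rw [Equiv.apply_symm_apply] at e
    rw [← mul_assoc, ← e, mul_assoc]
    exact mem_filLt σ (L := σ.symm m :: L) (by simp; omega)
  · rw [mul_zero]; exact zero_mem _
  · intro x z _ _ h1 h2; rw [mul_add]; exact add_mem h1 h2
  · intro c x _ h; rw [mul_smul_comm]; exact Submodule.smul_mem _ _ h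

theorem exists_mem_filLt (x : HeckeAlg ℓ) : ∃ k, x ∈ filLt ℓ k := by
  let S : Submodule ℂ (HeckeAlg ℓ) := ⨆ k, filLt ℓ k
  have hdir : Directed (· ≤ ·) (filLt ℓ) := Monotone.directed_le fun a b h => filLt_mono h
  have hmem : ∀ x, x ∈ S ↔ ∃ k, x ∈ filLt ℓ k := fun x => Submodule.mem_iSup_of_directed _ hdir
  rw [← hmem]
  refine mem_of_left_mul S ?_ ?_ ?_ x
  · rw [hmem]
    refine ⟨1, ?_⟩
    have := mem_filLt (ℓ := ℓ) (k := 1) 1 (L := []) (by simp)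
    simpa [sigma_one, yProd] using this
  · intro σ x hx
    rw [hmem] at hx ⊢
    obtain ⟨k, hk⟩ := hx
    exact ⟨k, sigma_mul_mem_filLt σ hk⟩
  · intro i x hx
    rw [hmem] at hx ⊢
    obtain ⟨k, hk⟩ := hx
    refine ⟨k + 1, ?_⟩
    have e : eps i = y i + jm 0 i := by rw [y_eq_yRel, yRel, sub_add_cancel]
    rw [e, add_mul]
    refine add_mem (y_mul_mem_filLt i hk) ?_
    unfold jm
    rw [Finset.sum_mul]
    refine sum_mem fun j _ => ?_
    split_ifs
    · exact filLt_mono (by omega) (sigma_mul_mem_filLt _ hk)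
    · rw [zero_mul]; exact zero_mem _

theorem yProd_perm {L L' : List (Fin ℓ)} (h : L.Perm L') :
    yProd L - yProd L' ∈ filLt ℓ L.length := by
  induction h with
  | nil => rw [sub_self]; exact zero_mem _
  | cons a _ ih =>
    unfold yProd at *
    rw [List.map_cons, List.map_cons, List.prod_cons, List.prod_cons, ← mul_sub]
    exact y_mul_mem_filLt a ih
  | swap a b L =>
    rcases eq_or_ne a b with rfl | hab
    · rw [sub_self]; exact zero_mem _
    have e := y_commutator b a hab.symm
    have e2 : yProd (b :: a :: L) - yProd (a :: b :: L) =
        -(sigma (Equiv.swap b a) * (y a * yProd L - y b * yProd L)) := by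
      have e3 := sigma_mul_y (Equiv.swap b a) a
      have e4 := sigma_mul_y (Equiv.swap b a) b
      rw [Equiv.swap_apply_right] at e3
      rw [Equiv.swap_apply_left] at e4
      unfold yProd
      simp only [List.map_cons, List.prod_cons]
      generalize (L.map y).prod = Y
      linear_combination (norm := noncomm_ring) e * Y + e3 * Y - e4 * Y
    rw [e2]
    refine neg_mem (sigma_mul_mem_filLt _ (sub_mem ?_ ?_))
    · have := mem_filLt (ℓ := ℓ) (k := (b :: a :: L).length) 1 (L := a :: L) (by simp)
      rwa [sigma_one, one_mul] at this
    · have := mem_filLt (ℓ := ℓ) (k := (b :: a :: L).length) 1 (L := b :: L) (by simp)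
      rwa [sigma_one, one_mul] at this
  | trans h1 _ ih1 ih2 =>
    rw [← h1.length_eq] at ih2
    simpa using add_mem ih1 ih2

/-! ### Elements of `H_ℓ` realized by the Yangian -/

/-- `x` is antisymmetric with respect to the stabilizer of the word `u`. -/
def AntiWord {n : ℕ} {M : Type} [AddCommGroup M] [Module (HeckeAlg ℓ) M] (u : Word ℓ n) (x : M) :
    Prop :=
  ∀ i j : Fin ℓ, i ≠ j → u i = u j → sigma (Equiv.swap i j) • x = -x

/-- `f` is realized, on the tensors `x ⊗ e_u` with `x` antisymmetric, by the Yangian element `Y`. -/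
def RealizedBy {n : ℕ} (u : Word ℓ n) (f : MW ℓ n (HeckeAlg ℓ)) (Y : Yangian n) : Prop :=
  ∀ (M : Type) [AddCommGroup M] [Module ℂ M] [Module (HeckeAlg ℓ) M] [IsScalarTower ℂ (HeckeAlg ℓ) M]
    (ρ : Hecke ℓ →ₐ[ℂ] Module.End ℂ M) (_ : ∀ h x, ρ h x = ofHecke h • x)
    (π : Yangian n →ₐ[ℂ] Module.End ℂ (Dmod n ρ)) (_ : IsDrinfeldAction n ρ π)
    (x : M) (_ : AntiWord u x),
    π Y (tens n ρ u x) = Submodule.Quotient.mk fun w => f w • x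

/-- The space of all realized functions. -/
def realized {n : ℕ} (u : Word ℓ n) : Submodule ℂ (MW ℓ n (HeckeAlg ℓ)) where
  carrier := {f | ∃ Y, RealizedBy u f Y}
  zero_mem' := by
    refine ⟨0, ?_⟩
    intro M _ _ _ _ ρ hρ π hπ x hx
    rw [map_zero, LinearMap.zero_apply]
    symm
    rw [Submodule.Quotient.mk_eq_zero]
    convert zero_mem (NSub n ρ) using 1
    funext w; exact zero_smul _ _
  add_mem' := by
    rintro f g ⟨Y, hY⟩ ⟨Z, hZ⟩
    refine ⟨Y + Z, ?_⟩
    intro M _ _ _ _ ρ hρ π hπ x hx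
    rw [map_add, LinearMap.add_apply, hY M ρ hρ π hπ x hx, hZ M ρ hρ π hπ x hx,
      ← Submodule.Quotient.mk_add]
    congr 1
    funext w; exact (add_smul _ _ _).symm
  smul_mem' := by
    rintro c f ⟨Y, hY⟩
    refine ⟨c • Y, ?_⟩
    intro M _ _ _ _ ρ hρ π hπ x hx
    rw [map_smul, LinearMap.smul_apply, hY M ρ hρ π hπ x hx, ← Submodule.Quotient.mk_smul]
    congr 1
    funext w; exact (smul_assoc _ _ _).symm

variable {n : ℕ}

theorem mk_single_smul {M : Type} [AddCommGroup M] [Module ℂ M] [Module (HeckeAlg ℓ) M]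
    (ρ : Hecke ℓ →ₐ[ℂ] Module.End ℂ M) (w : Word ℓ n) (h : HeckeAlg ℓ) (x : M) :
    (Submodule.Quotient.mk (fun v => (Pi.single w h : MW ℓ n (HeckeAlg ℓ)) v • x) : Dmod n ρ) =
      tens n ρ w (h • x) := by
  unfold tens
  congr 1
  funext v
  by_cases e : v = w
  · subst e; simp
  · rw [Pi.single_eq_of_ne e, Pi.single_eq_of_ne e, zero_smul]

/-- The operator inducing `t_{ab}^{(d)}`, on functions with values in `H_ℓ`. -/
def sumH (a b : Fin n) (d : ℕ) (f : MW ℓ n (HeckeAlg ℓ)) : MW ℓ n (HeckeAlg ℓ) := fun w =>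
  ∑ m : Fin ℓ, if w m = a then y m ^ d * f (Function.update w m b) else 0

theorem sumH_mem_realized (u : Word ℓ n) (a b : Fin n) (d : ℕ) {f : MW ℓ n (HeckeAlg ℓ)}
    (hf : f ∈ realized u) : sumH a b d f ∈ realized u := by
  obtain ⟨Y, hY⟩ := hf
  refine ⟨Yangian.t a b d * Y, ?_⟩
  intro M _ _ _ _ ρ hρ π hπ x hx
  rw [map_mul, Module.End.mul_apply, hY M ρ hρ π hπ x hx, hπ]
  congr 1
  funext w
  unfold sumOp sumH
  rw [LinearMap.sum_apply, Finset.sum_apply, Finset.sum_smul]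
  refine Finset.sum_congr rfl fun m _ => ?_
  change ρ (Hecke.y m ^ d) (if w m = a then f (Function.update w m b) • x else 0) = _
  split_ifs
  · rw [hρ, mul_smul, map_pow]; rfl
  · rw [map_zero, zero_smul]

theorem sumH_single (a b : Fin n) (d : ℕ) (w : Word ℓ n) (h : HeckeAlg ℓ) :
    sumH a b d (Pi.single w h) =
      ∑ m : Fin ℓ, if w m = b then Pi.single (Function.update w m a) (y m ^ d * h) else 0 := by
  funext v
  unfold sumH
  rw [Finset.sum_apply]
  refine Finset.sum_congr rfl fun m _ => ?_
  by_cases hv : v m = a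
  · rw [if_pos hv]
    by_cases hw : Function.update v m b = w
    · subst hw
      rw [Pi.single_eq_same, Function.update_self, if_pos rfl, Function.update_idem, ← hv,
        Function.update_eq_self, Pi.single_eq_same]
    · rw [Pi.single_eq_of_ne hw, mul_zero]
      split_ifs with hb
      · rw [Pi.single_eq_of_ne]
        rintro rfl
        apply hw
        rw [Function.update_idem, ← hb, Function.update_eq_self]
      · rfl
  · rw [if_neg hv]
    split_ifs with hb
    · rw [Pi.single_eq_of_ne]
      rintro rfl
      exact hv (Function.update_self ..)
    · rfl

theorem single_sub_single_mem_realized (u w w' : Word ℓ n) (h h' : HeckeAlg ℓ) (c : ℂ)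
    (H : ∀ (M : Type) [AddCommGroup M] [Module ℂ M] [Module (HeckeAlg ℓ) M]
      [IsScalarTower ℂ (HeckeAlg ℓ) M] (ρ : Hecke ℓ →ₐ[ℂ] Module.End ℂ M)
      (_ : ∀ h x, ρ h x = ofHecke h • x) (x : M) (_ : AntiWord u x),
      tens n ρ w (h • x) = c • tens n ρ w' (h' • x)) :
    Pi.single w h - c • (Pi.single w' h' : MW ℓ n (HeckeAlg ℓ)) ∈ realized u := by
  refine ⟨0, ?_⟩
  intro M _ _ _ _ ρ hρ π hπ x hx
  rw [map_zero, LinearMap.zero_apply]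
  have e : (fun v => ((Pi.single w h : MW ℓ n (HeckeAlg ℓ)) - c • (Pi.single w' h' : MW ℓ n (HeckeAlg ℓ))) v • x) =
      (fun v => (Pi.single w h : MW ℓ n (HeckeAlg ℓ)) v • x) -
        c • (fun v => (Pi.single w' h' : MW ℓ n (HeckeAlg ℓ)) v • x) := by
    funext v
    rw [Pi.sub_apply, sub_smul, Pi.sub_apply, Pi.smul_apply, Pi.smul_apply, smul_assoc]
  rw [e, Submodule.Quotient.mk_sub, Submodule.Quotient.mk_smul, mk_single_smul, mk_single_smul,
    H M ρ hρ x hx, sub_self]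

theorem single_sigma_mul_mem_realized (u w : Word ℓ n) (σ : Equiv.Perm (Fin ℓ)) (h : HeckeAlg ℓ)
    (hh : Pi.single (w ∘ σ) h ∈ realized u) : Pi.single w (sigma σ * h) ∈ realized u := by
  have := single_sub_single_mem_realized u w (w ∘ σ) (sigma σ * h) h
    ((Equiv.Perm.sign σ : ℤ) : ℂ) (by
      intro M _ _ _ _ ρ hρ x hx
      rw [mul_smul, tens_perm ρ hρ])
  simpa using add_mem this (Submodule.smul_mem _ ((Equiv.Perm.sign σ : ℤ) : ℂ) hh)

/-- Any tensor `h x ⊗ e_w` is obtained from `x ⊗ e_u`, `x` antisymmetric, by an element of the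
Yangian not depending on `x`. -/
theorem single_mem_realized (u w : Word ℓ n) (h : HeckeAlg ℓ) : Pi.single w h ∈ realized u := by
  obtain ⟨k, hk⟩ := exists_mem_filLt h
  induction k generalizing w h with
  | zero =>
    have : filLt ℓ 0 = ⊥ := by
      unfold filLt; rw [Submodule.span_eq_bot]; rintro x ⟨_, _, h, _⟩; omega
    rw [this, Submodule.mem_bot] at hk
    rw [hk, Pi.single_zero]; exact zero_mem _
  | succ k ih =>
    let supp (w : Word ℓ n) (L : List (Fin ℓ)) : Finset (Fin ℓ) :=
      Finset.univ.filter fun i => i ∈ L ∨ w i ≠ u i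
    have key : ∀ (c : ℕ) (w : Word ℓ n) (L : List (Fin ℓ)), L.length ≤ k → (supp w L).card = c →
        Pi.single w (yProd L) ∈ realized u := by
      intro c
      induction c using Nat.strong_induction_on with
      | _ c ihc =>
      intro w L hL hc
      rcases Nat.eq_zero_or_pos c with h0 | hpos
      · rw [h0, Finset.card_eq_zero] at hc
        have hns : ∀ i, ¬ (i ∈ L ∨ w i ≠ u i) := fun i hi => by
          have : i ∈ supp w L := Finset.mem_filter.2 ⟨Finset.mem_univ _, hi⟩
          rw [hc] at this; simp at this
        obtain rfl : w = u := funext fun i => by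
          by_contra h; exact hns i (Or.inr h)
        obtain rfl : L = [] := List.eq_nil_iff_forall_not_mem.2 fun i hi => hns i (Or.inl hi)
        refine ⟨1, ?_⟩
        intro M _ _ _ _ ρ hρ π hπ x hx
        rw [mk_single_smul, map_one, Module.End.one_apply]
        simp [yProd]
      · rw [← hc] at hpos; replace hpos := Finset.card_pos.1 hpos
        obtain ⟨i, hi⟩ := hpos
        set d := L.count i with hd
        set L' := L.filter (· ≠ i) with hL'
        set w' := Function.update w i (u i) with hw'
        have hperm : L.Perm (List.replicate d i ++ L') := by
          rw [List.perm_iff_count]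
          intro a
          rw [List.count_append, List.count_replicate]
          by_cases ha : a = i
          · subst ha
            rw [if_pos (by simp), hL', List.count_eq_zero_of_not_mem (l := L.filter _) (by simp)]
            rfl
          · rw [if_neg (by simpa using Ne.symm ha), hL', List.count_filter (by simpa using ha), zero_add]
        have hlen : d + L'.length ≤ k := by
          rw [hperm.length_eq, List.length_append, List.length_replicate] at hL
          exact hL
        have hiL' : i ∉ L' := by simp [hL']
        have hsub : supp w' L' ⊆ (supp w L).erase i := by
          intro j hj
          have hj' := (Finset.mem_filter.1 hj).2
          have hji : j ≠ i := by
            rintro rfl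
            rcases hj' with h | h
            · exact hiL' h
            · exact h (Function.update_self ..)
          refine Finset.mem_erase.2 ⟨hji, Finset.mem_filter.2 ⟨Finset.mem_univ _, ?_⟩⟩
          rw [hw', Function.update_of_ne hji] at hj'
          exact hj'.imp (fun h => (List.mem_filter.1 h).1) id
        have hcard : ((supp w L).erase i).card < c := by
          rw [← hc]; exact Finset.card_erase_lt_of_mem hi
        have hbase : Pi.single w' (yProd L') ∈ realized u :=
          ihc _ (lt_of_le_of_lt (Finset.card_le_card hsub) hcard) w' L' (by omega) rfl
        have hsum := sumH_mem_realized u (w i) (u i) d hbase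
        rw [sumH_single] at hsum
        set z : MW ℓ n (HeckeAlg ℓ) := Pi.single w (y i ^ d * yProd L') with hz
        have hterm : ∀ m : Fin ℓ, ∃ e : ℕ, (m = i → e = 1) ∧
            (if w' m = u i then Pi.single (Function.update w' m (w i)) (y m ^ d * yProd L') else 0) -
              (e : ℂ) • z ∈ realized u := by
          intro m
          rcases eq_or_ne m i with rfl | hmi
          · refine ⟨1, fun _ => rfl, ?_⟩
            rw [if_pos (Function.update_self ..), hw', Function.update_idem,
              Function.update_eq_self,
              Nat.cast_one, one_smul, hz, sub_self]
            exact zero_mem _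
          by_cases hwm : w' m = u i
          swap
          · refine ⟨0, fun h => absurd h hmi, ?_⟩
            rw [if_neg hwm, Nat.cast_zero, zero_smul, sub_self]; exact zero_mem _
          rw [if_pos hwm]
          by_cases hm : m ∈ supp w' L'
          · refine ⟨0, fun h => absurd h hmi, ?_⟩
            rw [Nat.cast_zero, zero_smul, sub_zero]
            have e : yProd (List.replicate d m ++ L') = y m ^ d * yProd L' := by simp [yProd]
            rw [← e]
            refine ihc _ (lt_of_le_of_lt (Finset.card_le_card ?_) hcard) _ _ (by simpa using hlen) rfl
            intro j hj
            have hj' := (Finset.mem_filter.1 hj).2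
            rcases eq_or_ne j m with rfl | hjm
            · exact hsub hm
            · rw [Function.update_of_ne hjm] at hj'
              refine hsub (Finset.mem_filter.2 ⟨Finset.mem_univ _, hj'.imp_left fun h => ?_⟩)
              rcases List.mem_append.1 h with h | h
              · exact absurd (List.eq_of_mem_replicate h) hjm
              · exact h
          · have hns : ¬ (m ∈ L' ∨ w' m ≠ u m) := fun h =>
              hm (Finset.mem_filter.2 ⟨Finset.mem_univ _, h⟩)
            rw [not_or, not_not] at hns
            have hum : u i = u m := hwm.symm.trans hns.2
            refine ⟨1, fun _ => rfl, ?_⟩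
            have := single_sub_single_mem_realized u (Function.update w' m (w i)) w
              (y m ^ d * yProd L') (y i ^ d * yProd L') 1 (by
                intro M _ _ _ _ ρ hρ x hx
                have hword : Function.update w' m (w i) = w ∘ Equiv.swap i m := by
                  funext j
                  rw [Function.comp_apply]
                  rcases eq_or_ne j m with rfl | hjm
                  · rw [Function.update_self, Equiv.swap_apply_right]
                  rw [Function.update_of_ne hjm]
                  rcases eq_or_ne j i with rfl | hji
                  · rw [hw', Function.update_self, Equiv.swap_apply_left, ← hwm, hw',
                      Function.update_of_ne hmi]
                  · rw [hw', Function.update_of_ne hji, Equiv.swap_apply_of_ne_of_ne hji hjm]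
                have hcomm : sigma (Equiv.swap i m) * (y m ^ d * yProd L') =
                    (y i ^ d * yProd L') * sigma (Equiv.swap i m) := by
                  have h1 : ∀ L : List (Fin ℓ), sigma (Equiv.swap i m) * yProd L =
                      yProd (L.map (Equiv.swap i m)) * sigma (Equiv.swap i m) := by
                    intro L
                    induction L with
                    | nil => simp [yProd]
                    | cons a L ih =>
                      unfold yProd at *
                      simp only [List.map_cons, List.prod_cons]
                      rw [← mul_assoc, sigma_mul_y, mul_assoc, ih, mul_assoc]
                  have h2 : L'.map (Equiv.swap i m) = L' := by
                    conv_rhs => rw [← List.map_id L']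
                    refine List.map_congr_left fun j hj => ?_
                    rw [id, Equiv.swap_apply_of_ne_of_ne (by rintro rfl; exact hiL' hj)
                      (by rintro rfl; exact hns.1 hj)]
                  have h3 := h1 (List.replicate d m ++ L')
                  rw [List.map_append, h2, List.map_replicate, Equiv.swap_apply_right] at h3
                  simpa [yProd] using h3
                have e := tens_perm ρ hρ (Equiv.swap i m) w ((y m ^ d * yProd L') • x)
                rw [← mul_smul, hcomm, mul_smul, hx i m hmi.symm hum, smul_neg, tens_neg,
                  Equiv.Perm.sign_swap hmi.symm] at e
                rw [hword, one_smul]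
                push_cast at e
                rw [neg_one_smul, neg_inj] at e
                exact e.symm)
            rw [one_smul] at this
            rwa [Nat.cast_one, one_smul]
        choose e he1 he2 using hterm
        have hsum2 := sub_mem hsum (sum_mem fun m (_ : m ∈ Finset.univ) => he2 m)
        rw [Finset.sum_sub_distrib, sub_sub_cancel, ← Finset.sum_smul, ← Nat.cast_sum] at hsum2
        have hz' : z ∈ realized u := by
          have hne : ((∑ m, e m : ℕ) : ℂ) ≠ 0 := by
            rw [Nat.cast_ne_zero]
            have := Finset.single_le_sum (f := e) (fun _ _ => Nat.zero_le _) (Finset.mem_univ i)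
            rw [he1 i rfl] at this
            omega
          have := Submodule.smul_mem _ (((∑ m, e m : ℕ) : ℂ)⁻¹) hsum2
          rwa [inv_smul_smul₀ hne] at this
        have hdiff := ih w _ (filLt_mono hL (yProd_perm hperm))
        have e3 : yProd (List.replicate d i ++ L') = y i ^ d * yProd L' := by
          simp [yProd]
        have := add_mem hdiff hz'
        rwa [hz, ← Pi.single_add, e3, sub_add_cancel] at this
    refine Submodule.span_induction (p := fun x _ => ∀ w, Pi.single w x ∈ realized u)
      ?_ ?_ ?_ ?_ hk w
    · rintro x ⟨σ, L, hL, rfl⟩ w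
      exact single_sigma_mul_mem_realized u w σ _ (key _ (w ∘ σ) L (by omega) rfl)
    · intro w; rw [Pi.single_zero]; exact zero_mem _
    · intro x z _ _ h1 h2 w; rw [Pi.single_add]; exact add_mem (h1 w) (h2 w)
    · intro c x _ h1 w; rw [Pi.single_smul]; exact Submodule.smul_mem _ _ (h1 w)

end HeckeAlg

namespace HeckeAlg

/-! ### Blocks -/

theorem off_zero {r : ℕ} (L : Fin (r + 1) → ℕ) : off L 0 = 0 := by simp [off]

theorem off_succ {r : ℕ} (L : Fin (r + 1) → ℕ) (k : Fin r) :
    off L k.succ = L 0 + off (L ∘ Fin.succ) k := by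
  unfold off
  rw [Finset.sum_filter, Fin.sum_univ_succ, Finset.sum_filter]
  simp

theorem off_add_le {r : ℕ} (L : Fin r → ℕ) {j k : Fin r} (h : j < k) : off L j + L j ≤ off L k := by
  unfold off
  rw [add_comm, ← Finset.sum_insert (by simp)]
  refine Finset.sum_le_sum_of_subset ?_
  intro i hi
  rw [Finset.mem_insert, Finset.mem_filter_univ] at hi
  rw [Finset.mem_filter_univ]
  rcases hi with rfl | hi
  · exact h
  · exact hi.trans h

theorem off_add_le_sum {r : ℕ} (L : Fin r → ℕ) (k : Fin r) : off L k + L k ≤ ∑ i, L i := by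
  unfold off
  rw [add_comm, ← Finset.sum_insert (by simp)]
  exact Finset.sum_le_sum_of_subset (Finset.subset_univ _)

theorem inBlock_unique {r : ℕ} {L : Fin r → ℕ} {j k : Fin r} {m m' : ℕ} (hj : inBlock L j m)
    (hk : inBlock L k m') (h : m ≤ m') : j ≤ k := by
  by_contra hlt
  have := off_add_le L (not_le.1 hlt)
  have := hj.1
  have := hk.2
  omega

theorem exists_inBlock {r : ℕ} (L : Fin r → ℕ) {m : ℕ} (h : m < ∑ i, L i) :
    ∃ k, inBlock L k m := by
  induction r generalizing m with
  | zero => simp at h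
  | succ r ih =>
    by_cases hm : m < L 0
    · exact ⟨0, by rw [off_zero]; exact Nat.zero_le _, by rw [off_zero]; omega⟩
    · rw [Fin.sum_univ_succ] at h
      obtain ⟨k, hk1, hk2⟩ := ih (L ∘ Fin.succ) (m := m - L 0) (by simp; omega)
      refine ⟨k.succ, ?_, ?_⟩
      · rw [off_succ]; omega
      · rw [off_succ]; simp only [Function.comp_apply] at hk2; omega

/-- The word recording the block of each position. -/
def blockWord {r : ℕ} (L : Fin r → ℕ) (hL : ∑ i, L i = ℓ) (m : Fin ℓ) : Fin r :=
  (exists_inBlock L (m := m) (hL ▸ m.2)).choose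

theorem blockWord_spec {r : ℕ} (L : Fin r → ℕ) (hL : ∑ i, L i = ℓ) (m : Fin ℓ) :
    inBlock L (blockWord L hL m) m := (exists_inBlock L (m := m) (hL ▸ m.2)).choose_spec

theorem blockWord_eq_iff {r : ℕ} (L : Fin r → ℕ) (hL : ∑ i, L i = ℓ) (m : Fin ℓ) (k : Fin r) :
    blockWord L hL m = k ↔ inBlock L k m := by
  constructor
  · rintro rfl; exact blockWord_spec L hL m
  · intro h
    exact le_antisymm (inBlock_unique (blockWord_spec L hL m) h le_rfl)
      (inBlock_unique h (blockWord_spec L hL m) le_rfl)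

theorem blockWord_mono {r : ℕ} (L : Fin r → ℕ) (hL : ∑ i, L i = ℓ) : Monotone (blockWord L hL) :=
  fun m m' h => inBlock_unique (blockWord_spec L hL m) (blockWord_spec L hL m') h

theorem card_blockWord {r : ℕ} (L : Fin r → ℕ) (hL : ∑ i, L i = ℓ) (k : Fin r) :
    (Finset.univ.filter fun m => blockWord L hL m = k).card = L k := by
  have h1 := off_add_le_sum L k
  rw [hL] at h1
  rw [← card_strands h1]
  congr 1
  ext m
  rw [Finset.mem_filter_univ, mem_strands, blockWord_eq_iff]; rfl

theorem card_blockWord_lt {r : ℕ} (L : Fin r → ℕ) (hL : ∑ i, L i = ℓ) (m : Fin ℓ) :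
    (Finset.univ.filter fun j => j < m ∧ blockWord L hL j = blockWord L hL m).card =
      m - off L (blockWord L hL m) := by
  have h1 := blockWord_spec L hL m
  have h2 := m.2
  have e : off L (blockWord L hL m) + (m - off L (blockWord L hL m)) = m := by
    have := h1.1; omega
  have hc := card_strands (ℓ := ℓ) (lo := off L (blockWord L hL m))
    (k := m - off L (blockWord L hL m)) (by omega)
  rw [e] at hc
  rw [← hc]
  congr 1
  ext j
  rw [Finset.mem_filter_univ, mem_strands, blockWord_eq_iff, Fin.lt_def]
  have := h1.2
  unfold inBlock
  omega

/-! ### Standard modules as universal cyclic modules -/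

instance quotModule (I : Submodule (Hecke ℓ) (Hecke ℓ)) : Module (HeckeAlg ℓ) (Hecke ℓ ⧸ I) :=
  inferInstanceAs (Module (Hecke ℓ) (Hecke ℓ ⧸ I))

instance quotTower (I : Submodule (Hecke ℓ) (Hecke ℓ)) :
    IsScalarTower ℂ (HeckeAlg ℓ) (Hecke ℓ ⧸ I) :=
  inferInstanceAs (IsScalarTower ℂ (Hecke ℓ) (Hecke ℓ ⧸ I))

theorem quotRho_apply (I : Submodule (Hecke ℓ) (Hecke ℓ)) (h : Hecke ℓ) (x : Hecke ℓ ⧸ I) :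
    quotRho I h x = ofHecke h • x := rfl

/-- The canonical generator of a cyclic module. -/
def gen (I : Submodule (Hecke ℓ) (Hecke ℓ)) : Hecke ℓ ⧸ I := Submodule.Quotient.mk 1

theorem smul_gen (I : Submodule (Hecke ℓ) (Hecke ℓ)) (h : Hecke ℓ) :
    ofHecke h • gen I = Submodule.Quotient.mk h := by
  change Submodule.Quotient.mk (h * 1) = _
  rw [mul_one]

theorem exists_smul_gen (I : Submodule (Hecke ℓ) (Hecke ℓ)) (x : Hecke ℓ ⧸ I) :
    ∃ h : HeckeAlg ℓ, x = h • gen I := by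
  obtain ⟨h, rfl⟩ := Submodule.Quotient.mk_surjective _ x
  exact ⟨ofHecke h, (smul_gen I h).symm⟩

section IsGenLike

variable {M : Type} [AddCommGroup M] [Module ℂ M] [Module (HeckeAlg ℓ) M]
  [IsScalarTower ℂ (HeckeAlg ℓ) M]

/-- `x` satisfies the defining relations of the generator of `K(λ,ν)`. -/
def BlockType {r : ℕ} (L : Fin r → ℕ) (ν : Fin r → ℂ) (x : M) : Prop :=
  (∀ (m : Fin ℓ) (k : Fin r), inBlock L k m →
      eps m • x = (ν k + (((m : ℕ) - off L k : ℕ) : ℂ)) • x) ∧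
    ∀ (m m' : Fin ℓ) (k : Fin r), (m' : ℕ) = (m : ℕ) + 1 → inBlock L k m → inBlock L k m' →
      sigma (Equiv.swap m m') • x = x

theorem blockType_gen {r : ℕ} (L : Fin r → ℕ) (ν : Fin r → ℂ) :
    BlockType (ℓ := ℓ) L ν (gen (KIdeal ℓ L ν)) := by
  constructor
  · intro m k hk
    rw [← sub_eq_zero]
    have : Hecke.eps m - (ν k + (((m : ℕ) - off L k : ℕ) : ℂ)) • 1 ∈ KIdeal ℓ L ν :=
      Submodule.subset_span (Or.inl ⟨m, k, hk, rfl⟩)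
    rw [← Submodule.Quotient.mk_eq_zero] at this
    rw [← this, Submodule.Quotient.mk_sub]
    unfold eps
    rw [smul_gen]
    rfl
  · intro m m' k hm h1 h2
    rw [← sub_eq_zero]
    have : Hecke.sigma (Equiv.swap m m') - 1 ∈ KIdeal ℓ L ν :=
      Submodule.subset_span (Or.inr ⟨m, m', k, hm, h1, h2, rfl⟩)
    rw [← Submodule.Quotient.mk_eq_zero] at this
    rw [← this, Submodule.Quotient.mk_sub]
    unfold sigma
    rw [smul_gen]
    rfl

theorem BlockType.smul_eq_zero {r : ℕ} {L : Fin r → ℕ} {ν : Fin r → ℂ} {x : M}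
    (hx : BlockType (ℓ := ℓ) L ν x) {h : Hecke ℓ} (hh : h ∈ KIdeal ℓ L ν) : ofHecke h • x = 0 := by
  refine Submodule.span_induction (p := fun h _ => ofHecke h • x = 0) ?_ ?_ ?_ ?_ hh
  · rintro h (⟨m, k, hk, rfl⟩ | ⟨m, m', k, hm, h1, h2, rfl⟩)
    · rw [map_sub, map_smul, map_one, sub_smul, smul_assoc, one_smul, sub_eq_zero]
      exact hx.1 m k hk
    · rw [map_sub, map_one, sub_smul, one_smul, sub_eq_zero]
      exact hx.2 m m' k hm h1 h2
  · rw [map_zero, zero_smul]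
  · intro a b _ _ h1 h2; rw [map_add, add_smul, h1, h2, add_zero]
  · intro a b _ h1; rw [smul_eq_mul, map_mul, mul_smul, h1, smul_zero]

/-- The universal property of `K(λ,ν)`. -/
theorem BlockType.exists_lift {r : ℕ} {L : Fin r → ℕ} {ν : Fin r → ℂ} {x : M}
    (hx : BlockType (ℓ := ℓ) L ν x) :
    ∃ φ : KMod ℓ L ν →ₗ[ℂ] M, (∀ (h : HeckeAlg ℓ) z, φ (h • z) = h • φ z) ∧
      φ (gen (KIdeal ℓ L ν)) = x := by
  have key : ∀ a b : Hecke ℓ, (KIdeal ℓ L ν).quotientRel a b → ofHecke a • x = ofHecke b • x := by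
    intro a b hab
    rw [Submodule.quotientRel_def] at hab
    have := hx.smul_eq_zero hab
    rwa [map_sub, sub_smul, sub_eq_zero] at this
  let f : KMod ℓ L ν → M := Quotient.lift (fun h : Hecke ℓ => ofHecke h • x) key
  have hf : ∀ h : HeckeAlg ℓ, f (h • gen (KIdeal ℓ L ν)) = h • x := fun h => by
    obtain ⟨h, rfl⟩ := ofHecke.surjective h
    rw [smul_gen]; rfl
  refine ⟨⟨⟨f, ?_⟩, ?_⟩, ?_, ?_⟩
  · intro a b
    obtain ⟨a, rfl⟩ := exists_smul_gen _ a
    obtain ⟨b, rfl⟩ := exists_smul_gen _ b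
    rw [← add_smul, hf, hf, hf, add_smul]
  · intro c a
    obtain ⟨a, rfl⟩ := exists_smul_gen _ a
    simp only [RingHom.id_apply]
    rw [← smul_assoc, hf, hf, smul_assoc]
  · intro h z
    obtain ⟨z, rfl⟩ := exists_smul_gen _ z
    change f (h • z • gen (KIdeal ℓ L ν)) = h • f (z • gen (KIdeal ℓ L ν))
    rw [← mul_smul, hf, hf, mul_smul]
  · have := hf 1
    rwa [one_smul, one_smul] at this

end IsGenLike

end HeckeAlg

namespace HeckeAlg

/-! ### A combinatorial model of the standard modules -/

section Model

variable {r : ℕ}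

/-- The structure constants of the action of `ε_m` in the combinatorial model. -/
def modelCoef (k m : Fin ℓ) (v : Word ℓ r) : ℂ :=
  (if k < m then 1 else 0) - (if v m < v k then 1 else 0)

/-- The action of `ε_m` on functions on words. -/
def modelEps (ν : Fin r → ℂ) (m : Fin ℓ) : MW ℓ r ℂ →ₗ[ℂ] MW ℓ r ℂ where
  toFun f := fun v => ν (v m) * f v + ∑ k, modelCoef k m v * f (v ∘ Equiv.swap k m)
  map_add' f g := by
    funext v
    simp only [Pi.add_apply, mul_add, Finset.sum_add_distrib]; ring
  map_smul' c f := by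
    funext v
    simp only [Pi.smul_apply, smul_eq_mul, RingHom.id_apply, mul_add, Finset.mul_sum]
    congr 1
    · ring
    · exact Finset.sum_congr rfl fun _ _ => by ring

theorem modelEps_apply (ν : Fin r → ℂ) (m : Fin ℓ) (f : MW ℓ r ℂ) (v : Word ℓ r) :
    modelEps ν m f v = ν (v m) * f v + ∑ k, modelCoef k m v * f (v ∘ Equiv.swap k m) := rfl

theorem permOp_apply' (σ : Equiv.Perm (Fin ℓ)) (f : MW ℓ r ℂ) (v : Word ℓ r) :
    permOp r σ f v = f (v ∘ σ) := rfl

theorem permOp_mul (σ τ : Equiv.Perm (Fin ℓ)) :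
    (permOp r σ : Module.End ℂ (MW ℓ r ℂ)) * permOp r τ = permOp r (σ * τ) := rfl

theorem permOp_one : (permOp r (1 : Equiv.Perm (Fin ℓ)) : Module.End ℂ (MW ℓ r ℂ)) = 1 := rfl

theorem lt_swap_adjacent (i i' k j : Fin ℓ) (h : (i' : ℕ) = i + 1) :
    ((if k < j then 1 else 0 : ℂ) - (if Equiv.swap i i' k < Equiv.swap i i' j then 1 else 0)) =
      (if k = i ∧ j = i' then 1 else 0) - (if k = i' ∧ j = i then 1 else 0) := by
  have hne : i ≠ i' := by rintro rfl; omega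
  have hlt : i < i' := by rw [Fin.lt_def]; omega
  by_cases hk1 : k = i
  · subst hk1
    rw [Equiv.swap_apply_left]
    by_cases hj1 : j = k
    · subst hj1; simp [hne]
    by_cases hj2 : j = i'
    · subst hj2; simp [hne, hlt, hlt.le]
    · rw [Equiv.swap_apply_of_ne_of_ne hj1 hj2]
      have : k < j ↔ i' < j := by
        rw [Fin.lt_def, Fin.lt_def]; rw [Fin.ext_iff] at hj1 hj2; omega
      simp [this, hj1, hj2]
  by_cases hk2 : k = i'
  · subst hk2
    rw [Equiv.swap_apply_right]
    by_cases hj1 : j = i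
    · subst hj1; simp [hne, hlt, hlt.le]
    by_cases hj2 : j = k
    · subst hj2; simp
    · rw [Equiv.swap_apply_of_ne_of_ne hj1 hj2]
      have : k < j ↔ i < j := by
        rw [Fin.lt_def, Fin.lt_def]; rw [Fin.ext_iff] at hj1 hj2; omega
      simp [this, hj1, hj2]
  · rw [Equiv.swap_apply_of_ne_of_ne hk1 hk2]
    by_cases hj1 : j = i
    · subst hj1
      rw [Equiv.swap_apply_left]
      have : k < j ↔ k < i' := by
        rw [Fin.lt_def, Fin.lt_def]; rw [Fin.ext_iff] at hk1 hk2; omega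
      simp [this, hk1, hk2]
    by_cases hj2 : j = i'
    · subst hj2
      rw [Equiv.swap_apply_right]
      have : k < j ↔ k < i := by
        rw [Fin.lt_def, Fin.lt_def]; rw [Fin.ext_iff] at hk1 hk2; omega
      simp [this, hk1, hk2]
    · rw [Equiv.swap_apply_of_ne_of_ne hj1 hj2]
      simp [hk1, hk2]

theorem permOp_mul_modelEps (ν : Fin r → ℂ) (i i' j : Fin ℓ) (h : (i' : ℕ) = i + 1) :
    (permOp r (Equiv.swap i i') : Module.End ℂ (MW ℓ r ℂ)) * modelEps ν j =
      modelEps ν (Equiv.swap i i' j) * permOp r (Equiv.swap i i') +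
        ((if j = i' then 1 else 0 : ℂ) - (if j = i then 1 else 0)) • 1 := by
  refine LinearMap.ext fun f => funext fun v => ?_
  rw [LinearMap.add_apply, LinearMap.smul_apply, Module.End.one_apply, Module.End.mul_apply,
    Module.End.mul_apply, Pi.add_apply, Pi.smul_apply, smul_eq_mul, permOp_apply', modelEps_apply,
    modelEps_apply, permOp_apply']
  set s := Equiv.swap i i' with hs
  have e : ∑ k, modelCoef k (s j) v * permOp r s f (v ∘ Equiv.swap k (s j)) =
      ∑ k, modelCoef (s k) (s j) v * f ((v ∘ s) ∘ Equiv.swap k j) := by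
    rw [← Equiv.sum_comp s]
    refine Finset.sum_congr rfl fun k _ => ?_
    rw [permOp_apply', Function.comp_assoc, Function.comp_assoc, ← Equiv.Perm.coe_mul,
      ← Equiv.Perm.coe_mul, ← Equiv.mul_swap_eq_swap_mul]
  rw [e]
  have e2 : ∑ k, modelCoef k j (v ∘ s) * f ((v ∘ s) ∘ Equiv.swap k j) =
      ∑ k, modelCoef (s k) (s j) v * f ((v ∘ s) ∘ Equiv.swap k j) +
      ∑ k, ((if k = i ∧ j = i' then 1 else 0 : ℂ) - (if k = i' ∧ j = i then 1 else 0)) *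
        f ((v ∘ s) ∘ Equiv.swap k j) := by
    rw [← Finset.sum_add_distrib]
    refine Finset.sum_congr rfl fun k _ => ?_
    rw [← add_mul, ← lt_swap_adjacent i i' k j h]
    unfold modelCoef
    simp only [Function.comp_apply]
    ring
  rw [e2]
  have e3 : ∑ k, ((if k = i ∧ j = i' then 1 else 0 : ℂ) - (if k = i' ∧ j = i then 1 else 0)) *
        f ((v ∘ s) ∘ Equiv.swap k j) =
      ((if j = i' then 1 else 0 : ℂ) - (if j = i then 1 else 0)) * f v := by
    have hvs : ∀ g : Equiv.Perm (Fin ℓ), g = s → (v ∘ s) ∘ g = v := by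
      rintro g rfl; funext k; simp [hs]
    simp only [sub_mul, Finset.sum_sub_distrib, ite_mul, one_mul, zero_mul]
    congr 1
    · by_cases hj : j = i'
      · subst hj; simp [hvs _ hs.symm]
      · simp [hj]
    · by_cases hj : j = i
      · subst hj; simp [hvs (Equiv.swap i' j) (Equiv.swap_comm ..)]
      · simp [hj]
  rw [e3]
  simp only [Function.comp_apply]
  ring

theorem modelEps_single_sorted (ν : Fin r → ℂ) (v : Word ℓ r) (hv : Monotone v) (m : Fin ℓ) :
    modelEps ν m (Pi.single v 1) =
      (ν (v m) + ((Finset.univ.filter fun j => j < m ∧ v j = v m).card : ℂ)) •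
        (Pi.single v 1 : MW ℓ r ℂ) := by
  funext u
  rw [modelEps_apply, Pi.smul_apply, smul_eq_mul, add_mul]
  have hcomp : ∀ k : Fin ℓ, u ∘ Equiv.swap k m = v ↔ u = v ∘ Equiv.swap k m := by
    intro k
    constructor <;> rintro rfl <;> funext j <;> simp
  have e : ∀ k, modelCoef k m u * (Pi.single v 1 : MW ℓ r ℂ) (u ∘ Equiv.swap k m) =
      (if k < m ∧ v k = v m then 1 else 0) * (Pi.single v 1 : MW ℓ r ℂ) u := by
    intro k
    simp only [Pi.single_apply, hcomp]
    by_cases hk : v k = v m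
    · have e1 : v ∘ Equiv.swap k m = v := by
        funext j
        by_cases h1 : j = k
        · subst h1; simp [hk]
        by_cases h2 : j = m
        · subst h2; simp [hk]
        · simp [Equiv.swap_apply_of_ne_of_ne h1 h2]
      rw [e1]
      by_cases hu : u = v
      · subst hu
        simp [modelCoef, hk]
      · simp only [hu, if_false, mul_zero]
    · have e2 : (if k < m ∧ v k = v m then (1 : ℂ) else 0) = 0 := by simp [hk]
      rw [e2, zero_mul]
      by_cases hu : u = v ∘ Equiv.swap k m
      · subst hu
        rw [if_pos rfl, mul_one]
        unfold modelCoef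
        simp only [Function.comp_apply, Equiv.swap_apply_left, Equiv.swap_apply_right]
        rcases lt_trichotomy k m with h | h | h
        · have := lt_of_le_of_ne (hv h.le) hk
          simp [h, this]
        · exact absurd (by rw [h]) hk
        · have := hv h.le
          simp [not_lt.2 h.le, not_lt.2 this]
      · rw [if_neg hu, mul_zero]
  rw [Finset.sum_congr rfl fun k _ => e k, ← Finset.sum_mul]
  congr 1
  · by_cases hu : u = v
    · subst hu; rfl
    · simp [hu]
  · congr 1
    rw [Finset.sum_boole]

theorem modelEps_comm (ν : Fin r → ℂ) (i j : Fin ℓ) :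
    (modelEps ν i : Module.End ℂ (MW ℓ r ℂ)) * modelEps ν j = modelEps ν j * modelEps ν i := by
  have key : ∀ v : Word ℓ r, Monotone v → ∀ σ : Equiv.Perm (Fin ℓ), ∀ i j : Fin ℓ,
      ((modelEps ν i : Module.End ℂ (MW ℓ r ℂ)) * modelEps ν j - modelEps ν j * modelEps ν i)
        (permOp r σ (Pi.single v 1)) = 0 := by
    intro v hv σ
    refine permIco_induction (P := fun σ => ∀ i j : Fin ℓ,
      ((modelEps ν i : Module.End ℂ (MW ℓ r ℂ)) * modelEps ν j - modelEps ν j * modelEps ν i)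
        (permOp r σ (Pi.single v 1)) = 0) ?_ ?_ σ (mem_permIco_full σ)
    · intro i j
      rw [permOp_one, Module.End.one_apply, LinearMap.sub_apply, Module.End.mul_apply,
        Module.End.mul_apply, modelEps_single_sorted ν v hv i, modelEps_single_sorted ν v hv j,
        map_smul, map_smul, modelEps_single_sorted ν v hv i, modelEps_single_sorted ν v hv j,
        smul_smul, smul_smul, mul_comm, sub_self]
    · intro a b _ hab _ σ ih i j
      have hne : a ≠ b := by rintro rfl; omega
      have c1 := permOp_mul_modelEps ν a b (Equiv.swap a b i) hab
      have c2 := permOp_mul_modelEps ν a b (Equiv.swap a b j) hab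
      rw [Equiv.swap_apply_self] at c1 c2
      set s := Equiv.swap a b
      set P : Module.End ℂ (MW ℓ r ℂ) := permOp r s
      set Ei : Module.End ℂ (MW ℓ r ℂ) := modelEps ν i
      set Ej : Module.End ℂ (MW ℓ r ℂ) := modelEps ν j
      set Fi : Module.End ℂ (MW ℓ r ℂ) := modelEps ν (s i) with hFi
      set Fj : Module.End ℂ (MW ℓ r ℂ) := modelEps ν (s j) with hFj
      set di : ℂ := (if s i = b then 1 else 0 : ℂ) - (if s i = a then 1 else 0) with hdi
      set dj : ℂ := (if s j = b then 1 else 0 : ℂ) - (if s j = a then 1 else 0) with hdj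
      have main : (Ei * Ej - Ej * Ei) * P = P * (Fi * Fj - Fj * Fi) := by
        have h3 : (Ei * Ej - Ej * Ei) * P = P * (Fi * Fj - Fj * Fi)
            - dj • (Ei - Fi) + di • (Ej - Fj) := by
          have a1 : Ei * P = P * Fi - di • 1 := eq_sub_of_add_eq c1.symm
          have a2 : Ej * P = P * Fj - dj • 1 := eq_sub_of_add_eq c2.symm
          rw [sub_mul, mul_assoc, a2, mul_assoc, a1, mul_sub, mul_sub, ← mul_assoc, a1, ← mul_assoc,
            a2]
          simp only [sub_mul, mul_sub, smul_mul_assoc, mul_smul_comm, one_mul, mul_one, smul_sub,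
            mul_assoc]
          abel
        have h4 : dj • (Ei - Fi) = di • (Ej - Fj) := by
          by_cases hij : i = j
          · subst hij; rfl
          by_cases hia : i = a
          · subst hia
            by_cases hjb : j = b
            · subst hjb
              simp [Fi, Fj, di, dj, Ei, Ej, s, hne, hne.symm]
              exact (neg_one_smul ℂ (modelEps ν i - modelEps ν j)).trans (neg_sub _ _)
            · have : s j = j := Equiv.swap_apply_of_ne_of_ne (Ne.symm hij) hjb
              simp [Fj, dj, Ej, this, Ne.symm hij, hjb]
          by_cases hib : i = b
          · subst hib
            by_cases hja : j = a
            · subst hja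
              simp [Fi, Fj, di, dj, Ei, Ej, s, hne, hne.symm]
              exact ((neg_one_smul ℂ (modelEps ν j - modelEps ν i)).trans (neg_sub _ _)).symm
            · have : s j = j := Equiv.swap_apply_of_ne_of_ne hja (Ne.symm hij)
              simp [Fj, dj, Ej, this, hja, Ne.symm hij]
          · have : s i = i := Equiv.swap_apply_of_ne_of_ne hia hib
            simp [Fi, di, Ei, this, hia, hib]
        rw [h3, h4]; abel
      rw [← permOp_mul, Module.End.mul_apply, ← Module.End.mul_apply _ P, main,
        Module.End.mul_apply]
      have := ih (s i) (s j)
      rw [← hFi, ← hFj] at this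
      rw [this, map_zero]
  rw [← sub_eq_zero]
  refine LinearMap.pi_ext' fun u => LinearMap.ext_ring ?_
  rw [LinearMap.comp_apply, LinearMap.zero_comp, LinearMap.zero_apply]
  change (_ : Module.End ℂ (MW ℓ r ℂ)) (Pi.single u 1) = 0
  have := key (u ∘ Tuple.sort u) (Tuple.monotone_sort u) (Tuple.sort u) i j
  rwa [permOp_single, Function.comp_assoc, Equiv.self_comp_symm, Function.comp_id] at this

/-- The combinatorial model of the standard module. -/
def model (ℓ : ℕ) (ν : Fin r → ℂ) : Hecke ℓ →ₐ[ℂ] Module.End ℂ (MW ℓ r ℂ) :=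
  RingQuot.liftAlgHom ℂ ⟨FreeAlgebra.lift ℂ
      (fun g : HGen ℓ => match g with
        | HGen.perm σ => (permOp r σ : Module.End ℂ (MW ℓ r ℂ))
        | HGen.eps m => modelEps ν m), by
    intro a b hab
    cases hab with
    | permMul σ τ => simp only [map_mul, FreeAlgebra.lift_ι_apply, permOp_mul]
    | permOne => simp only [map_one, FreeAlgebra.lift_ι_apply, permOp_one]
    | epsComm i j => simp only [map_mul, FreeAlgebra.lift_ι_apply, modelEps_comm ν i j]
    | cross i j h =>
      simp only [map_mul, map_sub, map_smul, map_one, FreeAlgebra.lift_ι_apply]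
      rw [permOp_mul_modelEps ν i ⟨i + 1, h⟩ j rfl, add_sub_cancel_left, neg_sub]⟩

theorem model_sigma (ν : Fin r → ℂ) (σ : Equiv.Perm (Fin ℓ)) :
    model ℓ ν (Hecke.sigma σ) = permOp r σ := by
  unfold model Hecke.sigma
  rw [RingQuot.liftAlgHom_mkAlgHom_apply, FreeAlgebra.lift_ι_apply]

theorem model_eps (ν : Fin r → ℂ) (m : Fin ℓ) :
    model ℓ ν (Hecke.eps m) = modelEps ν m := by
  unfold model Hecke.eps
  rw [RingQuot.liftAlgHom_mkAlgHom_apply, FreeAlgebra.lift_ι_apply]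

/-- A type copy of the space of functions on words, carrying the model action. -/
def ModelSpace (ℓ r : ℕ) (_ν : Fin r → ℂ) : Type := MW ℓ r ℂ

instance (ν : Fin r → ℂ) : AddCommGroup (ModelSpace ℓ r ν) := inferInstanceAs (AddCommGroup (MW ℓ r ℂ))
instance (ν : Fin r → ℂ) : Module ℂ (ModelSpace ℓ r ν) := inferInstanceAs (Module ℂ (MW ℓ r ℂ))
instance modelModule (ν : Fin r → ℂ) : Module (HeckeAlg ℓ) (ModelSpace ℓ r ν) :=
  Module.compHom (MW ℓ r ℂ) ((model ℓ ν).comp ofHecke.symm.toAlgHom).toRingHom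

theorem modelSpace_smul (ν : Fin r → ℂ) (h : Hecke ℓ) (f : ModelSpace ℓ r ν) :
    ofHecke h • f = model ℓ ν h f := rfl

instance (ν : Fin r → ℂ) : IsScalarTower ℂ (HeckeAlg ℓ) (ModelSpace ℓ r ν) where
  smul_assoc c h f := by
    obtain ⟨h, rfl⟩ := ofHecke.surjective h
    rw [← map_smul, modelSpace_smul, modelSpace_smul, map_smul]; rfl

/-- The basis vector of the model attached to a word. -/
def modelVec (ν : Fin r → ℂ) (v : Word ℓ r) : ModelSpace ℓ r ν := (Pi.single v 1 : MW ℓ r ℂ)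

theorem sigma_smul_modelVec (ν : Fin r → ℂ) (σ : Equiv.Perm (Fin ℓ)) (v : Word ℓ r) :
    sigma σ • modelVec ν v = modelVec ν (v ∘ σ.symm) := by
  have : sigma σ • modelVec ν v = model ℓ ν (Hecke.sigma σ) (Pi.single v 1 : MW ℓ r ℂ) := rfl
  rw [this, model_sigma, permOp_single]; rfl

theorem eps_smul_modelVec (ν : Fin r → ℂ) (v : Word ℓ r) (hv : Monotone v) (m : Fin ℓ) :
    eps m • modelVec ν v =
      (ν (v m) + ((Finset.univ.filter fun j => j < m ∧ v j = v m).card : ℂ)) • modelVec ν v := by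
  have : eps m • modelVec ν v = model ℓ ν (Hecke.eps m) (Pi.single v 1 : MW ℓ r ℂ) := rfl
  rw [this, model_eps, modelEps_single_sorted ν v hv]; rfl

theorem linearIndependent_modelVec (ν : Fin r → ℂ) :
    LinearIndependent ℂ (modelVec (ℓ := ℓ) ν) := by
  have := (Pi.basisFun ℂ (Word ℓ r)).linearIndependent
  have e : modelVec (ℓ := ℓ) ν = Pi.basisFun ℂ (Word ℓ r) := by
    funext v
    rw [Pi.basisFun_apply]; rfl
  rw [e]
  exact this

theorem blockType_model (L : Fin r → ℕ) (hL : ∑ i, L i = ℓ) (ν : Fin r → ℂ) :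
    BlockType (ℓ := ℓ) L ν (modelVec ν (blockWord L hL)) := by
  constructor
  · intro m k hk
    rw [eps_smul_modelVec ν _ (blockWord_mono L hL), card_blockWord_lt,
      (blockWord_eq_iff L hL m k).2 hk]
  · intro m m' k _ h1 h2
    rw [sigma_smul_modelVec]
    congr 1
    funext j
    rw [← blockWord_eq_iff L hL] at h1 h2
    rw [Function.comp_apply, Equiv.symm_swap, Equiv.swap_apply_def]
    split_ifs with h h
    · rw [h, h1, h2]
    · rw [h, h1, h2]
    · rfl

end Model

end HeckeAlg

namespace HeckeAlg

/-! ### A basis of the standard modules -/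

theorem exists_perm_comp_eq {α β : Type*} [Fintype α] [DecidableEq β] (f g : α → β)
    (h : ∀ c, (Finset.univ.filter fun a => f a = c).card = (Finset.univ.filter fun a => g a = c).card) :
    ∃ τ : Equiv.Perm α, f = g ∘ τ := by
  have e : ∀ c, Nonempty ({a // f a = c} ≃ {a // g a = c}) := by
    intro c
    refine Fintype.card_eq.1 ?_
    rw [Fintype.card_subtype, Fintype.card_subtype, h c]
  refine ⟨Equiv.ofFiberEquiv fun c => (e c).some, ?_⟩
  funext a
  exact (Equiv.ofFiberEquiv_map _ a).symm

section BlockType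

variable {M : Type} [AddCommGroup M] [Module ℂ M] [Module (HeckeAlg ℓ) M]
  [IsScalarTower ℂ (HeckeAlg ℓ) M] {r : ℕ} {L : Fin r → ℕ} {ν : Fin r → ℂ}

theorem BlockType.sigma_permIco {x : M} (hx : BlockType (ℓ := ℓ) L ν x) (k : Fin r)
    {σ : Equiv.Perm (Fin ℓ)} (hσ : σ ∈ PermIco ℓ (off L k) (off L k + L k)) : sigma σ • x = x := by
  refine permIco_induction (P := fun σ => sigma σ • x = x) ?_ ?_ σ hσ
  · rw [sigma_one, one_smul]
  · intro m m' h1 h2 h3 σ ih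
    rw [← sigma_mul, mul_smul, ih]
    exact hx.2 m m' k h2 ⟨h1, by omega⟩ ⟨by omega, h3⟩

theorem BlockType.sigma_fix {x : M} (hx : BlockType (ℓ := ℓ) L ν x) (hL : ∑ i, L i = ℓ)
    {σ : Equiv.Perm (Fin ℓ)} (hσ : blockWord L hL ∘ σ = blockWord L hL) : sigma σ • x = x := by
  refine perm_preserving_induction (blockWord L hL) (P := fun σ => sigma σ • x = x) ?_ ?_ σ
    (fun i => congrFun hσ i)
  · rw [sigma_one, one_smul]
  · intro i j _ hf σ ih
    rw [← sigma_mul, mul_smul, ih]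
    refine hx.sigma_permIco (blockWord L hL i) (swap_mem_permIco (blockWord_spec L hL i) ?_)
    rw [hf]
    exact blockWord_spec L hL j

theorem BlockType.span_sigma {x : M} (hx : BlockType (ℓ := ℓ) L ν x) (hL : ∑ i, L i = ℓ)
    (h : HeckeAlg ℓ) : h • x ∈ Submodule.span ℂ (Set.range fun σ : Equiv.Perm (Fin ℓ) => sigma σ • x) := by
  set S := Submodule.span ℂ (Set.range fun σ : Equiv.Perm (Fin ℓ) => sigma σ • x) with hS
  let T : Submodule ℂ (HeckeAlg ℓ) :=
    { carrier := {h | h • x ∈ S}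
      add_mem' := fun {a b} ha hb => by
        rw [Set.mem_ofPred_eq, add_smul]; exact add_mem ha hb
      zero_mem' := by rw [Set.mem_ofPred_eq, zero_smul]; exact zero_mem _
      smul_mem' := fun c a ha => by
        rw [Set.mem_ofPred_eq, smul_assoc]; exact Submodule.smul_mem _ c ha }
  have hmem : ∀ σ : Equiv.Perm (Fin ℓ), sigma σ • x ∈ S := fun σ => Submodule.subset_span ⟨σ, rfl⟩
  have hσS : ∀ σ : Equiv.Perm (Fin ℓ), ∀ z ∈ S, sigma σ • z ∈ S := by
    intro σ z hz
    refine Submodule.span_induction (p := fun z _ => sigma σ • z ∈ S) ?_ ?_ ?_ ?_ hz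
    · rintro _ ⟨τ, rfl⟩
      rw [← mul_smul, sigma_mul]; exact hmem _
    · rw [smul_zero]; exact zero_mem _
    · intro a b _ _ ha hb; rw [smul_add]; exact add_mem ha hb
    · intro c a _ ha; rw [smul_comm (sigma σ) (c : ℂ) a]; exact Submodule.smul_mem _ _ ha
  have hjm : ∀ m : Fin ℓ, ∀ z ∈ S, jm 0 m • z ∈ S := by
    intro m z hz
    unfold jm
    rw [Finset.sum_smul]
    refine sum_mem fun j _ => ?_
    split_ifs
    · exact hσS _ _ hz
    · rw [zero_smul]; exact zero_mem _
  refine mem_of_left_mul T ?_ ?_ ?_ h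
  · change (1 : HeckeAlg ℓ) • x ∈ S
    have := hmem 1
    rwa [sigma_one] at this
  · intro σ h hh
    change (sigma σ * h) • x ∈ S
    rw [mul_smul]; exact hσS _ _ hh
  · intro m h hh
    change (eps m * h) • x ∈ S
    rw [mul_smul]
    change h • x ∈ S at hh
    refine Submodule.span_induction (p := fun z _ => eps m • z ∈ S) ?_ ?_ ?_ ?_ hh
    · rintro _ ⟨σ, rfl⟩
      have e := sigma_mul_y σ (σ.symm m)
      rw [Equiv.apply_symm_apply, y_eq_yRel, y_eq_yRel] at e
      unfold yRel at e
      have e2 : eps m * sigma σ = sigma σ * eps (σ.symm m) - sigma σ * jm 0 (σ.symm m) +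
          jm 0 m * sigma σ := by
        rw [← mul_sub, e, sub_mul, sub_add_cancel]
      change eps m • sigma σ • x ∈ S
      rw [← mul_smul, e2, add_smul, sub_smul, mul_smul, mul_smul, mul_smul,
        hx.1 _ _ (blockWord_spec L hL (σ.symm m)), smul_comm (sigma σ) (_ : ℂ) x]
      refine add_mem (sub_mem (Submodule.smul_mem _ _ (hmem σ)) (hσS _ _ (hjm _ _ ?_))) (hjm _ _ (hmem σ))
      have := hmem 1
      rwa [sigma_one, one_smul] at this
    · rw [smul_zero]; exact zero_mem _
    · intro a b _ _ ha hb; rw [smul_add]; exact add_mem ha hb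
    · intro c a _ ha; rw [smul_comm (eps m) (c : ℂ) a]; exact Submodule.smul_mem _ _ ha

end BlockType

section Basis

variable {r : ℕ}

/-- The words with `L k` letters `k`. -/
abbrev ContentWord (ℓ : ℕ) (L : Fin r → ℕ) : Type :=
  {v : Word ℓ r // ∀ k, (Finset.univ.filter fun m => v m = k).card = L k}

theorem card_comp_perm {α β : Type*} [Fintype α] [DecidableEq β] (v : α → β) (τ : Equiv.Perm α) (k : β) :
    (Finset.univ.filter fun m => (v ∘ τ) m = k).card = (Finset.univ.filter fun m => v m = k).card := by
  refine Finset.card_bij (fun a _ => τ a) ?_ ?_ ?_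
  · intro a ha; rw [Finset.mem_filter_univ] at ha ⊢; exact ha
  · intro a _ b _ h; exact τ.injective h
  · intro b hb
    refine ⟨τ.symm b, ?_, by simp⟩
    rw [Finset.mem_filter_univ] at hb ⊢; simpa using hb

theorem exists_perm_contentWord (L : Fin r → ℕ) (hL : ∑ i, L i = ℓ) (v : ContentWord ℓ L) :
    ∃ τ : Equiv.Perm (Fin ℓ), v.1 = blockWord L hL ∘ τ.symm := by
  obtain ⟨τ, hτ⟩ := exists_perm_comp_eq v.1 (blockWord L hL)
    (fun k => by rw [v.2 k, card_blockWord])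
  exact ⟨τ.symm, hτ⟩

/-- A vector of the basis of the standard module. -/
def basisVec (L : Fin r → ℕ) (hL : ∑ i, L i = ℓ) (ν : Fin r → ℂ) (v : ContentWord ℓ L) :
    KMod ℓ L ν :=
  sigma (exists_perm_contentWord L hL v).choose • gen (KIdeal ℓ L ν)

theorem span_basisVec (L : Fin r → ℕ) (hL : ∑ i, L i = ℓ) (ν : Fin r → ℂ) :
    Submodule.span ℂ (Set.range (basisVec L hL ν)) = ⊤ := by
  rw [eq_top_iff]
  rintro x -
  obtain ⟨h, rfl⟩ := exists_smul_gen _ x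
  have hx := blockType_gen (ℓ := ℓ) L ν
  refine Submodule.span_le.2 ?_ (hx.span_sigma hL h)
  rintro _ ⟨σ, rfl⟩
  let v : ContentWord ℓ L := ⟨blockWord L hL ∘ σ.symm, fun k => by
    rw [card_comp_perm, card_blockWord]⟩
  refine Submodule.subset_span ⟨v, ?_⟩
  unfold basisVec
  have h1 := (exists_perm_contentWord L hL v).choose_spec
  set τ := (exists_perm_contentWord L hL v).choose
  have e : sigma τ = sigma σ * sigma (σ⁻¹ * τ) := by rw [sigma_mul]; simp
  rw [e, mul_smul, hx.sigma_fix hL]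
  change blockWord L hL ∘ σ.symm = blockWord L hL ∘ τ.symm at h1
  funext k
  have := congrFun h1 (τ k)
  simpa using this

theorem linearIndependent_basisVec (L : Fin r → ℕ) (hL : ∑ i, L i = ℓ) (ν : Fin r → ℂ) :
    LinearIndependent ℂ (basisVec L hL ν) := by
  obtain ⟨φ, h1, h2⟩ := (blockType_model L hL ν).exists_lift
  refine LinearIndependent.of_comp φ ?_
  have e : φ ∘ basisVec L hL ν = modelVec ν ∘ (Subtype.val : ContentWord ℓ L → Word ℓ r) := by
    funext v
    unfold basisVec
    rw [Function.comp_apply, h1, h2, sigma_smul_modelVec,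
      ← (exists_perm_contentWord L hL v).choose_spec, Function.comp_apply]
  rw [e]
  exact (linearIndependent_modelVec ν).comp _ Subtype.val_injective

/-- A basis of the standard module. -/
def kBasis (L : Fin r → ℕ) (hL : ∑ i, L i = ℓ) (ν : Fin r → ℂ) :
    Module.Basis (ContentWord ℓ L) ℂ (KMod ℓ L ν) :=
  Module.Basis.mk (linearIndependent_basisVec L hL ν) (span_basisVec L hL ν).ge

theorem finite_KMod (L : Fin r → ℕ) (hL : ∑ i, L i = ℓ) (ν : Fin r → ℂ) :
    Module.Finite ℂ (KMod ℓ L ν) := Module.Finite.of_basis (kBasis L hL ν)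

theorem finrank_KMod (L : Fin r → ℕ) (hL : ∑ i, L i = ℓ) (ν : Fin r → ℂ) :
    Module.finrank ℂ (KMod ℓ L ν) = Fintype.card (ContentWord ℓ L) :=
  Module.finrank_eq_card_basis (kBasis L hL ν)

theorem gen_ne_zero (L : Fin r → ℕ) (hL : ∑ i, L i = ℓ) (ν : Fin r → ℂ) :
    gen (KIdeal ℓ L ν) ≠ 0 := by
  intro h
  obtain ⟨φ, h1, h2⟩ := (blockType_model L hL ν).exists_lift
  rw [h, map_zero] at h2
  exact (linearIndependent_modelVec ν).ne_zero _ h2.symm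

theorem card_contentWord_comp {r' : ℕ} (L : Fin r → ℕ) (e : Fin r' ≃ Fin r) :
    Fintype.card (ContentWord ℓ (L ∘ e)) = Fintype.card (ContentWord ℓ L) := by
  refine Fintype.card_congr ⟨fun v => ⟨e ∘ v.1, fun k => ?_⟩, fun v => ⟨e.symm ∘ v.1, fun k => ?_⟩,
    fun v => Subtype.ext ?_, fun v => Subtype.ext ?_⟩
  · have := v.2 (e.symm k)
    simpa [Equiv.eq_symm_apply] using this
  · have := v.2 (e k)
    simpa [Equiv.symm_apply_eq] using this
  · funext m; simp
  · funext m; simp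

end Basis

end HeckeAlg

namespace HeckeAlg

/-! ### Segment lists of families of segments -/

/-- The list of segments of a family. -/
def segs {r : ℕ} (L : Fin r → ℕ) (ν : Fin r → ℂ) : List (ℂ × ℕ) := List.ofFn fun k => (ν k, L k)

theorem segs_succ {r : ℕ} (L : Fin (r + 1) → ℕ) (ν : Fin (r + 1) → ℂ) :
    segs L ν = (ν 0, L 0) :: segs (L ∘ Fin.succ) (ν ∘ Fin.succ) := List.ofFn_succ

theorem total_segs {r : ℕ} (L : Fin r → ℕ) (ν : Fin r → ℂ) : total (segs L ν) = ∑ k, L k := by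
  unfold total segs
  rw [List.map_ofFn, List.sum_ofFn]
  rfl

theorem segs_get (l : List (ℂ × ℕ)) :
    segs (fun i : Fin l.length => (l.get i).2) (fun i => (l.get i).1) = l := List.ofFn_get l

section

variable {M : Type} [AddCommGroup M] [Module ℂ M] [Module (HeckeAlg ℓ) M]
  [IsScalarTower ℂ (HeckeAlg ℓ) M] {r : ℕ} {L : Fin r → ℕ} {ν : Fin r → ℂ}

theorem hasType_segs (p : ℕ) (x : M) : HasType (ℓ := ℓ) p (segs L ν) x ↔ ∀ k,
    (∀ m : Fin ℓ, p + off L k ≤ (m : ℕ) → (m : ℕ) < p + off L k + L k →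
      eps m • x = (ν k + ((m : ℕ) - (p + off L k : ℕ))) • x) ∧
    (∀ σ ∈ PermIco ℓ (p + off L k) (p + off L k + L k), sigma σ • x = x) := by
  induction r generalizing p with
  | zero => simp [segs, HasType]
  | succ r ih =>
    rw [segs_succ, Fin.forall_fin_succ]
    simp only [HasType, ih, off_succ, off_zero, add_zero, Function.comp_apply, and_assoc,
      ← add_assoc]

theorem blockType_iff_hasType (x : M) :
    BlockType (ℓ := ℓ) L ν x ↔ HasType (ℓ := ℓ) 0 (segs L ν) x := by
  rw [hasType_segs]
  simp only [zero_add]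
  constructor
  · intro hx k
    refine ⟨fun m h1 h2 => ?_, fun σ hσ => hx.sigma_permIco k hσ⟩
    rw [hx.1 m k ⟨h1, h2⟩, Nat.cast_sub h1]
  · intro h
    refine ⟨fun m k hk => ?_, fun m m' k _ hm hm' => (h k).2 _ (swap_mem_permIco hm hm')⟩
    rw [(h k).1 m hk.1 hk.2, Nat.cast_sub hk.1]

end

theorem count_ofFn {α : Type*} [DecidableEq α] {r : ℕ} (f : Fin r → α) (a : α) :
    (List.ofFn f).count a = (Finset.univ.filter fun i => f i = a).card := by
  induction r with
  | zero => simp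
  | succ r ih =>
    rw [List.ofFn_succ, List.count_cons, ih, Finset.card_filter, Finset.card_filter,
      Fin.sum_univ_succ, add_comm]
    simp

theorem exists_equiv_of_perm_ofFn {α : Type*} {r r' : ℕ} {f : Fin r → α} {g : Fin r' → α}
    (h : (List.ofFn f).Perm (List.ofFn g)) : ∃ e : Fin r ≃ Fin r', f = g ∘ e := by
  classical
  have e : ∀ c, Nonempty ({a // f a = c} ≃ {a // g a = c}) := by
    intro c
    refine Fintype.card_eq.1 ?_
    rw [Fintype.card_subtype, Fintype.card_subtype]
    have := h.count_eq c
    rw [count_ofFn, count_ofFn] at this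
    convert this
  refine ⟨Equiv.ofFiberEquiv fun c => (e c).some, ?_⟩
  funext a
  exact (Equiv.ofFiberEquiv_map _ a).symm

/-- Two standard modules are isomorphic. -/
def StdIso (ℓ : ℕ) {r r' : ℕ} (L : Fin r → ℕ) (ν : Fin r → ℂ) (L' : Fin r' → ℕ)
    (ν' : Fin r' → ℂ) : Prop :=
  ∃ e : KMod ℓ L ν ≃ₗ[ℂ] KMod ℓ L' ν', ∀ (h : HeckeAlg ℓ) x, e (h • x) = h • e x

theorem StdIso.symm {r r' : ℕ} {L : Fin r → ℕ} {ν : Fin r → ℂ} {L' : Fin r' → ℕ}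
    {ν' : Fin r' → ℂ} (h : StdIso ℓ L ν L' ν') : StdIso ℓ L' ν' L ν := by
  obtain ⟨e, he⟩ := h
  exact ⟨e.symm, fun h x => by rw [LinearEquiv.symm_apply_eq, he, LinearEquiv.apply_symm_apply]⟩

theorem StdIso.trans {r r' r'' : ℕ} {L : Fin r → ℕ} {ν : Fin r → ℂ} {L' : Fin r' → ℕ}
    {ν' : Fin r' → ℂ} {L'' : Fin r'' → ℕ} {ν'' : Fin r'' → ℂ} (h : StdIso ℓ L ν L' ν')
    (h' : StdIso ℓ L' ν' L'' ν'') : StdIso ℓ L ν L'' ν'' := by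
  obtain ⟨e, he⟩ := h
  obtain ⟨e', he'⟩ := h'
  exact ⟨e.trans e', fun h x => by simp only [LinearEquiv.trans_apply, he, he']⟩

/-- If vectors of one type can be moved to vectors of another one, the standard modules agree. -/
theorem stdIso_of_reach {r r' : ℕ} {L : Fin r → ℕ} {ν : Fin r → ℂ} {L' : Fin r' → ℕ}
    {ν' : Fin r' → ℂ} (hL : ∑ i, L i = ℓ) (hp : (segs L ν).Perm (segs L' ν'))
    (hR : Reach ℓ (segs L ν) (segs L' ν')) : StdIso ℓ L ν L' ν' := by
  have hL' : ∑ i, L' i = ℓ := by rw [← total_segs L' ν', hR.1, total_segs, hL]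
  obtain ⟨b, -, hb⟩ := hR.2 0 (by rw [total_segs, hL, zero_add])
  have hx := (blockType_iff_hasType _).1 (blockType_gen (ℓ := ℓ) L ν)
  obtain ⟨-, hbt⟩ := hb _ _ (gen_ne_zero L hL ν) hx
  obtain ⟨φ, hφ, hφg⟩ := ((blockType_iff_hasType _).2 hbt).exists_lift
  let R : Submodule (HeckeAlg ℓ) (KMod ℓ L ν) :=
    { carrier := Set.range φ
      add_mem' := by rintro _ _ ⟨u, rfl⟩ ⟨v, rfl⟩; exact ⟨u + v, map_add φ u v⟩
      zero_mem' := ⟨0, map_zero φ⟩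
      smul_mem' := by rintro h _ ⟨u, rfl⟩; exact ⟨h • u, hφ h u⟩ }
  have hgen : gen (KIdeal ℓ L ν) ∈ R := by
    by_contra hg
    have hq : HasType (ℓ := ℓ) 0 (segs L ν) (R.mkQ (gen (KIdeal ℓ L ν))) := by
      rw [← blockType_iff_hasType]
      have h := blockType_gen (ℓ := ℓ) L ν
      constructor
      · intro m k hk
        rw [← map_smul, h.1 m k hk]; rfl
      · intro m m' k e h1 h2
        rw [← map_smul, h.2 m m' k e h1 h2]
    refine (hb _ (R.mkQ (gen (KIdeal ℓ L ν))) (fun h0 => hg ?_) hq).1 ?_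
    · rwa [Submodule.mkQ_apply, Submodule.Quotient.mk_eq_zero] at h0
    · rw [← map_smul, Submodule.mkQ_apply, Submodule.Quotient.mk_eq_zero]
      exact ⟨_, hφg⟩
  have hsurj : Function.Surjective φ := by
    intro z
    obtain ⟨h, rfl⟩ := exists_smul_gen _ z
    exact R.smul_mem h hgen
  have := finite_KMod L hL ν
  have := finite_KMod L' hL' ν'
  obtain ⟨e, he⟩ := exists_equiv_of_perm_ofFn hp
  have hrk : Module.finrank ℂ (KMod ℓ L' ν') = Module.finrank ℂ (KMod ℓ L ν) := by
    rw [finrank_KMod L hL, finrank_KMod L' hL', show L = L' ∘ e from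
      funext fun k => congrArg Prod.snd (congrFun he k), card_contentWord_comp]
  have hinj := (LinearMap.injective_iff_surjective_of_finrank_eq_finrank hrk).2 hsurj
  refine StdIso.symm ⟨LinearEquiv.ofBijective φ ⟨hinj, hsurj⟩, fun h x => hφ h x⟩

/-- Two standard modules, given by lists of segments, are isomorphic. -/
def ListIso (ℓ : ℕ) (l l' : List (ℂ × ℕ)) : Prop :=
  StdIso ℓ (fun i : Fin l.length => (l.get i).2) (fun i => (l.get i).1)
    (fun i : Fin l'.length => (l'.get i).2) (fun i => (l'.get i).1)

theorem listIso_of_reach {l l' : List (ℂ × ℕ)} (hl : total l = ℓ) (hp : l.Perm l')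
    (hR : Reach ℓ l l') : ListIso ℓ l l' := by
  refine stdIso_of_reach ?_ ?_ ?_
  · rw [← total_segs _ fun i => (l.get i).1, segs_get, hl]
  · rwa [segs_get, segs_get]
  · rwa [segs_get, segs_get]

theorem Reach.or_of_dom {s t : ℂ × ℕ} (h1 : DomC (s.1 + s.2) (t.1 + t.2))
    (h2 : DomC (t.1 + t.2) (s.1 + s.2)) : Reach ℓ [s, t] [t, s] ∨ Reach ℓ [t, s] [s, t] := by
  obtain ⟨a, q⟩ := s
  obtain ⟨b, k⟩ := t
  by_cases h : a + q = b + k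
  · rcases le_total q k with hqk | hqk
    · exact Or.inl (Reach.same_end_swap a b q k hqk h)
    · exact Or.inr (Reach.same_end_swap b a k q hqk h.symm)
  · left
    have hinteger : ∀ n : ℤ, (a + q) - (b + k) ≠ n := by
      intro n hn
      rcases lt_trichotomy n 0 with h0 | rfl | h0
      · obtain ⟨m, rfl⟩ : ∃ m : ℕ, n = -((m : ℤ) + 1) := ⟨(-n - 1).toNat, by omega⟩
        exact h1 m (by simpa using hn)
      · rw [Int.cast_zero, sub_eq_zero] at hn
        exact h hn
      · obtain ⟨m, rfl⟩ : ∃ m : ℕ, n = (m : ℤ) + 1 := ⟨(n - 1).toNat, by omega⟩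
        refine h2 m ?_
        push_cast at hn
        linear_combination -hn
    refine Reach.generic_swap a b q k fun i _ j _ h0 => ?_
    rw [pow_two, mul_self_eq_one_iff] at h0
    rcases h0 with h0 | h0
    · refine hinteger (1 + q - k - i + j) ?_
      push_cast; linear_combination h0
    · refine hinteger (-1 + q - k - i + j) ?_
      push_cast; linear_combination h0

theorem listIso_swap (A B : List (ℂ × ℕ)) {s t : ℂ × ℕ} (h1 : DomC (s.1 + s.2) (t.1 + t.2))
    (h2 : DomC (t.1 + t.2) (s.1 + s.2)) (hl : total (A ++ s :: t :: B) = ℓ) :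
    ListIso ℓ (A ++ s :: t :: B) (A ++ t :: s :: B) := by
  have hp : (A ++ s :: t :: B).Perm (A ++ t :: s :: B) :=
    List.Perm.append_left A (List.Perm.swap t s B)
  rcases Reach.or_of_dom (ℓ := ℓ) h1 h2 with h | h
  · exact listIso_of_reach hl hp (by simpa using h.append A B)
  · refine StdIso.symm (listIso_of_reach ?_ hp.symm (by simpa using h.append A B))
    rw [← hl]
    simp only [total_append, total_cons]
    omega

theorem listIso_move (A C B : List (ℂ × ℕ)) {s : ℂ × ℕ}
    (h : ∀ t ∈ C, DomC (s.1 + s.2) (t.1 + t.2) ∧ DomC (t.1 + t.2) (s.1 + s.2))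
    (hl : total (A ++ s :: (C ++ B)) = ℓ) :
    ListIso ℓ (A ++ s :: (C ++ B)) (A ++ (C ++ s :: B)) := by
  induction C generalizing A with
  | nil => exact listIso_of_reach hl (List.Perm.refl _) (Reach.refl _)
  | cons t C ih =>
    have e1 := listIso_swap A (C ++ B) (h t List.mem_cons_self).1 (h t List.mem_cons_self).2 hl
    have e2 := ih (A ++ [t]) (fun t ht => h t (List.mem_cons_of_mem _ ht)) (by
      rw [← hl]; simp only [total_append, total_cons, total_nil]; omega)
    simp only [List.append_assoc, List.singleton_append] at e2
    exact e1.trans e2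

theorem total_perm {l l' : List (ℂ × ℕ)} (h : l.Perm l') : total l = total l' :=
  (h.map Prod.snd).sum_eq

theorem listIso_of_perm {l l' : List (ℂ × ℕ)} (hp : l.Perm l') (hd : DomList l) (hd' : DomList l')
    (A : List (ℂ × ℕ)) (hl : total (A ++ l) = ℓ) : ListIso ℓ (A ++ l) (A ++ l') := by
  induction l generalizing l' A with
  | nil =>
    obtain rfl := hp.nil_eq
    exact listIso_of_reach hl (List.Perm.refl _) (Reach.refl _)
  | cons s t ih =>
    obtain ⟨C, B, rfl⟩ := List.append_of_mem (hp.mem_iff.1 List.mem_cons_self)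
    have hp' : t.Perm (C ++ B) := (hp.trans List.perm_middle).cons_inv
    unfold DomList at hd hd'
    rw [List.pairwise_cons] at hd
    have hCB : DomList (C ++ B) := hd'.sublist
      ((List.Sublist.refl C).append (List.sublist_cons_self s B))
    rw [List.pairwise_append] at hd'
    have e1 := ih hp' hd.2 hCB (A ++ [s]) (by simpa using hl)
    simp only [List.append_assoc, List.singleton_append] at e1
    refine e1.trans (listIso_move A C B ?_ ?_)
    · intro c hc
      exact ⟨hd.1 c (hp'.mem_iff.2 (List.mem_append_left _ hc)),
        hd'.2.2 c hc s List.mem_cons_self⟩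
    · rw [← hl]
      exact total_perm (List.Perm.append_left A (hp'.symm.cons s))

/-- A standard module only depends on the multiset of its segments, as long as these are ordered
dominantly. -/
theorem stdIso_of_perm {r r' : ℕ} {L : Fin r → ℕ} {ν : Fin r → ℂ} {L' : Fin r' → ℕ}
    {ν' : Fin r' → ℂ} (hL : ∑ i, L i = ℓ) (hp : (segs L ν).Perm (segs L' ν'))
    (hd : DomList (segs L ν)) (hd' : DomList (segs L' ν')) : StdIso ℓ L ν L' ν' := by
  have hl : total (segs L ν) = ℓ := by rw [total_segs, hL]
  have h := listIso_of_perm hp hd hd' [] hl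
  have h1 : StdIso ℓ L ν (fun i : Fin (segs L ν).length => ((segs L ν).get i).2)
      (fun i => ((segs L ν).get i).1) := by
    refine stdIso_of_reach hL ?_ ?_ <;> rw [segs_get]
    exact Reach.refl _
  have h2 : StdIso ℓ L' ν' (fun i : Fin (segs L' ν').length => ((segs L' ν').get i).2)
      (fun i => ((segs L' ν').get i).1) := by
    refine stdIso_of_reach (by rw [← total_segs L' ν', ← total_perm hp, hl]) ?_ ?_ <;> rw [segs_get]
    exact Reach.refl _
  exact (h1.trans h).trans h2.symm

end HeckeAlg

namespace HeckeAlg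

/-! ### Weights -/

/-- The number of letters `a` of a word. -/
def content {n : ℕ} (w : Word ℓ n) (a : Fin n) : ℕ := (Finset.univ.filter fun m => w m = a).card

/-- `v` is a weight vector, with the weight of the tensors `x ⊗ e_w`. -/
def IsWeight {n : ℕ} {V : Type} [AddCommGroup V] [Module ℂ V]
    (π : Yangian n →ₐ[ℂ] Module.End ℂ V) (w : Word ℓ n) (v : V) : Prop :=
  ∀ a, π (Yangian.t a a 0) v = (content w a : ℂ) • v

theorem isWeight_tens {n : ℕ} {M : Type} [AddCommGroup M] [Module ℂ M]
    (ρ : Hecke ℓ →ₐ[ℂ] Module.End ℂ M) {π : Yangian n →ₐ[ℂ] Module.End ℂ (Dmod n ρ)}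
    (hπ : IsDrinfeldAction n ρ π) (w : Word ℓ n) (x : M) : IsWeight π w (tens n ρ w x) := by
  intro a
  unfold tens
  rw [hπ, sumOp_single, ← Submodule.Quotient.mk_smul]
  congr 1
  have : ∀ m : Fin ℓ, (if w m = a then
      (Pi.single (Function.update w m a) (ρ (Hecke.y m ^ 0) x) : MW ℓ n M) else 0) =
      if w m = a then Pi.single w x else 0 := by
    intro m
    split_ifs with h
    · rw [← h, Function.update_eq_self, pow_zero, map_one, Module.End.one_apply]
    · rfl
  rw [Finset.sum_congr rfl fun m _ => this m, ← Finset.sum_filter, Finset.sum_const, content,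
    Nat.cast_smul_eq_nsmul]

theorem aeval_apply_of_eigen {V : Type*} [AddCommGroup V] [Module ℂ V] {T : Module.End ℂ V} {c : ℂ}
    {v : V} (h : T v = c • v) (p : Polynomial ℂ) : Polynomial.aeval T p v = p.eval c • v := by
  by_cases hv : v = 0
  · rw [hv, map_zero, smul_zero]
  · exact Module.End.aeval_apply_of_hasEigenvector
      ⟨Module.End.mem_eigenspace_iff.2 h, hv⟩

/-- An eigenvector which is a sum of eigenvectors is the sum of those with the same eigenvalue. -/
theorem eq_sum_filter_of_eigen {ι V : Type*} [AddCommGroup V] [Module ℂ V] {T : Module.End ℂ V}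
    (S : Finset ι) (κ : ι → ℕ) (f : ι → V) (hf : ∀ i, T (f i) = (κ i : ℂ) • f i) {c : ℕ} {v : V}
    (hv : T v = (c : ℂ) • v) (h : v = ∑ i ∈ S, f i) : v = ∑ i ∈ S.filter (fun i => κ i = c), f i := by
  classical
  let p : Polynomial ℂ := ∏ k ∈ (S.image κ).erase c, (Polynomial.X - Polynomial.C (k : ℂ))
  have hpc : p.eval (c : ℂ) ≠ 0 := by
    rw [Polynomial.eval_prod, Finset.prod_ne_zero_iff]
    intro k hk
    rw [Polynomial.eval_sub, Polynomial.eval_X, Polynomial.eval_C, sub_ne_zero]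
    exact fun e => Finset.ne_of_mem_erase hk (Nat.cast_injective e).symm
  have h1 := aeval_apply_of_eigen hv p
  have h2 : Polynomial.aeval T p v =
      p.eval (c : ℂ) • ∑ i ∈ S.filter (fun i => κ i = c), f i := by
    rw [h, map_sum, Finset.smul_sum, Finset.sum_filter]
    refine Finset.sum_congr rfl fun i hi => ?_
    rw [aeval_apply_of_eigen (hf i)]
    split_ifs with e
    · rw [e]
    · have : p.eval (κ i : ℂ) = 0 := by
        rw [Polynomial.eval_prod]
        refine Finset.prod_eq_zero (Finset.mem_erase.2 ⟨e, Finset.mem_image_of_mem κ hi⟩) ?_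
        simp
      rw [this, zero_smul]
  rw [h1] at h2
  exact smul_right_injective V hpc h2

theorem IsWeight.eq_sum_filter {n : ℕ} {V : Type} [AddCommGroup V] [Module ℂ V]
    {π : Yangian n →ₐ[ℂ] Module.End ℂ V} (f : Word ℓ n → V) (hf : ∀ w, IsWeight π w (f w))
    {u : Word ℓ n} {v : V} (hv : IsWeight π u v) (h : v = ∑ w, f w) :
    v = ∑ w ∈ Finset.univ.filter (fun w => content w = content u), f w := by
  have key : ∀ F : Finset (Fin n), v = ∑ w ∈ Finset.univ.filter
      (fun w => ∀ a ∈ F, content w a = content u a), f w := by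
    intro F
    induction F using Finset.induction_on with
    | empty => simpa using h
    | insert a F _ ih =>
      have := eq_sum_filter_of_eigen _ (fun w => content w a) f (fun w => hf w a) (hv a) ih
      rw [Finset.filter_filter] at this
      rw [this]
      refine Finset.sum_congr ?_ fun _ _ => rfl
      ext w
      simp [and_comm]
  rw [key Finset.univ]
  refine Finset.sum_congr ?_ fun _ _ => rfl
  ext w
  simp [funext_iff]

section StandardWeights

variable {n r : ℕ} {L : Fin r → ℕ} {ν : Fin r → ℂ}

/-- The tensors of the generator of a standard module. -/
abbrev genTens (n : ℕ) (L : Fin r → ℕ) (ν : Fin r → ℂ) (w : Word ℓ n) :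
    Dmod n (quotRho (KIdeal ℓ L ν)) :=
  tens n (quotRho (KIdeal ℓ L ν)) w (gen (KIdeal ℓ L ν))

theorem span_genTens (hL : ∑ i, L i = ℓ) :
    Submodule.span ℂ (Set.range (genTens (ℓ := ℓ) n L ν)) = ⊤ := by
  rw [eq_top_iff]
  rintro v -
  obtain ⟨f, rfl⟩ := Submodule.Quotient.mk_surjective _ v
  rw [mk_eq_sum_tens]
  refine sum_mem fun w _ => ?_
  obtain ⟨h, hh⟩ := exists_smul_gen _ (f w)
  rw [hh]
  have := (blockType_gen (ℓ := ℓ) L ν).span_sigma hL h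
  refine Submodule.span_induction (p := fun z _ => tens n (quotRho (KIdeal ℓ L ν)) w z ∈
    Submodule.span ℂ (Set.range (genTens (ℓ := ℓ) n L ν))) ?_ ?_ ?_ ?_ this
  · rintro _ ⟨σ, rfl⟩
    simp only
    rw [tens_perm _ (quotRho_apply _)]
    exact Submodule.smul_mem _ _ (Submodule.subset_span ⟨_, rfl⟩)
  · rw [tens_zero]; exact zero_mem _
  · intro a b _ _ ha hb; rw [tens_add]; exact add_mem ha hb
  · intro c a _ ha; rw [tens_smul]; exact Submodule.smul_mem _ _ ha

theorem genTens_comp (hL : ∑ i, L i = ℓ) (w : Word ℓ n) {σ : Equiv.Perm (Fin ℓ)}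
    (hσ : blockWord L hL ∘ σ = blockWord L hL) :
    genTens n L ν w = ((Equiv.Perm.sign σ : ℤ) : ℂ) • genTens n L ν (w ∘ σ) := by
  rw [genTens, genTens, ← tens_perm _ (quotRho_apply _), (blockType_gen L ν).sigma_fix hL hσ]

theorem genTens_eq_zero (hL : ∑ i, L i = ℓ) (w : Word ℓ n) {i j : Fin ℓ} (hij : i ≠ j)
    (hw : w i = w j) (hb : blockWord L hL i = blockWord L hL j) : genTens n L ν w = 0 := by
  have hcomp : ∀ {α : Type} (f : Fin ℓ → α), f i = f j → f ∘ Equiv.swap i j = f := by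
    intro α f hf
    funext m
    rw [Function.comp_apply, Equiv.swap_apply_def]
    split_ifs with h1 h2
    · rw [h1, hf]
    · rw [h2, hf]
    · rfl
  have := genTens_comp (ν := ν) hL w (hcomp _ hb)
  rw [hcomp w hw, Equiv.Perm.sign_swap hij] at this
  push_cast at this
  rw [neg_one_smul, eq_neg_iff_add_eq_zero, ← two_smul ℂ] at this
  exact (smul_eq_zero.1 this).resolve_left two_ne_zero

/-- The number of letters `≥ a` of the `k`-th block of a word. -/
def blockCount (hL : ∑ i, L i = ℓ) (w : Word ℓ n) (k : Fin r) (a : ℕ) : ℕ :=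
  (Finset.univ.filter fun m => blockWord L hL m = k ∧ a ≤ (w m : ℕ)).card

theorem sum_blockCount (hL : ∑ i, L i = ℓ) (w : Word ℓ n) (a : ℕ) :
    ∑ k, blockCount hL w k a = (Finset.univ.filter fun m => a ≤ (w m : ℕ)).card := by
  rw [Finset.card_eq_sum_card_fiberwise (f := blockWord L hL) (t := Finset.univ) (by simp)]
  refine Finset.sum_congr rfl fun k _ => ?_
  rw [Finset.filter_filter, blockCount]
  congr 1
  ext m
  simp [and_comm]

theorem le_blockCount (hL : ∑ i, L i = ℓ) {w : Word ℓ n} (hw : genTens n L ν w ≠ 0) (k : Fin r)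
    (a : ℕ) : L k - a ≤ blockCount hL w k a := by
  have h1 : (Finset.univ.filter fun m => blockWord L hL m = k ∧ (w m : ℕ) < a).card ≤ a := by
    conv_rhs => rw [← Finset.card_range a]
    refine Finset.card_le_card_of_injOn (fun m => (w m : ℕ)) ?_ ?_
    · intro m hm
      have : blockWord L hL m = k ∧ (w m : ℕ) < a := by simpa using hm
      simpa using this.2
    · intro m hm m' hm' e
      have h2 : blockWord L hL m = k ∧ (w m : ℕ) < a := by simpa using hm
      have h3 : blockWord L hL m' = k ∧ (w m' : ℕ) < a := by simpa using hm'
      by_contra hne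
      exact hw (genTens_eq_zero hL w hne (Fin.ext e) (h2.1.trans h3.1.symm))
  have h2 := card_blockWord L hL k
  have h3 : (Finset.univ.filter fun m => blockWord L hL m = k) =
      (Finset.univ.filter fun m => blockWord L hL m = k ∧ (w m : ℕ) < a) ∪
      (Finset.univ.filter fun m => blockWord L hL m = k ∧ a ≤ (w m : ℕ)) := by
    ext m
    simp only [Finset.mem_union, Finset.mem_filter_univ]
    rw [← and_or_left, and_iff_left (lt_or_ge _ _)]
  rw [h3] at h2
  have h4 := Finset.card_union_le (Finset.univ.filter fun m => blockWord L hL m = k ∧ (w m : ℕ) < a)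
    (Finset.univ.filter fun m => blockWord L hL m = k ∧ a ≤ (w m : ℕ))
  unfold blockCount
  omega

theorem sum_content (w : Word ℓ n) (a : ℕ) :
    (Finset.univ.filter fun m => a ≤ (w m : ℕ)).card =
      ∑ b ∈ Finset.univ.filter (fun b : Fin n => a ≤ (b : ℕ)), content w b := by
  rw [Finset.card_eq_sum_card_fiberwise (f := w)
    (t := Finset.univ.filter (fun b : Fin n => a ≤ (b : ℕ))) (by intro m hm; simpa using hm)]
  refine Finset.sum_congr rfl fun b hb => ?_
  rw [Finset.mem_filter_univ] at hb
  rw [Finset.filter_filter, content]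
  congr 1
  ext m
  simp only [Finset.mem_filter_univ, and_iff_right_iff_imp]
  rintro rfl
  exact hb

/-- The number of letters `≥ a` of a word with nonzero tensor is bounded below. -/
theorem le_of_genTens_ne_zero (hL : ∑ i, L i = ℓ) {w : Word ℓ n} (hw : genTens n L ν w ≠ 0)
    (a : ℕ) : ∑ k, (L k - a) ≤ (Finset.univ.filter fun m => a ≤ (w m : ℕ)).card := by
  rw [← sum_blockCount hL]
  exact Finset.sum_le_sum fun k _ => le_blockCount hL hw k a

/-- Tensors of extremal weight are proportional. -/
theorem genTens_proportional (hL : ∑ i, L i = ℓ) {w w' : Word ℓ n} (hw : genTens n L ν w ≠ 0)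
    (hw' : genTens n L ν w' ≠ 0)
    (h : ∀ a, (Finset.univ.filter fun m => a ≤ (w m : ℕ)).card = ∑ k, (L k - a))
    (h' : ∀ a, (Finset.univ.filter fun m => a ≤ (w' m : ℕ)).card = ∑ k, (L k - a)) :
    ∃ c : ℂ, genTens n L ν w' = c • genTens n L ν w := by
  have key : ∀ w : Word ℓ n, genTens n L ν w ≠ 0 →
      (∀ a, (Finset.univ.filter fun m => a ≤ (w m : ℕ)).card = ∑ k, (L k - a)) →
      ∀ k a, blockCount hL w k a = L k - a := by
    intro w hw h k a
    have h1 := h a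
    rw [← sum_blockCount hL] at h1
    exact ((Finset.sum_eq_sum_iff_of_le fun k _ => le_blockCount hL hw k a).1 h1.symm k
      (Finset.mem_univ k)).symm
  have key2 : ∀ (w : Word ℓ n) (k : Fin r) (b : Fin n),
      (Finset.univ.filter fun m => (blockWord L hL m, w m) = (k, b)).card + blockCount hL w k (b + 1) =
        blockCount hL w k b := by
    intro w k b
    unfold blockCount
    rw [← Finset.card_union_of_disjoint]
    · congr 1
      ext m
      simp only [Finset.mem_union, Finset.mem_filter_univ, Prod.mk.injEq]
      rw [← and_or_left, Fin.ext_iff]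
      refine and_congr_right fun _ => ?_
      omega
    · rw [Finset.disjoint_filter]
      rintro m - h1 h2
      rw [Prod.mk.injEq, Fin.ext_iff] at h1
      omega
  obtain ⟨τ, hτ⟩ := exists_perm_comp_eq (fun m => (blockWord L hL m, w' m))
    (fun m => (blockWord L hL m, w m)) (by
      rintro ⟨k, b⟩
      have h1 := key2 w k b
      have h2 := key2 w' k b
      rw [key w hw h, key w hw h] at h1
      rw [key w' hw' h', key w' hw' h'] at h2
      omega)
  have hb : blockWord L hL ∘ τ = blockWord L hL :=
    funext fun m => (congrArg Prod.fst (congrFun hτ m)).symm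
  have hwτ : w' = w ∘ τ := funext fun m => congrArg Prod.snd (congrFun hτ m)
  have e := genTens_comp (ν := ν) hL w hb
  refine ⟨((Equiv.Perm.sign τ : ℤ) : ℂ), ?_⟩
  rw [e, hwτ, smul_smul, ← Int.cast_mul, ← Units.val_mul, Int.units_mul_self]
  simp

end StandardWeights

end HeckeAlg

namespace HeckeAlg

/-! ### Whittaker vectors in quotients of `D_ℓ(M)` -/

section Alternator

variable {n : ℕ}

/-- The antisymmetrizer of the stabilizer of a word. -/
def alternator (u : Word ℓ n) : HeckeAlg ℓ :=
  ∑ τ ∈ Finset.univ.filter fun τ : Equiv.Perm (Fin ℓ) => u ∘ τ = u,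
    ((Equiv.Perm.sign τ : ℤ) : ℂ) • sigma τ

theorem comp_swap_eq {α β : Type*} [DecidableEq α] (f : α → β) {i j : α} (h : f i = f j) :
    f ∘ Equiv.swap i j = f := by
  funext m
  rw [Function.comp_apply, Equiv.swap_apply_def]
  split_ifs with h1 h2
  · rw [h1, h]
  · rw [h2, h]
  · rfl

theorem swap_mul_alternator (u : Word ℓ n) {i j : Fin ℓ} (hij : i ≠ j) (h : u i = u j) :
    sigma (Equiv.swap i j) * alternator u = - alternator u := by
  unfold alternator
  rw [Finset.mul_sum, ← Finset.sum_neg_distrib]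
  refine Finset.sum_bij (fun τ _ => Equiv.swap i j * τ) ?_ ?_ ?_ ?_
  · intro τ hτ
    rw [Finset.mem_filter_univ] at hτ ⊢
    rw [Equiv.Perm.coe_mul, ← Function.comp_assoc, comp_swap_eq u h, hτ]
  · intro a _ b _ hab
    exact mul_left_cancel hab
  · intro τ hτ
    rw [Finset.mem_filter_univ] at hτ
    refine ⟨Equiv.swap i j * τ, ?_, ?_⟩
    · rw [Finset.mem_filter_univ, Equiv.Perm.coe_mul, ← Function.comp_assoc, comp_swap_eq u h, hτ]
    · rw [← mul_assoc, Equiv.swap_mul_self, one_mul]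
  · intro τ _
    rw [mul_smul_comm, sigma_mul, Equiv.Perm.sign_mul, Equiv.Perm.sign_swap hij, ← neg_smul]
    simp

variable {M : Type} [AddCommGroup M] [Module ℂ M] [Module (HeckeAlg ℓ) M]
  [IsScalarTower ℂ (HeckeAlg ℓ) M]

theorem antiWord_alternator (u : Word ℓ n) (x : M) : AntiWord u (alternator u • x) := by
  intro i j hij h
  rw [← mul_smul, swap_mul_alternator u hij h, neg_smul]

theorem AntiWord.sigma_smul {u : Word ℓ n} {x : M} (hx : AntiWord u x) {τ : Equiv.Perm (Fin ℓ)}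
    (hτ : u ∘ τ = u) : sigma τ • x = ((Equiv.Perm.sign τ : ℤ) : ℂ) • x := by
  refine perm_preserving_induction u
    (P := fun τ => sigma τ • x = ((Equiv.Perm.sign τ : ℤ) : ℂ) • x) ?_ ?_ τ (fun i => congrFun hτ i)
  · rw [sigma_one, one_smul, Equiv.Perm.sign_one]; simp
  · intro i j hij h σ ih
    rw [← sigma_mul, mul_smul, ih, smul_comm (sigma _) (_ : ℂ) x, hx i j hij h,
      Equiv.Perm.sign_mul, Equiv.Perm.sign_swap hij]
    simp

theorem alternator_smul {u : Word ℓ n} {x : M} (hx : AntiWord u x) :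
    alternator u • x =
      ((Finset.univ.filter fun τ : Equiv.Perm (Fin ℓ) => u ∘ τ = u).card : ℂ) • x := by
  unfold alternator
  rw [Finset.sum_smul, Finset.cast_card, Finset.sum_smul]
  refine Finset.sum_congr rfl fun τ hτ => ?_
  rw [Finset.mem_filter_univ] at hτ
  rw [smul_assoc, hx.sigma_smul hτ, smul_smul]
  congr 1
  rcases Int.units_eq_one_or (Equiv.Perm.sign τ) with h | h <;> rw [h] <;> simp

theorem card_stabilizer_ne_zero (u : Word ℓ n) :
    ((Finset.univ.filter fun τ : Equiv.Perm (Fin ℓ) => u ∘ τ = u).card : ℂ) ≠ 0 := by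
  rw [Nat.cast_ne_zero, ← Nat.pos_iff_ne_zero, Finset.card_pos]
  exact ⟨1, by rw [Finset.mem_filter_univ]; rfl⟩

theorem HasType.map {M' : Type} [AddCommGroup M'] [Module ℂ M'] [Module (HeckeAlg ℓ) M']
    [IsScalarTower ℂ (HeckeAlg ℓ) M'] (f : M →ₗ[HeckeAlg ℓ] M') {l : List (ℂ × ℕ)} {p : ℕ} {x : M}
    (h : HasType (ℓ := ℓ) p l x) : HasType (ℓ := ℓ) p l (f x) := by
  induction l generalizing p with
  | nil => trivial
  | cons s t ih =>
    obtain ⟨a, k⟩ := s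
    refine ⟨?_, ?_, ih h.2.2⟩
    · intro i hi hi'
      rw [← f.map_smul, h.1 i hi hi', f.map_smul_of_tower]
    · intro σ hσ
      rw [← f.map_smul, h.2.1 σ hσ]

end Alternator

section LevelWord

/-- The word whose letters `j` fill the positions from `c (j + 1)` to `c j`. -/
def IsLevelWord {n : ℕ} (c : ℕ → ℕ) (u : Word ℓ n) : Prop :=
  ∀ m : Fin ℓ, c (u m + 1) ≤ m ∧ (m : ℕ) < c (u m)

theorem exists_isLevelWord {n : ℕ} (c : ℕ → ℕ) (h0 : c 0 = ℓ) (hn : c n = 0) :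
    ∃ u : Word ℓ n, IsLevelWord c u := by
  have key : ∀ m : Fin ℓ, ∃ j : Fin n, c (j + 1) ≤ m ∧ (m : ℕ) < c j := by
    intro m
    have hex : ∃ j, c j ≤ m := ⟨n, by omega⟩
    have h1 := Nat.find_spec hex
    have h2 : Nat.find hex ≤ n := Nat.find_min' hex (by omega)
    have h3 : Nat.find hex ≠ 0 := by
      intro h
      rw [h, h0] at h1
      have := m.2
      omega
    refine ⟨⟨Nat.find hex - 1, by omega⟩, ?_, ?_⟩
    · rw [Nat.sub_add_cancel (by omega)]; exact h1
    · have := Nat.find_min hex (m := Nat.find hex - 1) (by omega)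
      exact not_le.1 this
  choose u hu using key
  exact ⟨u, hu⟩

theorem IsLevelWord.le_iff {n : ℕ} {c : ℕ → ℕ} (hc : Antitone c) {u : Word ℓ n}
    (hu : IsLevelWord c u) (m : Fin ℓ) (a : ℕ) : a ≤ (u m : ℕ) ↔ (m : ℕ) < c a := by
  constructor
  · intro h
    exact (hu m).2.trans_le (hc h)
  · intro h
    by_contra h'
    have := hc (show (u m : ℕ) + 1 ≤ a by omega)
    have := (hu m).1
    omega

theorem IsLevelWord.card {n : ℕ} {c : ℕ → ℕ} (hc : Antitone c) (h0 : c 0 = ℓ) {u : Word ℓ n}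
    (hu : IsLevelWord c u) (a : ℕ) : (Finset.univ.filter fun m => a ≤ (u m : ℕ)).card = c a := by
  have h : c a ≤ ℓ := h0 ▸ hc (Nat.zero_le a)
  simp only [hu.le_iff hc]
  rw [Fin.card_filter_val_lt]
  omega

theorem IsLevelWord.unique {n : ℕ} {c : ℕ → ℕ} (hc : Antitone c) {u u' : Word ℓ n}
    (hu : IsLevelWord c u) (hu' : IsLevelWord c u') : u = u' := by
  funext m
  refine Fin.ext (le_antisymm ?_ ?_)
  · rw [hu'.le_iff hc]; exact (hu m).2
  · rw [hu.le_iff hc]; exact (hu' m).2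

theorem cut_antitone (l : List (ℂ × ℕ)) : Antitone (cut l) := by
  intro a b h
  unfold cut
  exact List.sum_le_sum fun s _ => by omega

theorem cut_eq_zero {l : List (ℂ × ℕ)} {N : ℕ} (h : ∀ s ∈ l, s.2 ≤ N) : cut l N = 0 := by
  unfold cut
  rw [List.sum_eq_zero_iff]
  intro x hx
  obtain ⟨s, hs, rfl⟩ := List.mem_map.1 hx
  have := h s hs
  omega

end LevelWord

section WhittakerQuotient

variable {n : ℕ} {M : Type} [AddCommGroup M] [Module ℂ M] [Module (HeckeAlg ℓ) M]
  [IsScalarTower ℂ (HeckeAlg ℓ) M]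

/-- The vectors all of whose translates have their tensors in `q`. -/
def tensIn (ρ : Hecke ℓ →ₐ[ℂ] Module.End ℂ M) (q : Submodule ℂ (Dmod n ρ)) :
    Submodule (HeckeAlg ℓ) M where
  carrier := {x | ∀ (h : HeckeAlg ℓ) (w : Word ℓ n), tens n ρ w (h • x) ∈ q}
  zero_mem' := by intro h w; rw [smul_zero, tens_zero]; exact zero_mem _
  add_mem' := by
    intro x x' hx hx' h w
    rw [smul_add, tens_add]; exact add_mem (hx h w) (hx' h w)
  smul_mem' := by
    intro h' x hx h w
    rw [← mul_smul]; exact hx _ _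

/-- The level word of `l` supports a Whittaker vector. -/
theorem exists_whittaker_alternating {l : List (ℂ × ℕ)} (hN : ∀ s ∈ l, s.2 ≤ n) (hd : DomList l)
    (htot : total l = ℓ) {u : Word ℓ n} (hu : IsLevelWord (cut l) u) {x : M} (hx : x ≠ 0)
    (ht : HasType (ℓ := ℓ) 0 l x) :
    ∃ h : HeckeAlg ℓ, h • x ≠ 0 ∧ AntiWord u (h • x) ∧ ∀ j < n, ∀ t : ℂ,
      charProd ℓ (cut l (j + 1)) t (cut l j - cut l (j + 1)) • h • x = levelPoly l j t • h • x := by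
  obtain ⟨h, -, h1, h2⟩ := exists_whittaker n l hN hd htot.le x hx ht
  refine ⟨h, h1, ?_, fun j hj t => (h2 j hj).2 t⟩
  intro i j hij hij'
  have e := hu j
  rw [← hij'] at e
  exact (h2 (u i) (u i).2).1 i j hij (mem_strands.2 (hu i)) (mem_strands.2 e)

theorem exists_whittaker_quotient (ρ : Hecke ℓ →ₐ[ℂ] Module.End ℂ M)
    (hρ : ∀ h x, ρ h x = ofHecke h • x) {π : Yangian n →ₐ[ℂ] Module.End ℂ (Dmod n ρ)}
    (hπ : IsDrinfeldAction n ρ π) {l : List (ℂ × ℕ)} (hN : ∀ s ∈ l, s.2 ≤ n) (hd : DomList l)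
    (htot : total l = ℓ) {u : Word ℓ n} (hu : IsLevelWord (cut l) u) {g : M}
    (hg : ∀ x, ∃ h : HeckeAlg ℓ, x = h • g) (ht : HasType (ℓ := ℓ) 0 l g)
    {q : Submodule ℂ (Dmod n ρ)} (hq : YStable π q) (hqt : q ≠ ⊤) :
    ∃ x : M, AntiWord u x ∧ tens n ρ u x ∉ q ∧ ∀ j < n, ∀ t : ℂ,
      tens n ρ u (charProd ℓ (cut l (j + 1)) t (cut l j - cut l (j + 1)) • x)
        - levelPoly l j t • tens n ρ u x ∈ q := by
  have hgq : (tensIn ρ q).mkQ g ≠ 0 := by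
    intro h0
    rw [Submodule.mkQ_apply, Submodule.Quotient.mk_eq_zero] at h0
    refine hqt (eq_top_iff.2 fun v _ => ?_)
    obtain ⟨f, rfl⟩ := Submodule.Quotient.mk_surjective _ v
    rw [mk_eq_sum_tens]
    refine sum_mem fun w _ => ?_
    obtain ⟨h, hh⟩ := hg (f w)
    rw [hh]; exact h0 h w
  obtain ⟨h, h1, h2, h3⟩ := exists_whittaker_alternating hN hd htot hu hgq (ht.map (tensIn ρ q).mkQ)
  have hmk : (tensIn ρ q).mkQ (alternator u • h • g) =
      ((Finset.univ.filter fun τ : Equiv.Perm (Fin ℓ) => u ∘ τ = u).card : ℂ) •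
        h • (tensIn ρ q).mkQ g := by
    rw [map_smul, map_smul, alternator_smul h2]
  refine ⟨alternator u • h • g, antiWord_alternator u _, fun hmem => ?_, fun j hj t => ?_⟩
  · have hne : (tensIn ρ q).mkQ (alternator u • h • g) ≠ 0 := by
      rw [hmk]; exact smul_ne_zero (card_stabilizer_ne_zero u) h1
    refine hne ?_
    rw [Submodule.mkQ_apply, Submodule.Quotient.mk_eq_zero]
    intro h' w
    obtain ⟨Y, hY⟩ := single_mem_realized u w h'
    have := hY M ρ hρ π hπ _ (antiWord_alternator u (h • g))
    rw [mk_single_smul] at this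
    rw [← this]
    exact hq Y _ hmem
  · generalize alternator u • h • g = v at hmk ⊢
    have hz : charProd ℓ (cut l (j + 1)) t (cut l j - cut l (j + 1)) • v
        - levelPoly l j t • v ∈ tensIn ρ q := by
      rw [← Submodule.Quotient.mk_eq_zero, ← Submodule.mkQ_apply, map_sub, map_smul,
        LinearMap.map_smul_of_tower, hmk, smul_comm (charProd _ _ _ _) (_ : ℂ) (h • _), h3 j hj t,
        smul_comm (_ : ℂ) (levelPoly l j t) (h • _), sub_self]
    have := hz 1 u
    rwa [one_smul, sub_eq_add_neg, tens_add, tens_neg, tens_smul, ← sub_eq_add_neg] at this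

end WhittakerQuotient

end HeckeAlg

namespace HeckeAlg

/-! ### Quotients of standard Yangian modules -/

section QuotientWeights

variable {n r : ℕ} {L : Fin r → ℕ} {ν : Fin r → ℂ}

theorem cut_segs (L : Fin r → ℕ) (ν : Fin r → ℂ) (a : ℕ) : cut (segs L ν) a = ∑ k, (L k - a) := by
  unfold cut segs
  rw [List.map_ofFn, List.sum_ofFn]
  rfl

theorem levelPoly_segs (L : Fin r → ℕ) (ν : Fin r → ℂ) (j : ℕ) (t : ℂ) :
    levelPoly (segs L ν) j t = ∏ k, if j < L k then t - (ν k + L k - 1 - j) else 1 := by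
  unfold levelPoly segs
  rw [List.map_ofFn, List.prod_ofFn]
  rfl

variable {π : Yangian n →ₐ[ℂ] Module.End ℂ (Dmod n (quotRho (KIdeal ℓ L ν)))}
  {q : Submodule ℂ (Dmod n (quotRho (KIdeal ℓ L ν)))}
  {πq : Yangian n →ₐ[ℂ] Module.End ℂ (Dmod n (quotRho (KIdeal ℓ L ν)) ⧸ q)}

theorem isWeight_mkQ (hπq : ∀ y x, πq y (q.mkQ x) = q.mkQ (π y x)) {w : Word ℓ n}
    {v : Dmod n (quotRho (KIdeal ℓ L ν))} (h : IsWeight π w v) : IsWeight πq w (q.mkQ v) := by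
  intro a
  rw [hπq, h a, map_smul]

theorem IsWeight.smul {V : Type} [AddCommGroup V] [Module ℂ V]
    {π : Yangian n →ₐ[ℂ] Module.End ℂ V} {w : Word ℓ n} {v : V} (h : IsWeight π w v) (c : ℂ) :
    IsWeight π w (c • v) := by
  intro a
  rw [map_smul, h a, smul_comm]

theorem exists_weight_expansion (hL : ∑ i, L i = ℓ) (hπ : IsDrinfeldAction n (quotRho (KIdeal ℓ L ν)) π)
    (hπq : ∀ y x, πq y (q.mkQ x) = q.mkQ (π y x)) {u : Word ℓ n}
    {v : Dmod n (quotRho (KIdeal ℓ L ν)) ⧸ q} (hv : IsWeight πq u v) :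
    ∃ c : Word ℓ n → ℂ, v = ∑ w ∈ Finset.univ.filter (fun w => content w = content u),
      c w • q.mkQ (genTens n L ν w) := by
  obtain ⟨v', rfl⟩ := q.mkQ_surjective v
  have hv' : v' ∈ Submodule.span ℂ (Set.range (genTens n L ν)) := by
    rw [span_genTens hL]; trivial
  obtain ⟨c, hc⟩ := (Submodule.mem_span_range_iff_exists_fun ℂ).1 hv'
  refine ⟨c, IsWeight.eq_sum_filter (fun w => c w • q.mkQ (genTens n L ν w)) (fun w => ?_) hv ?_⟩
  · exact (isWeight_mkQ hπq (isWeight_tens _ hπ w _)).smul _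
  · rw [← hc, map_sum]
    exact Finset.sum_congr rfl fun w _ => map_smul _ _ _

theorem card_eq_of_content_eq {u w : Word ℓ n} (h : content w = content u) (a : ℕ) :
    (Finset.univ.filter fun m => a ≤ (w m : ℕ)).card =
      (Finset.univ.filter fun m => a ≤ (u m : ℕ)).card := by
  rw [sum_content, sum_content, h]

theorem le_of_isWeight (hL : ∑ i, L i = ℓ) (hπ : IsDrinfeldAction n (quotRho (KIdeal ℓ L ν)) π)
    (hπq : ∀ y x, πq y (q.mkQ x) = q.mkQ (π y x)) {u : Word ℓ n}
    {v : Dmod n (quotRho (KIdeal ℓ L ν)) ⧸ q} (hv : IsWeight πq u v) (hv0 : v ≠ 0) (a : ℕ) :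
    ∑ k, (L k - a) ≤ (Finset.univ.filter fun m => a ≤ (u m : ℕ)).card := by
  obtain ⟨c, hc⟩ := exists_weight_expansion hL hπ hπq hv
  rw [hc] at hv0
  obtain ⟨w, hw, hw0⟩ := Finset.exists_ne_zero_of_sum_ne_zero hv0
  rw [Finset.mem_filter_univ] at hw
  rw [← card_eq_of_content_eq hw]
  refine le_of_genTens_ne_zero (ν := ν) hL (fun h => hw0 ?_) a
  rw [h, map_zero, smul_zero]

theorem exists_weight_generator (hL : ∑ i, L i = ℓ)
    (hπ : IsDrinfeldAction n (quotRho (KIdeal ℓ L ν)) π)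
    (hπq : ∀ y x, πq y (q.mkQ x) = q.mkQ (π y x)) {u : Word ℓ n}
    (hu : ∀ a, (Finset.univ.filter fun m => a ≤ (u m : ℕ)).card = ∑ k, (L k - a)) :
    ∃ g, ∀ v, IsWeight πq u v → ∃ c : ℂ, v = c • g := by
  by_cases hex : ∃ w : Word ℓ n, content w = content u ∧ genTens n L ν w ≠ 0
  · obtain ⟨w₀, hw₀, hne₀⟩ := hex
    refine ⟨q.mkQ (genTens n L ν w₀), fun v hv => ?_⟩
    obtain ⟨c, hc⟩ := exists_weight_expansion hL hπ hπq hv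
    have key : ∀ w : Word ℓ n, content w = content u →
        ∃ d : ℂ, genTens n L ν w = d • genTens n L ν w₀ := by
      intro w hw
      by_cases h0 : genTens n L ν w = 0
      · exact ⟨0, by rw [h0, zero_smul]⟩
      · exact genTens_proportional hL hne₀ h0 (fun a => by rw [card_eq_of_content_eq hw₀, hu])
          (fun a => by rw [card_eq_of_content_eq hw, hu])
    choose! d hd using key
    refine ⟨∑ w ∈ Finset.univ.filter (fun w => content w = content u), c w * d w, ?_⟩
    rw [hc, Finset.sum_smul]
    refine Finset.sum_congr rfl fun w hw => ?_
    rw [Finset.mem_filter_univ] at hw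
    rw [hd w hw, map_smul, smul_smul]
  · push Not at hex
    refine ⟨0, fun v hv => ⟨0, ?_⟩⟩
    obtain ⟨c, hc⟩ := exists_weight_expansion hL hπ hπq hv
    rw [hc, smul_zero]
    refine Finset.sum_eq_zero fun w hw => ?_
    rw [Finset.mem_filter_univ] at hw
    rw [hex w hw, map_zero, smul_zero]

/-- A nonzero quotient contains a vector supported on the level word, on which suitable elements of
the Yangian act by the level polynomials. -/
theorem exists_quotient_vector (hL : ∑ i, L i = ℓ) (hn : ∀ i, L i ≤ n) (hd : DomList (segs L ν))
    (hπ : IsDrinfeldAction n (quotRho (KIdeal ℓ L ν)) π) (hq : YStable π q) (hqt : q ≠ ⊤)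
    (hπq : ∀ y x, πq y (q.mkQ x) = q.mkQ (π y x)) {u : Word ℓ n}
    (hu : IsLevelWord (cut (segs L ν)) u) :
    ∃ ξ, ξ ≠ 0 ∧ IsWeight πq u ξ ∧ ∀ j < n, ∀ (t : ℂ) (Y : Yangian n),
      RealizedBy u (Pi.single u (charProd ℓ (cut (segs L ν) (j + 1)) t
        (cut (segs L ν) j - cut (segs L ν) (j + 1)))) Y →
      πq Y ξ = levelPoly (segs L ν) j t • ξ := by
  have hN : ∀ s ∈ segs L ν, s.2 ≤ n := by
    intro s hs
    obtain ⟨k, rfl⟩ := (List.mem_ofFn' _ _).1 hs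
    exact hn k
  obtain ⟨x, hx, hxq, hF⟩ := exists_whittaker_quotient (quotRho (KIdeal ℓ L ν)) (quotRho_apply _) hπ hN
    hd ((total_segs L ν).trans hL) hu (exists_smul_gen _)
    ((blockType_iff_hasType _).1 (blockType_gen L ν)) hq hqt
  refine ⟨q.mkQ (tens n _ u x), ?_, isWeight_mkQ hπq (isWeight_tens _ hπ u x), ?_⟩
  · rwa [Ne, Submodule.mkQ_apply, Submodule.Quotient.mk_eq_zero]
  · intro j hj t Y hY
    rw [hπq, hY _ _ (quotRho_apply _) _ hπ x hx, mk_single_smul, ← map_smul, ← sub_eq_zero,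
      ← map_sub,
      Submodule.mkQ_apply, Submodule.Quotient.mk_eq_zero]
    exact hF j hj t

end QuotientWeights

section Comparison

variable {n r r' : ℕ} {L : Fin r → ℕ} {ν : Fin r → ℂ} {L' : Fin r' → ℕ} {ν' : Fin r' → ℂ}
  {π : Yangian n →ₐ[ℂ] Module.End ℂ (Dmod n (quotRho (KIdeal ℓ L ν)))}
  {q : Submodule ℂ (Dmod n (quotRho (KIdeal ℓ L ν)))}
  {πq : Yangian n →ₐ[ℂ] Module.End ℂ (Dmod n (quotRho (KIdeal ℓ L ν)) ⧸ q)}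
  {π' : Yangian n →ₐ[ℂ] Module.End ℂ (Dmod n (quotRho (KIdeal ℓ L' ν')))}
  {q' : Submodule ℂ (Dmod n (quotRho (KIdeal ℓ L' ν')))}
  {πq' : Yangian n →ₐ[ℂ] Module.End ℂ (Dmod n (quotRho (KIdeal ℓ L' ν')) ⧸ q')}

theorem IsWeight.map {V V' : Type} [AddCommGroup V] [Module ℂ V] [AddCommGroup V'] [Module ℂ V']
    {π : Yangian n →ₐ[ℂ] Module.End ℂ V} {π' : Yangian n →ₐ[ℂ] Module.End ℂ V'} (e : V →ₗ[ℂ] V')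
    (he : ∀ y x, e (π y x) = π' y (e x)) {w : Word ℓ n} {v : V} (h : IsWeight π w v) :
    IsWeight π' w (e v) := by
  intro a
  rw [← he, h a, map_smul]

theorem cut_le_of_hom (hL : ∑ i, L i = ℓ) (hn : ∀ i, L i ≤ n) (hd : DomList (segs L ν))
    (hπ : IsDrinfeldAction n (quotRho (KIdeal ℓ L ν)) π) (hq : YStable π q) (hqt : q ≠ ⊤)
    (hπq : ∀ y x, πq y (q.mkQ x) = q.mkQ (π y x))
    (hL' : ∑ i, L' i = ℓ) (hπ' : IsDrinfeldAction n (quotRho (KIdeal ℓ L' ν')) π')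
    (hπq' : ∀ y x, πq' y (q'.mkQ x) = q'.mkQ (π' y x))
    (e : (Dmod n (quotRho (KIdeal ℓ L ν)) ⧸ q) ≃ₗ[ℂ] (Dmod n (quotRho (KIdeal ℓ L' ν')) ⧸ q'))
    (he : ∀ y x, e (πq y x) = πq' y (e x)) {u : Word ℓ n}
    (hu : IsLevelWord (cut (segs L ν)) u) (a : ℕ) :
    cut (segs L' ν') a ≤ cut (segs L ν) a := by
  obtain ⟨ξ, hξ, hw, -⟩ := exists_quotient_vector hL hn hd hπ hq hqt hπq hu
  have := le_of_isWeight hL' hπ' hπq' (hw.map e.toLinearMap he)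
    ((LinearEquiv.map_ne_zero_iff e).2 hξ) a
  rwa [hu.card (cut_antitone _) (by rw [cut_zero, total_segs, hL]), ← cut_segs L' ν'] at this

/-- Isomorphic nonzero quotients have the same level data. -/
theorem levelPoly_eq_of_equiv (hL : ∑ i, L i = ℓ) (hn : ∀ i, L i ≤ n) (hd : DomList (segs L ν))
    (hπ : IsDrinfeldAction n (quotRho (KIdeal ℓ L ν)) π) (hq : YStable π q) (hqt : q ≠ ⊤)
    (hπq : ∀ y x, πq y (q.mkQ x) = q.mkQ (π y x))
    (hL' : ∑ i, L' i = ℓ) (hn' : ∀ i, L' i ≤ n) (hd' : DomList (segs L' ν'))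
    (hπ' : IsDrinfeldAction n (quotRho (KIdeal ℓ L' ν')) π') (hq' : YStable π' q') (hqt' : q' ≠ ⊤)
    (hπq' : ∀ y x, πq' y (q'.mkQ x) = q'.mkQ (π' y x))
    (e : (Dmod n (quotRho (KIdeal ℓ L ν)) ⧸ q) ≃ₗ[ℂ] (Dmod n (quotRho (KIdeal ℓ L' ν')) ⧸ q'))
    (he : ∀ y x, e (πq y x) = πq' y (e x)) {j : ℕ} (hj : j < n) (t : ℂ) :
    levelPoly (segs L ν) j t = levelPoly (segs L' ν') j t := by
  have key : ∀ {r : ℕ} {L : Fin r → ℕ} {ν : Fin r → ℂ}, (∑ i, L i = ℓ) → (∀ i, L i ≤ n) →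
      ∃ u : Word ℓ n, IsLevelWord (cut (segs L ν)) u := by
    intro r L ν hL hn
    refine exists_isLevelWord _ (by rw [cut_zero, total_segs, hL]) (cut_eq_zero ?_)
    intro s hs
    obtain ⟨k, rfl⟩ := (List.mem_ofFn' _ _).1 hs
    exact hn k
  obtain ⟨u, hu⟩ := key (ν := ν) hL hn
  obtain ⟨u', hu'⟩ := key (ν := ν') hL' hn'
  have he' : ∀ y x, e.symm (πq' y x) = πq y (e.symm x) := by
    intro y x
    rw [LinearEquiv.symm_apply_eq, he, LinearEquiv.apply_symm_apply]
  have hcut : cut (segs L ν) = cut (segs L' ν') := by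
    funext a
    exact le_antisymm (cut_le_of_hom hL' hn' hd' hπ' hq' hqt' hπq' hL hπ hπq e.symm he' hu' a)
      (cut_le_of_hom hL hn hd hπ hq hqt hπq hL' hπ' hπq' e he hu a)
  obtain rfl : u = u' := hu.unique (cut_antitone _) (hcut ▸ hu')
  obtain ⟨ξ, hξ, hw, hY⟩ := exists_quotient_vector hL hn hd hπ hq hqt hπq hu
  obtain ⟨ξ', hξ', hw', hY'⟩ := exists_quotient_vector hL' hn' hd' hπ' hq' hqt' hπq' hu'
  obtain ⟨g, hg⟩ := exists_weight_generator hL' hπ' hπq' (u := u) (by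
    intro a
    rw [← cut_segs L' ν', hu'.card (cut_antitone _) (by rw [cut_zero, total_segs, hL'])])
  obtain ⟨c, hc⟩ := hg _ (hw.map e.toLinearMap he)
  obtain ⟨c', hc'⟩ := hg _ hw'
  have hc0 : c' ≠ 0 := by rintro rfl; rw [zero_smul] at hc'; exact hξ' hc'
  have heξ : e ξ = (c / c') • ξ' := by
    rw [hc', smul_smul, div_mul_cancel₀ _ hc0]; exact hc
  have heξ0 : e ξ ≠ 0 := (LinearEquiv.map_ne_zero_iff e).2 hξ
  obtain ⟨Y, hreal⟩ := single_mem_realized u u (charProd ℓ (cut (segs L ν) (j + 1)) t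
    (cut (segs L ν) j - cut (segs L ν) (j + 1)))
  have h1 := he Y ξ
  rw [hY j hj t Y hreal, map_smul] at h1
  rw [hcut] at hreal
  rw [heξ, map_smul (πq' Y), hY' j hj t Y hreal, smul_comm (c / c'), ← heξ] at h1
  exact smul_left_injective ℂ heξ0 h1

end Comparison

end HeckeAlg

namespace HeckeAlg

/-! ### Recovering the segments from the level polynomials -/

section Segments

variable {r : ℕ} {L L' : Fin r → ℕ} {ν ν' lam : Fin r → ℂ}

open Polynomial in
theorem multiset_eq_of_prod_sub_eq {ι : Type*} (s s' : Finset ι) (f : ι → ℂ)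
    (h : ∀ t, ∏ k ∈ s, (t - f k) = ∏ k ∈ s', (t - f k)) : s.val.map f = s'.val.map f := by
  have key : ((s.val.map f).map fun a => X - C a).prod = ((s'.val.map f).map fun a => X - C a).prod := by
    refine Polynomial.funext fun t => ?_
    have e : ∀ s : Finset ι, eval t ((s.val.map f).map fun a => X - C a).prod = ∏ k ∈ s, (t - f k) := by
      intro s
      rw [Multiset.map_map]
      change eval t (∏ k ∈ s, (X - C (f k))) = _
      rw [eval_prod]
      simp
    rw [e, e, h]
  rw [← roots_multiset_prod_X_sub_C (s.val.map f), key, roots_multiset_prod_X_sub_C]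

theorem card_level_eq (hν : ∀ k, ν k + L k = lam k) (hν' : ∀ k, ν' k + L' k = lam k) {j : ℕ}
    (h : ∀ t, levelPoly (segs L ν) j t = levelPoly (segs L' ν') j t) (z : ℂ) :
    (Finset.univ.filter fun k => j < L k ∧ lam k = z).card =
      (Finset.univ.filter fun k => j < L' k ∧ lam k = z).card := by
  have e := multiset_eq_of_prod_sub_eq (Finset.univ.filter fun k => j < L k)
    (Finset.univ.filter fun k => j < L' k) (fun k => lam k - 1 - j) (by
      intro t
      have := h t
      rw [levelPoly_segs, levelPoly_segs] at this
      simpa only [hν, hν', Finset.prod_filter] using this)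
  have count : ∀ s : Finset (Fin r), (s.val.map fun k => lam k - 1 - j).count (z - 1 - j) =
      (s.filter fun k => lam k = z).card := by
    intro s
    rw [Multiset.count_map, Finset.card_def, Finset.filter_val]
    congr 1
    refine Multiset.filter_congr fun k _ => ?_
    constructor
    · intro h; linear_combination -h
    · intro h; rw [h]
  have e' := congrArg (Multiset.count (z - 1 - j)) e
  rw [count, count, Finset.filter_filter, Finset.filter_filter] at e'
  exact e'

theorem exists_perm_of_levelPoly {n : ℕ} (hn : ∀ k, L k ≤ n) (hn' : ∀ k, L' k ≤ n)
    (hν : ∀ k, ν k + L k = lam k) (hν' : ∀ k, ν' k + L' k = lam k)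
    (h : ∀ j < n, ∀ t, levelPoly (segs L ν) j t = levelPoly (segs L' ν') j t) :
    ∃ τ : Equiv.Perm (Fin r), ∀ k, lam k = lam (τ k) ∧ L' k = L (τ k) := by
  have hlev : ∀ j z, (Finset.univ.filter fun k => j < L k ∧ lam k = z).card =
      (Finset.univ.filter fun k => j < L' k ∧ lam k = z).card := by
    intro j z
    by_cases hj : j < n
    · exact card_level_eq hν hν' (h j hj) z
    · congr 1
      refine Finset.filter_congr fun k _ => ?_
      have := hn k
      have := hn' k
      constructor <;> rintro ⟨h1, -⟩ <;> omega
  have hsplit : ∀ (L : Fin r → ℕ) (j : ℕ) (z : ℂ),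
      (Finset.univ.filter fun k => (lam k, L k) = (z, j + 1)).card
        + (Finset.univ.filter fun k => j + 1 < L k ∧ lam k = z).card =
      (Finset.univ.filter fun k => j < L k ∧ lam k = z).card := by
    intro L j z
    rw [← Finset.card_union_of_disjoint]
    · congr 1
      ext k
      simp only [Finset.mem_union, Finset.mem_filter_univ, Prod.mk.injEq]
      constructor
      · rintro (⟨h1, h2⟩ | ⟨h1, h2⟩)
        · exact ⟨by omega, h1⟩
        · exact ⟨by omega, h2⟩
      · rintro ⟨h1, h2⟩
        by_cases h3 : L k = j + 1
        · exact Or.inl ⟨h2, h3⟩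
        · exact Or.inr ⟨by omega, h2⟩
    · rw [Finset.disjoint_filter]
      rintro k _ h1 ⟨h2, -⟩
      rw [Prod.mk.injEq] at h1
      omega
  have hsplit0 : ∀ (L : Fin r → ℕ) (z : ℂ),
      (Finset.univ.filter fun k => (lam k, L k) = (z, 0)).card
        + (Finset.univ.filter fun k => 0 < L k ∧ lam k = z).card =
      (Finset.univ.filter fun k => lam k = z).card := by
    intro L z
    rw [← Finset.card_union_of_disjoint]
    · congr 1
      ext k
      simp only [Finset.mem_union, Finset.mem_filter_univ, Prod.mk.injEq]
      constructor
      · rintro (⟨h1, h2⟩ | ⟨h1, h2⟩)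
        · exact h1
        · exact h2
      · intro h2
        by_cases h3 : L k = 0
        · exact Or.inl ⟨h2, h3⟩
        · exact Or.inr ⟨by omega, h2⟩
    · rw [Finset.disjoint_filter]
      rintro k _ h1 ⟨h2, -⟩
      rw [Prod.mk.injEq] at h1
      omega
  obtain ⟨τ, hτ⟩ := exists_perm_comp_eq (fun k => (lam k, L' k)) (fun k => (lam k, L k)) (by
    rintro ⟨z, _ | j⟩
    · have h1 := hsplit0 L z
      have h2 := hsplit0 L' z
      have h3 := hlev 0 z
      omega
    · have h1 := hsplit L j z
      have h2 := hsplit L' j z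
      have h3 := hlev j z
      have h4 := hlev (j + 1) z
      omega)
  exact ⟨τ, fun k => Prod.mk.inj (congrFun hτ k)⟩

end Segments

end HeckeAlg

namespace HeckeAlg

/-! ### Functoriality of `D_ℓ` and nonvanishing -/

section Functoriality

variable {n : ℕ} {M M' : Type} [AddCommGroup M] [Module ℂ M] [AddCommGroup M'] [Module ℂ M']
  {ρ : Hecke ℓ →ₐ[ℂ] Module.End ℂ M} {ρ' : Hecke ℓ →ₐ[ℂ] Module.End ℂ M'}

theorem compLeft_mem_NSub (φ : M →ₗ[ℂ] M') (hφ : ∀ h x, φ (ρ h x) = ρ' h (φ x)) {f : MW ℓ n M}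
    (hf : f ∈ NSub n ρ) : φ.compLeft (Word ℓ n) f ∈ NSub n ρ' := by
  have : NSub n ρ ≤ (NSub n ρ').comap (φ.compLeft (Word ℓ n)) := by
    refine iSup_le fun i => iSup_le fun h => ?_
    rintro _ ⟨g, rfl⟩
    refine Submodule.mem_iSup_of_mem i (Submodule.mem_iSup_of_mem h ⟨φ.compLeft _ g, ?_⟩)
    funext w
    change ρ' _ (φ (g _)) + φ (g w) = φ (ρ _ (g _) + g w)
    rw [map_add, hφ]
  exact this hf

theorem exists_Dmod_equiv (φ : M ≃ₗ[ℂ] M') (hφ : ∀ h x, φ (ρ h x) = ρ' h (φ x)) :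
    ∃ e : Dmod n ρ ≃ₗ[ℂ] Dmod n ρ', ∀ f : MW ℓ n M,
      e (Submodule.Quotient.mk f) = Submodule.Quotient.mk fun w => φ (f w) := by
  have hφ' : ∀ h x, φ.symm (ρ' h x) = ρ h (φ.symm x) := by
    intro h x
    rw [LinearEquiv.symm_apply_eq, hφ, LinearEquiv.apply_symm_apply]
  refine ⟨Submodule.Quotient.equiv _ _ (LinearEquiv.piCongrRight fun _ : Word ℓ n => φ) ?_, fun f => rfl⟩
  refine le_antisymm ?_ fun f hf => ?_
  · rintro _ ⟨f, hf, rfl⟩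
    exact compLeft_mem_NSub φ.toLinearMap hφ hf
  · refine ⟨φ.symm.toLinearMap.compLeft _ f, compLeft_mem_NSub φ.symm.toLinearMap hφ' hf, ?_⟩
    funext w
    exact φ.apply_symm_apply (f w)

/-- A linear map intertwining the generators of the Yangian is a homomorphism. -/
theorem intertwines_of_generators {V V' : Type} [AddCommGroup V] [Module ℂ V] [AddCommGroup V']
    [Module ℂ V'] {π : Yangian n →ₐ[ℂ] Module.End ℂ V} {π' : Yangian n →ₐ[ℂ] Module.End ℂ V'}
    (e : V →ₗ[ℂ] V') (he : ∀ a b d x, e (π (Yangian.t a b d) x) = π' (Yangian.t a b d) (e x))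
    (y : Yangian n) (x : V) : e (π y x) = π' y (e x) := by
  obtain ⟨y, rfl⟩ := RingQuot.mkAlgHom_surjective ℂ (YRel n) y
  induction y using FreeAlgebra.induction generalizing x with
  | grade0 c => simp [Algebra.algebraMap_eq_smul_one]
  | grade1 i => exact he i.1 i.2.1 i.2.2 x
  | mul a b ha hb => rw [map_mul, map_mul, map_mul, Module.End.mul_apply, Module.End.mul_apply, ha,
    hb]
  | add a b ha hb => rw [map_add, map_add, map_add, LinearMap.add_apply, LinearMap.add_apply,
    map_add, ha, hb]

theorem exists_yangian_equiv (φ : M ≃ₗ[ℂ] M') (hφ : ∀ h x, φ (ρ h x) = ρ' h (φ x))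
    {π : Yangian n →ₐ[ℂ] Module.End ℂ (Dmod n ρ)} (hπ : IsDrinfeldAction n ρ π)
    {π' : Yangian n →ₐ[ℂ] Module.End ℂ (Dmod n ρ')} (hπ' : IsDrinfeldAction n ρ' π') :
    ∃ e : Dmod n ρ ≃ₗ[ℂ] Dmod n ρ', ∀ y x, e (π y x) = π' y (e x) := by
  obtain ⟨e, he⟩ := exists_Dmod_equiv (n := n) φ hφ
  refine ⟨e, intertwines_of_generators e.toLinearMap fun a b d x => ?_⟩
  obtain ⟨f, rfl⟩ := Submodule.Quotient.mk_surjective _ x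
  change e _ = π' _ (e _)
  rw [hπ, he, he, hπ']
  congr 1
  funext w
  simp only [sumOp, LinearMap.sum_apply, Finset.sum_apply, map_sum]
  refine Finset.sum_congr rfl fun m _ => ?_
  change φ (ρ _ (if w m = a then f _ else 0)) = ρ' _ (if w m = a then φ (f _) else 0)
  rw [hφ]
  split_ifs
  · rfl
  · rw [map_zero]

end Functoriality

section Nonvanishing

variable {n : ℕ} {M : Type} [AddCommGroup M] [Module ℂ M] [Module (HeckeAlg ℓ) M]
  [IsScalarTower ℂ (HeckeAlg ℓ) M]

/-- The antisymmetrized coefficient of a word. -/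
def altCoeff (u : Word ℓ n) : MW ℓ n M →ₗ[ℂ] M :=
  ∑ σ : Equiv.Perm (Fin ℓ), ((Equiv.Perm.sign σ : ℤ) : ℂ) •
    (Module.toModuleEnd ℂ (S := HeckeAlg ℓ) M (sigma σ) ∘ₗ LinearMap.proj (u ∘ σ))

theorem altCoeff_apply (u : Word ℓ n) (f : MW ℓ n M) :
    altCoeff u f = ∑ σ : Equiv.Perm (Fin ℓ), ((Equiv.Perm.sign σ : ℤ) : ℂ) • sigma σ • f (u ∘ σ) := by
  unfold altCoeff
  rw [LinearMap.sum_apply]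
  rfl

theorem altCoeff_eq_zero (ρ : Hecke ℓ →ₐ[ℂ] Module.End ℂ M) (hρ : ∀ h x, ρ h x = ofHecke h • x)
    (u : Word ℓ n) {f : MW ℓ n M} (hf : f ∈ NSub n ρ) : altCoeff u f = 0 := by
  have : NSub n ρ ≤ LinearMap.ker (altCoeff (M := M) u) := by
    refine iSup_le fun i => iSup_le fun h => ?_
    rintro _ ⟨g, rfl⟩
    rw [LinearMap.mem_ker, LinearMap.add_apply, map_add, LinearMap.id_apply,
      ← eq_neg_iff_add_eq_zero,
      altCoeff_apply, altCoeff_apply, ← Finset.sum_neg_distrib]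
    have hne : i ≠ ⟨(i : ℕ) + 1, h⟩ := by
      intro e; have := congrArg Fin.val e; simp at this
    refine Fintype.sum_equiv (Equiv.mulRight (Equiv.swap i ⟨(i : ℕ) + 1, h⟩)) _ _ fun σ => ?_
    change _ • sigma σ • ρ (Hecke.sigma (Equiv.swap i ⟨(i : ℕ) + 1, h⟩))
      (g ((u ∘ σ) ∘ Equiv.swap i ⟨(i : ℕ) + 1, h⟩)) =
      -((((Equiv.Perm.sign (σ * Equiv.swap i ⟨(i : ℕ) + 1, h⟩) : ℤˣ) : ℤ) : ℂ) • _ •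
        g ((u ∘ σ) ∘ Equiv.swap i ⟨(i : ℕ) + 1, h⟩))
    rw [hρ, Equiv.Perm.sign_mul, Equiv.Perm.sign_swap hne, ← neg_smul]
    change _ • sigma σ • sigma _ • _ = _ • sigma (σ * Equiv.swap i ⟨(i : ℕ) + 1, h⟩) • _
    rw [← mul_smul, sigma_mul]
    simp
  exact this hf

theorem tens_ne_zero (ρ : Hecke ℓ →ₐ[ℂ] Module.End ℂ M) (hρ : ∀ h x, ρ h x = ofHecke h • x)
    {u : Word ℓ n} {x : M} (hx : AntiWord u x) (hx0 : x ≠ 0) : tens n ρ u x ≠ 0 := by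
  intro h
  have h1 := altCoeff_eq_zero ρ hρ u ((Submodule.Quotient.mk_eq_zero _).1 h)
  refine smul_ne_zero (card_stabilizer_ne_zero u) hx0 ?_
  rw [← alternator_smul hx, ← h1, altCoeff_apply, alternator, Finset.sum_smul, Finset.sum_filter]
  refine Finset.sum_congr rfl fun σ _ => ?_
  split_ifs with h
  · rw [h, Pi.single_eq_same, smul_assoc]
  · rw [Pi.single_eq_of_ne h, smul_zero, smul_zero]

theorem nontrivial_Dmod_standard {r : ℕ} {L : Fin r → ℕ} {ν : Fin r → ℂ} (hL : ∑ i, L i = ℓ)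
    (hn : ∀ i, L i ≤ n) (hd : DomList (segs L ν)) : Nontrivial (Dmod n (quotRho (KIdeal ℓ L ν))) := by
  have hN : ∀ s ∈ segs L ν, s.2 ≤ n := by
    intro s hs
    obtain ⟨k, rfl⟩ := (List.mem_ofFn' _ _).1 hs
    exact hn k
  obtain ⟨u, hu⟩ := exists_isLevelWord (n := n) (cut (segs L ν)) (by rw [cut_zero, total_segs, hL])
    (cut_eq_zero hN)
  obtain ⟨h, h1, h2, -⟩ := exists_whittaker_alternating hN hd ((total_segs L ν).trans hL) hu
    (gen_ne_zero L hL ν) ((blockType_iff_hasType _).1 (blockType_gen L ν))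
  exact ⟨⟨_, 0, tens_ne_zero (quotRho (KIdeal ℓ L ν)) (quotRho_apply _) h2 h1⟩⟩

theorem finite_Dmod_standard {r : ℕ} {L : Fin r → ℕ} (ν : Fin r → ℂ) (hL : ∑ i, L i = ℓ) :
    Module.Finite ℂ (Dmod n (quotRho (KIdeal ℓ L ν))) := by
  have := finite_KMod L hL ν
  infer_instance

end Nonvanishing

/-! ### Simple quotients -/

section SimpleQuotient

variable {n : ℕ} {V V' : Type} [AddCommGroup V] [Module ℂ V] [AddCommGroup V'] [Module ℂ V']
  {π : Yangian n →ₐ[ℂ] Module.End ℂ V} {π' : Yangian n →ₐ[ℂ] Module.End ℂ V'}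

/-- The action on the quotient by a stable subspace. -/
def quotAct (π : Yangian n →ₐ[ℂ] Module.End ℂ V) (q : Submodule ℂ V) (hq : YStable π q) :
    Yangian n →ₐ[ℂ] Module.End ℂ (V ⧸ q) :=
  AlgHom.ofLinearMap
    { toFun := fun y => q.mapQ q (π y) fun x hx => hq y x hx
      map_add' := by
        intro y y'
        refine Submodule.linearMap_qext _ (LinearMap.ext fun x => ?_)
        simp
      map_smul' := by
        intro c y
        refine Submodule.linearMap_qext _ (LinearMap.ext fun x => ?_)
        simp }
    (by
      refine Submodule.linearMap_qext _ (LinearMap.ext fun x => ?_)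
      simp)
    (by
      intro y y'
      refine Submodule.linearMap_qext _ (LinearMap.ext fun x => ?_)
      simp)

theorem quotAct_mkQ {q : Submodule ℂ V} (hq : YStable π q) (y : Yangian n) (x : V) :
    quotAct π q hq y (q.mkQ x) = q.mkQ (π y x) := rfl

theorem exists_simple_quotient (π : Yangian n →ₐ[ℂ] Module.End ℂ V) [Module.Finite ℂ V] [Nontrivial V] :
    ∃ (q : Submodule ℂ V) (hq : YStable π q), YSimple (quotAct π q hq) := by
  obtain ⟨q, ⟨hq, hqt⟩, hmax⟩ := (wellFounded_gt (α := Submodule ℂ V)).has_min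
    {q | YStable π q ∧ q ≠ ⊤} ⟨⊥, by
      constructor
      · intro y x hx
        rw [Submodule.mem_bot] at hx ⊢
        rw [hx, map_zero]
      · exact bot_ne_top⟩
  refine ⟨q, hq, Submodule.Quotient.nontrivial_iff.2 hqt, fun p hp => ?_⟩
  have hle : q ≤ p.comap q.mkQ := by
    intro x hx
    rw [Submodule.mem_comap, Submodule.mkQ_apply, (Submodule.Quotient.mk_eq_zero q).2 hx]
    exact zero_mem _
  have hstab : YStable π (p.comap q.mkQ) := by
    intro y x hx
    rw [Submodule.mem_comap, ← quotAct_mkQ hq]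
    exact hp y _ hx
  by_cases htop : p.comap q.mkQ = ⊤
  · right
    rw [eq_top_iff]
    intro v _
    obtain ⟨x, rfl⟩ := q.mkQ_surjective v
    have : x ∈ p.comap q.mkQ := htop ▸ Submodule.mem_top
    exact this
  · left
    have heq : q = p.comap q.mkQ := by
      by_contra hne
      exact hmax _ ⟨hstab, htop⟩ (lt_of_le_of_ne hle hne)
    rw [eq_bot_iff]
    intro v hv
    obtain ⟨x, rfl⟩ := q.mkQ_surjective v
    have : x ∈ q := heq ▸ hv
    rw [Submodule.mem_bot, Submodule.mkQ_apply, Submodule.Quotient.mk_eq_zero]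
    exact this

theorem ySimple_of_equiv (e : V ≃ₗ[ℂ] V') (he : ∀ y x, e (π y x) = π' y (e x)) (h : YSimple π) :
    YSimple π' := by
  have := h.1
  refine ⟨e.injective.nontrivial, fun p hp => ?_⟩
  have hp' : YStable π (p.comap e.toLinearMap) := by
    intro y x hx
    change e (π y x) ∈ p
    rw [he]
    exact hp y _ hx
  rcases h.2 _ hp' with h0 | h0
  · left
    rw [eq_bot_iff]
    intro v hv
    have : e.symm v ∈ p.comap e.toLinearMap := by
      change e (e.symm v) ∈ p
      rwa [e.apply_symm_apply]
    rw [h0, Submodule.mem_bot] at this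
    rw [Submodule.mem_bot, ← e.apply_symm_apply v, this, map_zero]
  · right
    rw [eq_top_iff]
    intro v _
    have : e.symm v ∈ p.comap e.toLinearMap := h0 ▸ Submodule.mem_top
    change e (e.symm v) ∈ p at this
    rwa [e.apply_symm_apply] at this

theorem exists_common_simple_quotient [Module.Finite ℂ V] [Nontrivial V] (e : V ≃ₗ[ℂ] V')
    (he : ∀ y x, e (π y x) = π' y (e x)) :
    ∃ (q : Submodule ℂ V) (q' : Submodule ℂ V'), YStable π q ∧ YStable π' q' ∧
      ∃ (πq : Yangian n →ₐ[ℂ] Module.End ℂ (V ⧸ q)) (πq' : Yangian n →ₐ[ℂ] Module.End ℂ (V' ⧸ q')),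
        (∀ y x, πq y (q.mkQ x) = q.mkQ (π y x)) ∧ (∀ y x, πq' y (q'.mkQ x) = q'.mkQ (π' y x)) ∧
        YSimple πq ∧ YSimple πq' ∧
        ∃ e : (V ⧸ q) ≃ₗ[ℂ] (V' ⧸ q'), ∀ y x, e (πq y x) = πq' y (e x) := by
  obtain ⟨q, hq, hs⟩ := exists_simple_quotient π
  have hq' : YStable π' (q.map e.toLinearMap) := by
    rintro y _ ⟨x, hx, rfl⟩
    exact ⟨π y x, hq y x hx, he y x⟩
  have hee : ∀ y x, Submodule.Quotient.equiv q (q.map e.toLinearMap) e rfl (quotAct π q hq y x) =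
      quotAct π' _ hq' y (Submodule.Quotient.equiv q (q.map e.toLinearMap) e rfl x) := by
    intro y x
    obtain ⟨x, rfl⟩ := q.mkQ_surjective x
    change (q.map e.toLinearMap).mkQ (e (π y x)) = (q.map e.toLinearMap).mkQ (π' y (e x))
    rw [he]
  exact ⟨q, _, hq, hq', _, _, quotAct_mkQ hq, quotAct_mkQ hq', hs, ySimple_of_equiv _ hee hs, _, hee⟩

end SimpleQuotient

end HeckeAlg

namespace HeckeAlg

section MainTheorem

theorem domList_segs {r : ℕ} {L : Fin r → ℕ} {ν lam : Fin r → ℂ} (h : ∀ i, ν i + L i = lam i)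
    (hd : ∀ i j : Fin r, i < j → ∀ m : ℕ, lam i - lam j ≠ -((m : ℂ) + 1)) : DomList (segs L ν) := by
  unfold DomList segs
  rw [List.pairwise_ofFn]
  intro i j hij m
  rw [h, h]
  exact hd i j hij m

/-- A permutation matching the end points and the lengths of the segments gives equal double
cosets. -/
theorem exists_double_coset {r : ℕ} {lam μ : Fin r → ℂ} {w w' : Equiv.Perm (Fin r)}
    {L L' : Fin r → ℕ} (hw : ∀ i, lam i - μ (w⁻¹ i) = (L i : ℂ))
    (hw' : ∀ i, lam i - μ (w'⁻¹ i) = (L' i : ℂ)) {τ : Equiv.Perm (Fin r)}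
    (hτ : ∀ k, lam k = lam (τ k) ∧ L' k = L (τ k)) :
    ∃ a b : Equiv.Perm (Fin r),
      (∀ i, lam (a⁻¹ i) = lam i) ∧ (∀ i, μ (b⁻¹ i) = μ i) ∧ w' = a * w * b := by
  refine ⟨τ⁻¹, w⁻¹ * τ * w', fun i => ?_, fun i => ?_, by group⟩
  · rw [inv_inv]; exact (hτ i).1.symm
  · have h1 := hw (w i)
    have h2 := hw' (τ⁻¹ (w i))
    have h3 := hτ (τ⁻¹ (w i))
    rw [show τ (τ⁻¹ (w i)) = w i from τ.apply_symm_apply _] at h3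
    rw [show w⁻¹ (w i) = i from w.symm_apply_apply i] at h1
    rw [h3.1, h3.2, ← h1] at h2
    have e : (w⁻¹ * τ * w')⁻¹ i = w'⁻¹ (τ⁻¹ (w i)) := by
      rw [show (w⁻¹ * τ * w')⁻¹ = w'⁻¹ * τ⁻¹ * w by group]; rfl
    rw [e]
    linear_combination -h2

theorem segs_perm_of_double_coset {r : ℕ} {lam μ : Fin r → ℂ} {w w' a b : Equiv.Perm (Fin r)}
    {L L' : Fin r → ℕ} (hw : ∀ i, lam i - μ (w⁻¹ i) = (L i : ℂ))
    (hw' : ∀ i, lam i - μ (w'⁻¹ i) = (L' i : ℂ)) (ha : ∀ i, lam (a⁻¹ i) = lam i)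
    (hb : ∀ i, μ (b⁻¹ i) = μ i) (h : w' = a * w * b) :
    (segs L fun i => μ (w⁻¹ i)).Perm (segs L' fun i => μ (w'⁻¹ i)) := by
  have hμ : ∀ i, μ (w'⁻¹ i) = μ (w⁻¹ (a⁻¹ i)) := by
    intro i
    rw [h, show (a * w * b)⁻¹ = b⁻¹ * (w⁻¹ * a⁻¹) by group, Equiv.Perm.mul_apply, hb]
    rfl
  have hL : ∀ i, L' i = L (a⁻¹ i) := by
    intro i
    have h1 := hw (a⁻¹ i)
    have h2 := hw' i
    rw [hμ, ← ha i, h1] at h2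
    exact_mod_cast h2.symm
  have e : (segs L' fun i => μ (w'⁻¹ i)) = List.ofFn ((fun k => (μ (w⁻¹ k), L k)) ∘ (a⁻¹ : Equiv.Perm _)) := by
    unfold segs
    congr 1
    funext i
    exact Prod.ext (hμ i) (hL i)
  rw [e]
  exact (Equiv.Perm.ofFn_comp_perm a⁻¹ fun k => (μ (w⁻¹ k), L k)).symm

end MainTheorem

end HeckeAlg

end HeckeLemmas

/-- Let `λ, μ ∈ ℂ^r` both be dominant and `w, w' ∈ W_r` with
`w·μ, w'·μ ∈ S^{(n)}(λ;ℓ)` (encoded by `Lw i = λ_i − μ_{w⁻¹(i)}` etc.). Then the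
following are equivalent: (1) `D_ℓ(K(λ,w·μ)) ≅ D_ℓ(K(λ,w'·μ))` as `Y(gl_n)`-modules;
(2) some simple `Y(gl_n)`-quotient of `D_ℓ(K(λ,w·μ))` is isomorphic to some simple
`Y(gl_n)`-quotient of `D_ℓ(K(λ,w'·μ))`; (3) `W_λ w W_μ = W_λ w' W_μ`. -/
theorem statement5 (n ℓ r : ℕ) (hn : 0 < n) (hℓ : 0 < ℓ) (hr : 0 < r)
    (lam μ : Fin r → ℂ)
    (hdomLam : ∀ i j : Fin r, i < j → ∀ m : ℕ, lam i - lam j ≠ -((m : ℂ) + 1))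
    (hdomμ : ∀ i j : Fin r, i < j → ∀ m : ℕ, μ i - μ j ≠ -((m : ℂ) + 1))
    (w w' : Equiv.Perm (Fin r))
    (Lw Lw' : Fin r → ℕ)
    (hw : ∀ i, lam i - μ (w⁻¹ i) = (Lw i : ℂ))
    (hw' : ∀ i, lam i - μ (w'⁻¹ i) = (Lw' i : ℂ))
    (hwsum : ∑ i, Lw i = ℓ) (hw'sum : ∑ i, Lw' i = ℓ)
    (hwn : ∀ i, Lw i ≤ n) (hw'n : ∀ i, Lw' i ≤ n)
    (π₁ : Yangian n →ₐ[ℂ] Module.End ℂ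
      (Dmod n (quotRho (KIdeal ℓ Lw (fun i => μ (w⁻¹ i))))))
    (hπ₁ : IsDrinfeldAction n (quotRho (KIdeal ℓ Lw (fun i => μ (w⁻¹ i)))) π₁)
    (π₂ : Yangian n →ₐ[ℂ] Module.End ℂ
      (Dmod n (quotRho (KIdeal ℓ Lw' (fun i => μ (w'⁻¹ i))))))
    (hπ₂ : IsDrinfeldAction n (quotRho (KIdeal ℓ Lw' (fun i => μ (w'⁻¹ i)))) π₂) :
    -- (1) ↔ (3)
    ((∃ e : Dmod n (quotRho (KIdeal ℓ Lw (fun i => μ (w⁻¹ i)))) ≃ₗ[ℂ]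
          Dmod n (quotRho (KIdeal ℓ Lw' (fun i => μ (w'⁻¹ i)))),
        ∀ y x, e (π₁ y x) = π₂ y (e x)) ↔
      (∃ a b : Equiv.Perm (Fin r),
        (∀ i, lam (a⁻¹ i) = lam i) ∧ (∀ i, μ (b⁻¹ i) = μ i) ∧ w' = a * w * b)) ∧
    -- (2) ↔ (3)
    ((∃ (q₁ : Submodule ℂ (Dmod n (quotRho (KIdeal ℓ Lw (fun i => μ (w⁻¹ i))))))
        (q₂ : Submodule ℂ (Dmod n (quotRho (KIdeal ℓ Lw' (fun i => μ (w'⁻¹ i)))))),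
        YStable π₁ q₁ ∧ YStable π₂ q₂ ∧
        ∃ (πq₁ : Yangian n →ₐ[ℂ] Module.End ℂ
            (Dmod n (quotRho (KIdeal ℓ Lw (fun i => μ (w⁻¹ i)))) ⧸ q₁))
          (πq₂ : Yangian n →ₐ[ℂ] Module.End ℂ
            (Dmod n (quotRho (KIdeal ℓ Lw' (fun i => μ (w'⁻¹ i)))) ⧸ q₂)),
          (∀ y x, πq₁ y (q₁.mkQ x) = q₁.mkQ (π₁ y x)) ∧
          (∀ y x, πq₂ y (q₂.mkQ x) = q₂.mkQ (π₂ y x)) ∧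
          YSimple πq₁ ∧ YSimple πq₂ ∧
          ∃ e : (Dmod n (quotRho (KIdeal ℓ Lw (fun i => μ (w⁻¹ i)))) ⧸ q₁) ≃ₗ[ℂ]
              (Dmod n (quotRho (KIdeal ℓ Lw' (fun i => μ (w'⁻¹ i)))) ⧸ q₂),
            ∀ y x, e (πq₁ y x) = πq₂ y (e x)) ↔
      (∃ a b : Equiv.Perm (Fin r),
        (∀ i, lam (a⁻¹ i) = lam i) ∧ (∀ i, μ (b⁻¹ i) = μ i) ∧ w' = a * w * b)) := by
  have hν : ∀ i, μ (w⁻¹ i) + Lw i = lam i := fun i => by linear_combination -hw i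
  have hν' : ∀ i, μ (w'⁻¹ i) + Lw' i = lam i := fun i => by linear_combination -hw' i
  have hd := HeckeAlg.domList_segs hν hdomLam
  have hd' := HeckeAlg.domList_segs hν' hdomLam
  have hsimple := fun (h : ∃ e : Dmod n (quotRho (KIdeal ℓ Lw (fun i => μ (w⁻¹ i)))) ≃ₗ[ℂ]
      Dmod n (quotRho (KIdeal ℓ Lw' (fun i => μ (w'⁻¹ i)))), ∀ y x, e (π₁ y x) = π₂ y (e x)) =>
    have := HeckeAlg.nontrivial_Dmod_standard hwsum hwn hd
    have := HeckeAlg.finite_Dmod_standard (n := n) (fun i => μ (w⁻¹ i)) hwsum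
    HeckeAlg.exists_common_simple_quotient h.choose h.choose_spec
  have hiso : (∃ a b : Equiv.Perm (Fin r),
      (∀ i, lam (a⁻¹ i) = lam i) ∧ (∀ i, μ (b⁻¹ i) = μ i) ∧ w' = a * w * b) →
      ∃ e : Dmod n (quotRho (KIdeal ℓ Lw (fun i => μ (w⁻¹ i)))) ≃ₗ[ℂ]
        Dmod n (quotRho (KIdeal ℓ Lw' (fun i => μ (w'⁻¹ i)))), ∀ y x, e (π₁ y x) = π₂ y (e x) := by
    rintro ⟨a, b, ha, hb, hab⟩
    obtain ⟨φ, hφ⟩ := HeckeAlg.stdIso_of_perm hwsum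
      (HeckeAlg.segs_perm_of_double_coset hw hw' ha hb hab) hd hd'
    exact HeckeAlg.exists_yangian_equiv φ (fun h x => hφ (HeckeAlg.ofHecke h) x) hπ₁ hπ₂
  have hcoset : ∀ (q₁ : Submodule ℂ (Dmod n (quotRho (KIdeal ℓ Lw (fun i => μ (w⁻¹ i))))))
      (q₂ : Submodule ℂ (Dmod n (quotRho (KIdeal ℓ Lw' (fun i => μ (w'⁻¹ i)))))),
      YStable π₁ q₁ → YStable π₂ q₂ →
      ∀ (πq₁ : Yangian n →ₐ[ℂ] Module.End ℂ
          (Dmod n (quotRho (KIdeal ℓ Lw (fun i => μ (w⁻¹ i)))) ⧸ q₁))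
        (πq₂ : Yangian n →ₐ[ℂ] Module.End ℂ
          (Dmod n (quotRho (KIdeal ℓ Lw' (fun i => μ (w'⁻¹ i)))) ⧸ q₂)),
      (∀ y x, πq₁ y (q₁.mkQ x) = q₁.mkQ (π₁ y x)) → (∀ y x, πq₂ y (q₂.mkQ x) = q₂.mkQ (π₂ y x)) →
      YSimple πq₁ → YSimple πq₂ →
      ∀ e : (Dmod n (quotRho (KIdeal ℓ Lw (fun i => μ (w⁻¹ i)))) ⧸ q₁) ≃ₗ[ℂ]
          (Dmod n (quotRho (KIdeal ℓ Lw' (fun i => μ (w'⁻¹ i)))) ⧸ q₂),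
      (∀ y x, e (πq₁ y x) = πq₂ y (e x)) →
      ∃ a b : Equiv.Perm (Fin r),
        (∀ i, lam (a⁻¹ i) = lam i) ∧ (∀ i, μ (b⁻¹ i) = μ i) ∧ w' = a * w * b := by
    intro q₁ q₂ hq₁ hq₂ πq₁ πq₂ hπq₁ hπq₂ hs₁ hs₂ e he
    obtain ⟨τ, hτ⟩ := HeckeAlg.exists_perm_of_levelPoly hwn hw'n hν hν' fun j hj t =>
      HeckeAlg.levelPoly_eq_of_equiv hwsum hwn hd hπ₁ hq₁ (Submodule.Quotient.nontrivial_iff.1 hs₁.1)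
        hπq₁ hw'sum hw'n hd' hπ₂ hq₂ (Submodule.Quotient.nontrivial_iff.1 hs₂.1) hπq₂ e he hj t
    exact HeckeAlg.exists_double_coset hw hw' hτ
  refine ⟨⟨fun h => ?_, hiso⟩, ⟨?_, fun h => hsimple (hiso h)⟩⟩
  · obtain ⟨q₁, q₂, hq₁, hq₂, πq₁, πq₂, hπq₁, hπq₂, hs₁, hs₂, e, he⟩ := hsimple h
    exact hcoset q₁ q₂ hq₁ hq₂ πq₁ πq₂ hπq₁ hπq₂ hs₁ hs₂ e he
  · rintro ⟨q₁, q₂, hq₁, hq₂, πq₁, πq₂, hπq₁, hπq₂, hs₁, hs₂, e, he⟩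
    exact hcoset q₁ q₂ hq₁ hq₂ πq₁ πq₂ hπq₁ hπq₂ hs₁ hs₂ e he
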